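/- arXiv:2001.01149 — 4 statements merged into one kernel-verified Lean document; each statement's English description precedes it below -/
import Mathlib

section
/- Let k = k(n) be a sequence of positive integers with k(n) = o(n^{1/100}) as n → ∞. For each n ≥ 3, let H_1, …, H_{k(n)} be Hamilton cycles in the complete graph K_n, chosen independently and uniformly at random from the set of all Hamilton cycles of K_n. Let p(n) denote the probability that H_1, …, H_{k(n)} are pairwise edge-disjoint. Then p(n)·e^{2·binom(k(n),2)} → 1 as n → ∞; that is, p(n) = (1+o(1))·e^{-2·binom(k(n),2)}. -/
/-- `E` is the edge set of a Hamilton cycle of the complete graph on `Fin n`. -/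
def IsHamCycle (n : ℕ) (E : Finset (Sym2 (Fin n))) : Prop :=
  ∃ (v : Fin n) (w : (⊤ : SimpleGraph (Fin n)).Walk v v),
    w.IsHamiltonianCycle ∧ E = w.edges.toFinset

namespace HamAux
open Finset

/-- Edge set of the cyclic ordering `π`. -/
def cyc (m : ℕ) (π : Equiv.Perm (Fin (m+1))) : Finset (Sym2 (Fin (m+1))) :=
  univ.image fun i => s(π i, π (i+1))

lemma mem_walk_edges {V : Type*} {G : SimpleGraph V} {u v : V} (w : G.Walk u v) (e : Sym2 V) :
    e ∈ w.edges ↔ ∃ i, i < w.length ∧ e = s(w.getVert i, w.getVert (i+1)) := by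
  induction w with
  | nil => simp
  | cons h p ih =>
    rw [SimpleGraph.Walk.edges_cons, List.mem_cons, ih]
    constructor
    · rintro (rfl | ⟨i, hi, rfl⟩)
      · exact ⟨0, by simp, by simp⟩
      · exact ⟨i+1, by simpa using hi, by simp⟩
    · rintro ⟨i, hi, rfl⟩
      cases i with
      | zero => left; simp
      | succ i => right; exact ⟨i, by simpa using hi, by simp⟩

lemma walk_edges_eq {m : ℕ} {G : SimpleGraph (Fin (m+1))} {v : Fin (m+1)} (w : G.Walk v v)
    (hl : w.length = m+1) (π : Equiv.Perm (Fin (m+1))) (h : ∀ i : Fin (m+1), π i = w.getVert i) :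
    w.edges.toFinset = cyc m π := by
  have key : ∀ i : Fin (m+1), π (i+1) = w.getVert ((i:ℕ)+1) := by
    intro i
    rw [h]
    by_cases hi : i = Fin.last m
    · subst hi
      have := w.getVert_length
      rw [hl] at this
      simp [this]
    · rw [Fin.val_add_one_of_lt (Fin.lt_last_iff_ne_last.2 hi)]
  ext e
  simp only [List.mem_toFinset, mem_walk_edges, cyc, mem_image, mem_univ, true_and, hl, key, h]
  constructor
  · rintro ⟨i, hi, rfl⟩; exact ⟨⟨i, hi⟩, rfl⟩
  · rintro ⟨i, rfl⟩; exact ⟨i, i.2, rfl⟩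

lemma isHamCycle_iff (m : ℕ) (hm : 2 ≤ m) (E : Finset (Sym2 (Fin (m+1)))) :
    IsHamCycle (m+1) E ↔ ∃ π, E = cyc m π := by
  constructor
  · rintro ⟨v, w, hw, rfl⟩
    have hl : w.length = m+1 := by simpa using hw.length_eq
    have inj : Function.Injective (fun i : Fin (m+1) => w.getVert i) := by
      intro i j hij
      have := hw.isCycle.getVert_injOn' (x₁ := i) (by simp; omega) (x₂ := j) (by simp; omega) hij
      exact Fin.ext this
    let π : Equiv.Perm (Fin (m+1)) :=
      Equiv.ofBijective _ (Finite.injective_iff_bijective.1 inj)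
    exact ⟨π, walk_edges_eq w hl π fun i => rfl⟩
  · rintro ⟨π, rfl⟩
    obtain ⟨n, rfl⟩ : ∃ n, m = n + 2 := ⟨m-2, by omega⟩
    let f : SimpleGraph.cycleGraph (n+3) →g (⊤ : SimpleGraph (Fin (n+3))) :=
      ⟨fun a => π (-a), fun {a b} h => by simpa using h.ne⟩
    have hw0 : (SimpleGraph.cycleGraph.cycle n).IsHamiltonianCycle :=
      SimpleGraph.Walk.isHamiltonianCycle_iff_isCycle_and_length_eq.2
        ⟨SimpleGraph.cycleGraph.isCycle_cycle, by simp⟩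
    have hf : Function.Bijective f := π.bijective.comp (Equiv.neg _).bijective
    refine ⟨_, _, hw0.map hf, ?_⟩
    symm
    apply walk_edges_eq
    · simp
    · intro i
      rw [SimpleGraph.Walk.getVert_map, SimpleGraph.cycleGraph.getVert_cycle i.2.le]
      change π i = π (-_)
      congr 1
      rw [eq_neg_iff_add_eq_zero]
      ext
      simp [Fin.val_add]

/-- reversal of the initial segment `[0, i]` -/
def rev {m : ℕ} (i : Fin (m+1)) : Equiv.Perm (Fin (m+1)) :=
  Function.Involutive.toPerm (fun t => if t ≤ i then i - t else t) (by
    intro t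
    by_cases h : t ≤ i
    · have h1 : i - t ≤ i := by
        rw [Fin.le_def, Fin.sub_val_of_le h]; omega
      simp [h, h1]
    · simp [h])

variable {m : ℕ}

lemma rev_of_le {i t : Fin (m+1)} (h : t ≤ i) : rev i t = i - t := by
  change (if t ≤ i then i - t else t) = _
  simp [h]

lemma rev_of_lt {i t : Fin (m+1)} (h : i < t) : rev i t = t := by
  change (if t ≤ i then i - t else t) = _
  simp [not_le.2 h]

@[simp] lemma rev_rev (i t : Fin (m+1)) : rev i (rev i t) = t :=
  (Function.Involutive.toPerm_involutive _) t

@[simp] lemma rev_zero (i : Fin (m+1)) : rev i 0 = i := by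
  rw [rev_of_le (Fin.zero_le _)]; simp
@[simp] lemma rev_self (i : Fin (m+1)) : rev i i = 0 := by
  rw [rev_of_le le_rfl]; simp

lemma rev_last {i : Fin (m+1)} (h : i ≠ Fin.last m) : rev i (Fin.last m) = Fin.last m :=
  rev_of_lt (Fin.lt_last_iff_ne_last.2 h)

lemma lt_succ {i : Fin (m+1)} (h : i ≠ Fin.last m) : i < i + 1 :=
  Fin.lt_add_one_iff.2 (Fin.lt_last_iff_ne_last.2 h)

/-- `π` avoids the edge set `F`. -/
def Avoid (F : Finset (Sym2 (Fin (m+1)))) (π : Equiv.Perm (Fin (m+1))) : Prop :=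
  ∀ i, s(π i, π (i+1)) ∉ F

lemma val_succ {i : Fin (m+1)} (h : i ≠ Fin.last m) : ((i+1 : Fin (m+1)) : ℕ) = i + 1 :=
  Fin.val_add_one_of_lt (Fin.lt_last_iff_ne_last.2 h)

lemma rev_succ_of_lt {i t : Fin (m+1)} (h : t < i) : rev i t = rev i (t+1) + 1 := by
  have ht : t ≠ Fin.last m := (h.trans_le (Fin.le_last _)).ne
  have h2 : t + 1 ≤ i := by
    rw [Fin.le_def, val_succ ht]; exact h
  rw [rev_of_le h.le, rev_of_le h2]
  abel

lemma avoid_rev {F : Finset (Sym2 (Fin (m+1)))} {π : Equiv.Perm (Fin (m+1))} (h : Avoid F π)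
    {i : Fin (m+1)} (hi : i ≠ Fin.last m) (h0 : s(π 0, π (i+1)) ∉ F)
    (h1 : s(π (Fin.last m), π i) ∉ F) : Avoid F ((rev i).trans π) := by
  intro t
  simp only [Equiv.trans_apply]
  rcases lt_trichotomy t i with ht | ht | ht
  · rw [rev_succ_of_lt ht, Sym2.eq_swap]
    exact h _
  · subst ht
    rw [rev_self, rev_of_lt (lt_succ hi)]
    exact h0
  · by_cases hl : t = Fin.last m
    · subst hl
      rw [rev_last hi, Fin.last_add_one, rev_zero]
      exact h1
    · rw [rev_of_lt ht, rev_of_lt (ht.trans (lt_succ hl))]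
      exact h _

/-- neighbours -/
def nb (F : Finset (Sym2 (Fin (m+1)))) (x : Fin (m+1)) : Finset (Fin (m+1)) :=
  univ.filter fun y => s(x,y) ∈ F

lemma mem_nb {F : Finset (Sym2 (Fin (m+1)))} {x y : Fin (m+1)} : y ∈ nb F x ↔ s(x,y) ∈ F := by
  simp [nb]

open Classical in
/-- avoiding orderings with last vertex `u` -/
noncomputable def Om (F : Finset (Sym2 (Fin (m+1)))) (u : Fin (m+1)) :
    Finset (Equiv.Perm (Fin (m+1))) :=
  univ.filter fun π => Avoid F π ∧ π (Fin.last m) = u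

lemma mem_Om {F : Finset (Sym2 (Fin (m+1)))} {u : Fin (m+1)} {π : Equiv.Perm (Fin (m+1))} :
    π ∈ Om F u ↔ Avoid F π ∧ π (Fin.last m) = u := by simp [Om]

open Classical in
/-- admissible switches -/
noncomputable def good (F : Finset (Sym2 (Fin (m+1)))) (π : Equiv.Perm (Fin (m+1))) :
    Finset (Fin (m+1)) :=
  univ.filter fun i => i ≠ Fin.last m ∧ s(π 0, π (i+1)) ∉ F ∧ s(π (Fin.last m), π i) ∉ F

lemma rev_mem_Om {F : Finset (Sym2 (Fin (m+1)))} {u : Fin (m+1)} {π : Equiv.Perm (Fin (m+1))}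
    (h : π ∈ Om F u) {i} (hi : i ∈ good F π) : (rev i).trans π ∈ Om F u := by
  rw [mem_Om] at h ⊢
  simp only [good, mem_filter, mem_univ, true_and] at hi
  exact ⟨avoid_rev h.1 hi.1 hi.2.1 hi.2.2, by simp [rev_last hi.1, h.2]⟩

lemma card_good {F : Finset (Sym2 (Fin (m+1)))} {d : ℕ} (hd : ∀ x, (nb F x).card ≤ d)
    (π : Equiv.Perm (Fin (m+1))) : m ≤ (good F π).card + 2 * d := by
  classical
  have hsub : (univ : Finset (Fin (m+1))) ⊆ good F π ∪ ({Fin.last m} ∪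
      ((nb F (π 0)).image (fun y => π.symm y - 1) ∪
        (nb F (π (Fin.last m))).image (fun y => π.symm y))) := by
    intro i _
    simp only [mem_union, good, mem_filter, mem_univ, true_and, mem_singleton, mem_image, nb]
    by_cases h1 : i = Fin.last m
    · exact Or.inr (Or.inl h1)
    by_cases h2 : s(π 0, π (i+1)) ∈ F
    · exact Or.inr (Or.inr (Or.inl ⟨_, h2, by simp⟩))
    by_cases h3 : s(π (Fin.last m), π i) ∈ F
    · exact Or.inr (Or.inr (Or.inr ⟨_, h3, by simp⟩))
    exact Or.inl ⟨h1, h2, h3⟩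
  have := card_le_card hsub
  have a1 := card_union_le (good F π) ({Fin.last m} ∪
      ((nb F (π 0)).image (fun y => π.symm y - 1) ∪
        (nb F (π (Fin.last m))).image (fun y => π.symm y)))
  have a2 := card_union_le {Fin.last m}
      ((nb F (π 0)).image (fun y => π.symm y - 1) ∪
        (nb F (π (Fin.last m))).image (fun y => π.symm y))
  have a3 := card_union_le ((nb F (π 0)).image (fun y => π.symm y - 1))
        ((nb F (π (Fin.last m))).image (fun y => π.symm y))
  have a4 := (card_image_le (s := nb F (π 0)) (f := fun y => π.symm y - 1)).trans (hd _)
  have a5 := (card_image_le (s := nb F (π (Fin.last m))) (f := fun y => π.symm y)).trans (hd _)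
  simp only [card_univ, Fintype.card_fin, card_singleton] at *
  omega

open Classical in
/-- orderings with last vertex `u` and first vertex `v` -/
noncomputable def Bs (F : Finset (Sym2 (Fin (m+1)))) (u v : Fin (m+1)) :
    Finset (Equiv.Perm (Fin (m+1))) :=
  (Om F u).filter fun π => π 0 = v

lemma trans_inj {i : Fin (m+1)} {π π' : Equiv.Perm (Fin (m+1))}
    (h : (rev i).trans π = (rev i).trans π') : π = π' := by
  ext t
  have := congrArg (fun σ => σ (rev i t)) h
  simpa using congrArg Fin.val this

lemma card_Bs_upper {F : Finset (Sym2 (Fin (m+1)))} {d : ℕ} (hd : ∀ x, (nb F x).card ≤ d)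
    (u v : Fin (m+1)) : (Bs F u v).card * (m - 2 * d) ≤ (Om F u).card := by
  classical
  calc (Bs F u v).card * (m - 2 * d) ≤ ∑ π ∈ Bs F u v, (good F π).card := by
        rw [← smul_eq_mul]
        exact card_nsmul_le_sum _ _ _ fun π _ => by have := card_good hd π; omega
    _ = ((Bs F u v).sigma fun π => good F π).card := by rw [card_sigma]
    _ ≤ (Om F u).card := by
        apply card_le_card_of_injOn (fun p => (rev p.2).trans p.1)
        · rintro ⟨π, i⟩ h
          simp only [coe_sigma, Set.mem_sigma_iff, mem_coe, Bs, mem_filter] at h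
          exact rev_mem_Om h.1.1 h.2
        · rintro ⟨π, i⟩ h ⟨π', i'⟩ h' heq
          simp only [coe_sigma, Set.mem_sigma_iff, mem_coe, Bs, mem_filter] at h h' heq
          have e1 : ((rev i).trans π) i = v := by simp [h.1.2]
          have e2 : ((rev i).trans π) i' = v := by rw [heq]; simp [h'.1.2]
          have e3 : i = i' := ((rev i).trans π).injective (e1.trans e2.symm)
          subst e3
          rw [trans_inj heq]

open Classical in
/-- bad orderings -/
noncomputable def bad (F : Finset (Sym2 (Fin (m+1)))) (u v : Fin (m+1)) :
    Finset (Equiv.Perm (Fin (m+1))) :=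
  (Om F u).filter fun π => s(π 0, π (π.symm v + 1)) ∈ F

lemma card_Bs_lower {F : Finset (Sym2 (Fin (m+1)))} 
    {u v : Fin (m+1)} (huv : u ≠ v) (he : s(u,v) ∉ F) :
    (Om F u).card ≤ (bad F u v).card + (Bs F u v).card * m := by
  classical
  have h1 : (Om F u).card = (bad F u v).card +
      ((Om F u).filter fun π => ¬ s(π 0, π (π.symm v + 1)) ∈ F).card := by
    rw [bad, card_filter_add_card_filter_not]
  rw [h1]
  gcongr
  have h2 : (Bs F u v).card * m = ((Bs F u v) ×ˢ (univ.erase (Fin.last m))).card := by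
    simp
  rw [h2]
  apply card_le_card_of_injOn (fun π => ((rev (π.symm v)).trans π, π.symm v))
  · intro π h
    simp only [coe_filter, Set.mem_ofPred_eq, mem_Om] at h
    have hl : π.symm v ≠ Fin.last m := by
      intro hh
      apply huv
      rw [← h.1.2, ← hh]; simp
    simp only [coe_product, Set.mem_prod, mem_coe, Bs, mem_filter, mem_Om, mem_erase, mem_univ,
      and_true]
    refine ⟨⟨⟨avoid_rev h.1.1 hl h.2 ?_, ?_⟩, ?_⟩, hl⟩
    · simpa [h.1.2] using he
    · simp [rev_last hl, h.1.2]
    · simp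
  · intro π _ π' _ heq
    simp only [Prod.mk.injEq] at heq
    rw [← heq.2] at heq
    exact trans_inj heq.1

lemma card_bad {F : Finset (Sym2 (Fin (m+1)))} {d : ℕ} (hd : ∀ x, (nb F x).card ≤ d)
    {u v : Fin (m+1)} (huv : u ≠ v) : (bad F u v).card * (m - 2 * d) ≤ 2 * d * (Om F u).card := by
  classical
  calc (bad F u v).card * (m - 2 * d) ≤ ∑ π ∈ bad F u v, (good F π).card := by
        rw [← smul_eq_mul]
        exact card_nsmul_le_sum _ _ _ fun π _ => by have := card_good hd π; omega
    _ = ((bad F u v).sigma fun π => good F π).card := by rw [card_sigma]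
    _ ≤ ((Om F u).sigma fun π => nb F (π (π.symm v + 1)) ∪ nb F (π (π.symm v - 1))).card := by
        apply card_le_card_of_injOn (fun p => ⟨(rev p.2).trans p.1, p.1 0⟩)
        · rintro ⟨π, i⟩ h
          simp only [coe_sigma, Set.mem_sigma_iff, mem_coe, bad, mem_filter] at h
          obtain ⟨⟨hO, hb⟩, hg⟩ := h
          simp only [coe_sigma, Set.mem_sigma_iff, mem_coe]
          refine ⟨rev_mem_Om hO hg, ?_⟩
          simp only [good, mem_filter, mem_univ, true_and] at hg
          have hl : π.symm v ≠ Fin.last m := by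
            intro hh
            apply huv
            rw [← (mem_Om.1 hO).2, ← hh]; simp
          have hs : ((rev i).trans π).symm v = rev i (π.symm v) := by
            rw [Equiv.symm_apply_eq]; simp
          rw [hs]
          simp only [Equiv.trans_apply, mem_union, mem_nb]
          rw [Sym2.eq_swap] at hb
          rcases lt_trichotomy (π.symm v) i with hj | hj | hj
          · right
            rw [rev_succ_of_lt hj]
            simpa using hb
          · exfalso
            rw [hj, Sym2.eq_swap] at hb
            exact hg.2.1 hb
          · left
            rw [rev_of_lt hj, rev_of_lt (hj.trans (lt_succ hl))]
            exact hb
        · rintro ⟨π, i⟩ h ⟨π', i'⟩ h' heq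
          simp only [Sigma.mk.injEq, heq_eq_eq] at heq
          obtain ⟨heq, h0⟩ := heq
          have e1 : ((rev i).trans π) i = π 0 := by simp
          have e2 : ((rev i).trans π) i' = π 0 := by rw [heq, h0]; simp
          have e3 : i = i' := ((rev i).trans π).injective (e1.trans e2.symm)
          subst e3
          rw [trans_inj heq]
    _ ≤ 2 * d * (Om F u).card := by
        rw [card_sigma, mul_comm, ← smul_eq_mul]
        apply sum_le_card_nsmul
        intro π _
        have := card_union_le (nb F (π (π.symm v + 1))) (nb F (π (π.symm v - 1)))
        have := hd (π (π.symm v + 1))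
        have := hd (π (π.symm v - 1))
        omega

lemma card_Om_insert (hm : 2 ≤ m) {F : Finset (Sym2 (Fin (m+1)))}
    {u v : Fin (m+1)} :
    (Om F u).card = (Om (insert s(u,v) F) u).card + 2 * (Bs F u v).card := by
  classical
  -- orderings with `v` just before the last
  let C := (Om F u).filter fun π => π (Fin.last m - 1) = v
  have hl0 : Fin.last m ≠ 0 := by
    intro h; have := congrArg Fin.val h; simp at this; omega
  have hl1 : Fin.last m - 1 ≠ Fin.last m := by
    intro h
    have h' : (1 : Fin (m+1)) = 0 := by simpa using h
    have := congrArg Fin.val h'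
    rw [Fin.val_one', Nat.mod_eq_of_lt (by omega)] at this
    simp at this
  have hl2 : Fin.last m - 1 ≠ 0 := by
    intro h
    have h' : Fin.last m = 1 := sub_eq_zero.1 h
    have := congrArg Fin.val h'
    rw [Fin.val_one', Nat.mod_eq_of_lt (by omega)] at this
    simp at this; omega
  have hC : C.card = (Bs F u v).card := by
    refine card_bij' (fun π _ => (rev (Fin.last m - 1)).trans π)
      (fun π _ => (rev (Fin.last m - 1)).trans π) ?_ ?_ ?_ ?_
    · intro π h
      simp only [C, Bs, mem_filter, mem_Om] at h ⊢
      refine ⟨⟨avoid_rev h.1.1 hl1 ?_ ?_, ?_⟩, ?_⟩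
      · have := h.1.1 (Fin.last m); rw [Sym2.eq_swap]; simpa using this
      · have := h.1.1 (Fin.last m - 1); rw [Sym2.eq_swap]; simpa using this
      · simp [rev_last hl1, h.1.2]
      · simp [h.2]
    · intro π h
      simp only [C, Bs, mem_filter, mem_Om] at h ⊢
      refine ⟨⟨avoid_rev h.1.1 hl1 ?_ ?_, ?_⟩, ?_⟩
      · have := h.1.1 (Fin.last m); rw [Sym2.eq_swap]; simpa using this
      · have := h.1.1 (Fin.last m - 1); rw [Sym2.eq_swap]; simpa using this
      · simp [rev_last hl1, h.1.2]
      · simp [h.2]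
    · intro π _; ext t; simp
    · intro π _; ext t; simp
  have hdis : Disjoint (Bs F u v) C := by
    rw [disjoint_left]
    intro π h1 h2
    simp only [C, Bs, mem_filter] at h1 h2
    exact hl2 (π.injective (h2.2.trans h1.2.symm))
  have hO : Om F u = Om (insert s(u,v) F) u ∪ (Bs F u v ∪ C) := by
    ext π
    simp only [C, Bs, mem_union, mem_filter, mem_Om]
    constructor
    · rintro ⟨ha, hu⟩
      by_cases h1 : π 0 = v
      · exact Or.inr (Or.inl ⟨⟨ha, hu⟩, h1⟩)
      by_cases h2 : π (Fin.last m - 1) = v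
      · exact Or.inr (Or.inr ⟨⟨ha, hu⟩, h2⟩)
      refine Or.inl ⟨?_, hu⟩
      intro i hi
      rw [mem_insert] at hi
      rcases hi with hi | hi
      · rw [Sym2.eq_iff] at hi
        rcases hi with ⟨hi, hj⟩ | ⟨hi, hj⟩
        · have : i = Fin.last m := π.injective (hi.trans hu.symm)
          subst this
          apply h1; simpa using hj
        · have : i + 1 = Fin.last m := π.injective (hj.trans hu.symm)
          rw [← this] at h2
          apply h2; simpa using hi
      · exact ha i hi
    · rintro (⟨h, hu⟩ | h | h)
      · exact ⟨fun i hi => h i (mem_insert_of_mem hi), hu⟩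
      · exact h.1
      · exact h.1
  have hdis2 : Disjoint (Om (insert s(u,v) F) u) (Bs F u v ∪ C) := by
    rw [disjoint_left]
    intro π h1 h2
    simp only [C, Bs, mem_filter, mem_union, mem_Om] at h1 h2
    rcases h2 with h2 | h2
    · apply h1.1 (Fin.last m)
      simp [h1.2, h2.2]
    · apply h1.1 (Fin.last m - 1)
      simp [h1.2, h2.2, Sym2.eq_swap]
  conv_lhs => rw [hO]
  rw [card_union_of_disjoint hdis2, card_union_of_disjoint hdis, hC]
  ring

open Classical in
/-- all orderings avoiding `F` -/
noncomputable def Wf (F : Finset (Sym2 (Fin (m+1)))) : Finset (Equiv.Perm (Fin (m+1))) :=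
  univ.filter fun π => Avoid F π

lemma card_Wf (F : Finset (Sym2 (Fin (m+1)))) (u : Fin (m+1)) :
    (Wf F).card = (m+1) * (Om F u).card := by
  classical
  have h := card_eq_sum_card_fiberwise (s := Wf F) (t := univ) (f := fun π => π.symm u)
    (fun _ _ => mem_coe.2 (mem_univ _))
  rw [h]
  have h2 : ∀ i : Fin (m+1), ((Wf F).filter fun π => π.symm u = i).card = (Om F u).card := by
    intro i
    refine card_bij' (fun π _ => (Equiv.addRight (i - Fin.last m)).trans π)
      (fun π _ => (Equiv.addRight (Fin.last m - i)).trans π) ?_ ?_ ?_ ?_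
    · intro π h
      simp only [Wf, mem_filter, mem_univ, true_and, mem_Om] at h ⊢
      refine ⟨fun t => ?_, ?_⟩
      · have := h.1 (t + (i - Fin.last m))
        simpa [add_right_comm] using this
      · simp [← h.2]
    · intro π h
      simp only [Wf, mem_filter, mem_univ, true_and, mem_Om] at h ⊢
      refine ⟨fun t => ?_, ?_⟩
      · have := h.1 (t + (Fin.last m - i))
        simpa [add_right_comm] using this
      · rw [Equiv.symm_apply_eq]; simp [h.2]
    · intro π _; ext t; simp [add_assoc]
    · intro π _; ext t; simp [add_assoc]
  simp [h2]

lemma nb_mono {F F' : Finset (Sym2 (Fin (m+1)))} (h : F ⊆ F') (x : Fin (m+1)) :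
    nb F x ⊆ nb F' x := by
  intro y hy
  rw [mem_nb] at *
  exact h hy

/-- lower factor -/
noncomputable def lo (m d : ℕ) : ℝ := 1 - 2 / ((m:ℝ) - 2 * d)
/-- upper factor -/
noncomputable def hi (m d : ℕ) : ℝ := 1 - 2 / (m:ℝ) * (1 - 2 * d / ((m:ℝ) - 2 * d))

lemma lo_nonneg {d : ℕ} (h : 2 * d + 2 ≤ m) : 0 ≤ lo m d := by
  have : (2 * d + 2 : ℝ) ≤ m := by exact_mod_cast h
  rw [lo, sub_nonneg, div_le_one (by linarith)]
  linarith

lemma hi_nonneg {d : ℕ} (h : 2 * d + 2 ≤ m) : 0 ≤ hi m d := by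
  have h1 : (2 * d + 2 : ℝ) ≤ m := by exact_mod_cast h
  have h0 : (0:ℝ) ≤ d := by positivity
  have h2 : (2:ℝ) / m ≤ 1 := by
    rw [div_le_one (by linarith)]; linarith
  have h3 : 0 ≤ 2 * d / ((m:ℝ) - 2 * d) := div_nonneg (by linarith) (by linarith)
  have h4 : (0:ℝ) ≤ 2 / m := by positivity
  rw [hi]
  nlinarith

lemma Om_step {d : ℕ} (h : 2 * d + 2 ≤ m) {F : Finset (Sym2 (Fin (m+1)))}
    (hd : ∀ x, (nb F x).card ≤ d) {u v : Fin (m+1)} (huv : u ≠ v) (he : s(u,v) ∉ F) :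
    lo m d * (Om F u).card ≤ (Om (insert s(u,v) F) u).card ∧
    ((Om (insert s(u,v) F) u).card : ℝ) ≤ hi m d * (Om F u).card := by
  have a1 := card_Bs_upper hd u v
  have a2 := card_Bs_lower huv he
  have a3 := card_bad hd huv
  rcases Nat.lt_or_ge m 2 with hm | hm
  · omega
  have a4 := card_Om_insert hm (F := F) (u := u) (v := v)
  have h1 : (2 * d + 2 : ℝ) ≤ m := by exact_mod_cast h
  have hsub : ((m - 2 * d : ℕ) : ℝ) = (m:ℝ) - 2 * d := by
    rw [Nat.cast_sub (by omega)]; push_cast; ring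
  generalize (Om (insert s(u,v) F) u).card = T' at *
  generalize (Om F u).card = T at *
  generalize (Bs F u v).card = B at *
  generalize (bad F u v).card = bd at *
  have b1 : (B:ℝ) * ((m:ℝ) - 2 * d) ≤ T := by rw [← hsub]; exact_mod_cast a1
  have b2 : (T:ℝ) ≤ bd + B * m := by exact_mod_cast a2
  have b3 : (bd:ℝ) * ((m:ℝ) - 2 * d) ≤ 2 * d * T := by rw [← hsub]; exact_mod_cast a3
  have b4 : (T:ℝ) = T' + 2 * B := by exact_mod_cast a4
  have d0 : (0:ℝ) ≤ d := by positivity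
  have hδ : (0:ℝ) < (m:ℝ) - 2 * d := by linarith
  have hm0 : (0:ℝ) < m := by linarith
  constructor
  · have : (B:ℝ) ≤ T / ((m:ℝ) - 2 * d) := (le_div_iff₀ hδ).2 b1
    have e : lo m d * T = T - 2 * (T / ((m:ℝ) - 2 * d)) := by rw [lo]; ring
    rw [e]; linarith
  · have c1 : (bd:ℝ) ≤ 2 * d * T / ((m:ℝ) - 2 * d) := (le_div_iff₀ hδ).2 b3
    have c2 : ((T:ℝ) - 2 * d * T / ((m:ℝ) - 2 * d)) / m ≤ B := by
      rw [div_le_iff₀ hm0]; linarith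
    have e : hi m d * T = T - 2 * (((T:ℝ) - 2 * d * T / ((m:ℝ) - 2 * d)) / m) := by rw [hi]; ring
    rw [e]; linarith

lemma Wf_bounds {d : ℕ} (h : 2 * d + 2 ≤ m) (F : Finset (Sym2 (Fin (m+1)))) :
    (∀ x, (nb F x).card ≤ d) → (∀ e ∈ F, ¬ e.IsDiag) →
    lo m d ^ F.card * (Wf (m := m) ∅).card ≤ (Wf F).card ∧
    ((Wf F).card : ℝ) ≤ hi m d ^ F.card * (Wf (m := m) ∅).card := by
  classical
  induction F using Finset.induction_on with
  | empty => intro _ _; simp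
  | insert e F he ih =>
    intro hd hdiag
    have hd' : ∀ x, (nb F x).card ≤ d := fun x =>
      (card_le_card (nb_mono (subset_insert e F) x)).trans (hd x)
    obtain ⟨i1, i2⟩ := ih hd' (fun e' he' => hdiag e' (mem_insert_of_mem he'))
    have hde := hdiag e (mem_insert_self _ _)
    induction e using Sym2.ind with
    | _ u v =>
    have huv : u ≠ v := by simpa using hde
    obtain ⟨s1, s2⟩ := Om_step h hd' huv he
    rw [card_insert_of_notMem he, pow_succ', pow_succ', mul_assoc, mul_assoc]
    have hl := lo_nonneg h
    have hh := hi_nonneg h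
    constructor
    · calc lo m d * (lo m d ^ F.card * (Wf (m := m) ∅).card) ≤ lo m d * (Wf F).card := by gcongr
        _ = (m+1) * (lo m d * (Om F u).card) := by rw [card_Wf F u]; push_cast; ring
        _ ≤ (m+1) * (Om (insert s(u,v) F) u).card := by gcongr
        _ = _ := by rw [card_Wf _ u]; push_cast; ring
    · calc ((Wf (insert s(u,v) F)).card : ℝ) = (m+1) * (Om (insert s(u,v) F) u).card := by
            rw [card_Wf _ u]; push_cast; ring
        _ ≤ (m+1) * (hi m d * (Om F u).card) := by gcongr
        _ = hi m d * (Wf F).card := by rw [card_Wf F u]; push_cast; ring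
        _ ≤ _ := by gcongr

/-- the finite set of Hamilton cycles -/
def Ham (m : ℕ) : Finset (Finset (Sym2 (Fin (m+1)))) := univ.image (cyc m)

lemma avoid_iff {F : Finset (Sym2 (Fin (m+1)))} {π : Equiv.Perm (Fin (m+1))} :
    Avoid F π ↔ Disjoint (cyc m π) F := by
  rw [disjoint_left]
  simp [Avoid, cyc]

lemma cyc_trans (π τ : Equiv.Perm (Fin (m+1))) :
    cyc m (π.trans τ) = (cyc m π).image (Sym2.map τ) := by
  simp [cyc, image_image, Function.comp_def]

lemma exists_fiber (m : ℕ) : ∃ c : ℕ, 0 < c ∧ ∀ F : Finset (Sym2 (Fin (m+1))),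
    (Wf F).card = c * ((Ham m).filter fun E => Disjoint E F).card := by
  classical
  refine ⟨(univ.filter fun π => cyc m π = cyc m (Equiv.refl _)).card, ?_, ?_⟩
  · rw [card_pos]; exact ⟨Equiv.refl _, by simp⟩
  intro F
  have h := card_eq_sum_card_fiberwise (s := Wf F)
    (t := (Ham m).filter fun E => Disjoint E F) (f := cyc m) (by
      intro π hπ
      simp only [Wf, coe_filter, mem_univ, true_and, Set.mem_ofPred_eq, avoid_iff] at hπ
      simp [Ham, hπ])
  rw [h, mul_comm, ← smul_eq_mul, ← sum_const]
  apply sum_congr rfl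
  intro E hE
  simp only [Ham, mem_filter, mem_image, mem_univ, true_and] at hE
  obtain ⟨⟨τ, rfl⟩, hdis⟩ := hE
  symm
  refine card_bij' (fun π _ => π.trans τ) (fun π _ => π.trans τ.symm) ?_ ?_ ?_ ?_
  · intro π hπ
    simp only [mem_filter, mem_univ, true_and] at hπ
    have e : cyc m (π.trans τ) = cyc m τ := by
      rw [cyc_trans, hπ, ← cyc_trans]; rfl
    simp only [Wf, mem_filter, mem_univ, true_and, avoid_iff, e]
    exact ⟨hdis, trivial⟩
  · intro π hπ
    simp only [Wf, mem_filter, mem_univ, true_and] at hπ ⊢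
    rw [cyc_trans, hπ.2, ← cyc_trans]
    congr 1
    ext; simp
  · intro π _; ext; simp
  · intro π _; ext; simp

lemma ham_bounds {d : ℕ} (h : 2 * d + 2 ≤ m) (F : Finset (Sym2 (Fin (m+1))))
    (hd : ∀ x, (nb F x).card ≤ d) (hdiag : ∀ e ∈ F, ¬ e.IsDiag) :
    lo m d ^ F.card * (Ham m).card ≤ ((Ham m).filter fun E => Disjoint E F).card ∧
    (((Ham m).filter fun E => Disjoint E F).card : ℝ) ≤ hi m d ^ F.card * (Ham m).card := by
  obtain ⟨c, hc, hW⟩ := exists_fiber m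
  have hc' : (0:ℝ) < c := by exact_mod_cast hc
  have := Wf_bounds h F hd hdiag
  rw [hW F, hW ∅] at this
  simp only [disjoint_empty_right, filter_true, Nat.cast_mul] at this
  constructor
  · refine le_of_mul_le_mul_left ?_ hc'
    linarith [this.1]
  · refine le_of_mul_le_mul_left ?_ hc'
    linarith [this.2]

lemma card_cyc (hm : 2 ≤ m) (π : Equiv.Perm (Fin (m+1))) : (cyc m π).card = m + 1 := by
  rw [cyc, card_image_of_injective, card_univ, Fintype.card_fin]
  intro i j hij
  simp only [Sym2.eq_iff, EmbeddingLike.apply_eq_iff_eq] at hij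
  rcases hij with h | ⟨h1, h2⟩
  · exact h.1
  · exfalso
    rw [h1] at h2
    have h3 : (1 + 1 : Fin (m+1)) = 0 := by
      have : j + (1 + 1) = j + 0 := by rw [← add_assoc, h2, add_zero]
      exact add_left_cancel this
    have := congrArg Fin.val h3
    rw [Fin.val_add, Fin.val_one', Nat.mod_eq_of_lt (a := 1) (by omega),
      Nat.mod_eq_of_lt (by omega)] at this
    simp at this

lemma nb_cyc (π : Equiv.Perm (Fin (m+1))) (x : Fin (m+1)) : (nb (cyc m π) x).card ≤ 2 := by
  have : nb (cyc m π) x ⊆ {π (π.symm x + 1), π (π.symm x - 1)} := by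
    intro y hy
    rw [mem_nb] at hy
    simp only [cyc, mem_image, mem_univ, true_and, Sym2.eq_iff] at hy
    obtain ⟨i, ⟨rfl, rfl⟩ | ⟨rfl, rfl⟩⟩ := hy <;> simp
  exact (card_le_card this).trans card_le_two

lemma diag_cyc (hm : 2 ≤ m) (π : Equiv.Perm (Fin (m+1))) : ∀ e ∈ cyc m π, ¬ e.IsDiag := by
  intro e he
  simp only [cyc, mem_image, mem_univ, true_and] at he
  obtain ⟨i, rfl⟩ := he
  simp only [Sym2.mk_isDiag_iff, EmbeddingLike.apply_eq_iff_eq]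
  intro h
  have h' : (1 : Fin (m+1)) = 0 := by simpa using h.symm
  have := congrArg Fin.val h'
  rw [Fin.val_one', Nat.mod_eq_of_lt (by omega)] at this
  simp at this

open Classical in
/-- pairwise disjoint tuples -/
noncomputable def Tup (m j : ℕ) : Finset (Fin j → Finset (Sym2 (Fin (m+1)))) :=
  univ.filter fun f => (∀ i, f i ∈ Ham m) ∧ ∀ a b, a ≠ b → Disjoint (f a) (f b)

lemma card_Tup_succ (m j : ℕ) : (Tup m (j+1)).card =
    ∑ f ∈ Tup m j, ((Ham m).filter fun E => Disjoint E (univ.biUnion f)).card := by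
  classical
  rw [← card_sigma]
  refine card_bij' (fun f _ => ⟨Fin.tail f, f 0⟩) (fun p _ => Fin.cons p.2 p.1) ?_ ?_ ?_ ?_
  · intro f hf
    simp only [Tup, mem_filter, mem_univ, true_and, mem_sigma] at hf ⊢
    refine ⟨⟨fun i => hf.1 _, fun a b hab => hf.2 _ _ (by simpa using hab)⟩, hf.1 0, ?_⟩
    rw [disjoint_biUnion_right]
    intro i _
    exact hf.2 _ _ (Fin.succ_ne_zero i).symm
  · rintro ⟨f, E⟩ hf
    simp only [Tup, mem_filter, mem_univ, true_and, mem_sigma, disjoint_biUnion_right,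
      forall_const] at hf ⊢
    obtain ⟨⟨h1, h2⟩, h3, h4⟩ := hf
    refine ⟨fun i => ?_, fun a b hab => ?_⟩
    · cases i using Fin.cases with
      | zero => simpa using h3
      | succ i => simpa using h1 i
    · cases a using Fin.cases with
      | zero =>
        cases b using Fin.cases with
        | zero => exact absurd rfl hab
        | succ b => simpa using h4 b
      | succ a =>
        cases b using Fin.cases with
        | zero => simpa using (h4 a).symm
        | succ b => simpa using h2 a b (by simpa using hab)
  · intro f _; simp
  · rintro ⟨f, E⟩ _; simp

lemma Tup_bounds (k : ℕ) (h : 2 * (2 * k) + 2 ≤ m) (j : ℕ) (hj : j ≤ k) :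
    lo m (2*k) ^ ((m+1) * j.choose 2) * ((Ham m).card : ℝ) ^ j ≤ (Tup m j).card ∧
    ((Tup m j).card : ℝ) ≤ hi m (2*k) ^ ((m+1) * j.choose 2) * ((Ham m).card : ℝ) ^ j := by
  classical
  have hm : 2 ≤ m := by omega
  have hl := lo_nonneg h
  have hh := hi_nonneg h
  induction j with
  | zero => simp [Tup]
  | succ j ih =>
    obtain ⟨i1, i2⟩ := ih (by omega)
    have key : ∀ f ∈ Tup m j,
        lo m (2*k) ^ ((m+1) * j) * (Ham m).card ≤
          ((Ham m).filter fun E => Disjoint E (univ.biUnion f)).card ∧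
        (((Ham m).filter fun E => Disjoint E (univ.biUnion f)).card : ℝ) ≤
          hi m (2*k) ^ ((m+1) * j) * (Ham m).card := by
      intro f hf
      simp only [Tup, mem_filter, mem_univ, true_and, Ham, mem_image] at hf
      obtain ⟨h1, h2⟩ := hf
      have hcard : (univ.biUnion f).card = (m+1) * j := by
        rw [card_biUnion (fun a _ b _ hab => h2 a b hab)]
        rw [sum_congr rfl (fun i _ => show (f i).card = m + 1 by
          obtain ⟨π, hπ⟩ := h1 i; rw [← hπ, card_cyc hm])]
        simp [mul_comm]
      have := ham_bounds h (univ.biUnion f) (by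
        intro x
        have hsub : nb (univ.biUnion f) x ⊆ univ.biUnion fun i => nb (f i) x := by
          intro y hy
          rw [mem_nb, mem_biUnion] at hy
          obtain ⟨i, _, hi⟩ := hy
          exact mem_biUnion.2 ⟨i, mem_univ _, mem_nb.2 hi⟩
        refine (card_le_card hsub).trans (card_biUnion_le.trans ?_)
        refine (sum_le_card_nsmul _ _ 2 ?_).trans ?_
        · intro i _
          obtain ⟨π, hπ⟩ := h1 i; rw [← hπ]; exact nb_cyc π x
        · simp; omega) (by
        intro e he
        obtain ⟨i, _, hi⟩ := mem_biUnion.1 he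
        obtain ⟨π, hπ⟩ := h1 i
        rw [← hπ] at hi
        exact diag_cyc hm π e hi)
      rwa [hcard] at this
    have hch : (m+1) * (j+1).choose 2 = (m+1) * j.choose 2 + (m+1) * j := by
      rw [Nat.choose_succ_succ' j 1]; simp; ring
    rw [card_Tup_succ, hch, Nat.cast_sum]
    constructor
    · calc lo m (2*k) ^ ((m+1) * j.choose 2 + (m+1) * j) * ((Ham m).card : ℝ) ^ (j+1)
          = (lo m (2*k) ^ ((m+1) * j.choose 2) * ((Ham m).card : ℝ) ^ j) *
            (lo m (2*k) ^ ((m+1) * j) * (Ham m).card) := by ring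
        _ ≤ (Tup m j).card * (lo m (2*k) ^ ((m+1) * j) * (Ham m).card) := by gcongr
        _ ≤ _ := by
          rw [← nsmul_eq_mul]
          exact card_nsmul_le_sum _ _ _ fun f hf => (key f hf).1
    · calc _ ≤ (Tup m j).card * (hi m (2*k) ^ ((m+1) * j) * (Ham m).card) := by
            rw [← nsmul_eq_mul]
            exact sum_le_card_nsmul _ _ _ fun f hf => (key f hf).2
        _ ≤ (hi m (2*k) ^ ((m+1) * j.choose 2) * ((Ham m).card : ℝ) ^ j) *
            (hi m (2*k) ^ ((m+1) * j) * (Ham m).card) := by gcongr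
        _ = _ := by ring

lemma lo_exp {k : ℕ} (hk : 0 < k) (h : 8 * k + 8 ≤ m) :
    Real.exp (-(28 * (k:ℝ)^3 / (m+1))) ≤
      lo m (2*k) ^ ((m+1) * k.choose 2) * Real.exp (2 * (k.choose 2 : ℝ)) := by
  have h1 : (8 * k + 8 : ℝ) ≤ m := by exact_mod_cast h
  have hk1 : (1:ℝ) ≤ k := by exact_mod_cast hk
  set δ : ℝ := (m:ℝ) - 2 * ((2 * k : ℕ) : ℝ) with hδ
  have hδ' : δ = m - 4 * k := by rw [hδ]; push_cast; ring
  have hC : (k.choose 2 : ℝ) ≤ k^2 / 2 := by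
    rw [Nat.cast_choose_two]; nlinarith
  have hC0 : (0:ℝ) ≤ k.choose 2 := by positivity
  have hlo : Real.exp (-(2 / (δ - 2))) ≤ lo m (2*k) := by
    have hp : lo m (2*k) = (δ - 2) / δ := by
      rw [lo, ← hδ]; field_simp [show δ ≠ 0 by linarith]
    rw [hp, Real.exp_neg, inv_le_comm₀ (Real.exp_pos _) (div_pos (by linarith) (by linarith)),
      inv_div]
    have := Real.add_one_le_exp (2 / (δ - 2))
    have e : δ / (δ - 2) = 2 / (δ - 2) + 1 := by
      field_simp [show δ - 2 ≠ 0 by linarith]; ring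
    rw [e]; exact this
  calc Real.exp (-(28 * (k:ℝ)^3 / (m+1)))
      ≤ Real.exp (((m+1) * k.choose 2 : ℕ) * (-(2 / (δ - 2))) + 2 * (k.choose 2 : ℝ)) := by
        apply Real.exp_le_exp.2
        have e : ((m+1) * k.choose 2 : ℕ) * (-(2 / (δ - 2))) + 2 * (k.choose 2 : ℝ)
            = -((2 * (k.choose 2 : ℝ)) * ((4 * k + 3) / (δ - 2))) := by
          push_cast
          rw [hδ']
          field_simp [show (m:ℝ) - 4 * k - 2 ≠ 0 by linarith]; ring
        rw [e, neg_le_neg_iff]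
        have a1 : (4 * k + 3) / (δ - 2) ≤ 14 * k / ((m:ℝ)+1) := by
          rw [div_le_div_iff₀ (by linarith) (by linarith), hδ']
          nlinarith
        calc (2 * (k.choose 2 : ℝ)) * ((4 * k + 3) / (δ - 2))
            ≤ (k:ℝ)^2 * (14 * k / ((m:ℝ)+1)) := by
              apply mul_le_mul (by linarith) a1 (div_nonneg (by linarith) (by linarith))
              positivity
          _ = 14 * (k:ℝ)^3 / (m+1) := by ring
          _ ≤ _ := by gcongr; norm_num
    _ = Real.exp (-(2 / (δ - 2))) ^ ((m+1) * k.choose 2) * Real.exp (2 * (k.choose 2 : ℝ)) := by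
        rw [Real.exp_add, Real.exp_nat_mul]
    _ ≤ _ := by gcongr

lemma hi_exp {k : ℕ} (hk : 0 < k) (h : 8 * k + 8 ≤ m) :
    hi m (2*k) ^ ((m+1) * k.choose 2) * Real.exp (2 * (k.choose 2 : ℝ)) ≤
    Real.exp (28 * (k:ℝ)^3 / (m+1)) := by
  have h1 : (8 * k + 8 : ℝ) ≤ m := by exact_mod_cast h
  have hk1 : (1:ℝ) ≤ k := by exact_mod_cast hk
  set δ : ℝ := (m:ℝ) - 2 * ((2 * k : ℕ) : ℝ) with hδ
  have hδ' : δ = m - 4 * k := by rw [hδ]; push_cast; ring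
  have hC : (k.choose 2 : ℝ) ≤ k^2 / 2 := by
    rw [Nat.cast_choose_two]; nlinarith
  have hC0 : (0:ℝ) ≤ k.choose 2 := by positivity
  set x : ℝ := 2 / (m:ℝ) * (1 - 4 * k / δ) with hx
  have hhi : hi m (2*k) ≤ Real.exp (-x) := by
    have hp : hi m (2*k) = -x + 1 := by
      rw [hi, ← hδ, hx]; push_cast; ring
    rw [hp]; exact Real.add_one_le_exp _
  have hfrac : 4 * k / δ ≤ 1 := by
    rw [div_le_one (by linarith)]; linarith
  calc hi m (2*k) ^ ((m+1) * k.choose 2) * Real.exp (2 * (k.choose 2 : ℝ))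
      ≤ Real.exp (-x) ^ ((m+1) * k.choose 2) * Real.exp (2 * (k.choose 2 : ℝ)) := by
        have := hi_nonneg (m := m) (d := 2*k) (by omega)
        gcongr
    _ = Real.exp (((m+1) * k.choose 2 : ℕ) * (-x) + 2 * (k.choose 2 : ℝ)) := by
        rw [Real.exp_add, Real.exp_nat_mul]
    _ ≤ _ := by
        apply Real.exp_le_exp.2
        have a0 : 2 * (1 - 4 * k / δ) ≤ ((m:ℝ)+1) * x := by
          have : ((m:ℝ)+1) * x = 2 * (1 - 4 * k / δ) + x := by
            rw [hx]; field_simp [show (m:ℝ) ≠ 0 by linarith]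
          have hx0 : 0 ≤ x := by
            apply mul_nonneg (by positivity); linarith
          linarith
        have a1 : 8 * k / δ ≤ 28 * k / ((m:ℝ)+1) := by
          rw [div_le_div_iff₀ (by linarith) (by linarith), hδ']
          nlinarith
        have a2 : 2 - ((m:ℝ)+1) * x ≤ 28 * k / ((m:ℝ)+1) := by
          have : 8 * k / δ = 2 * (4 * k / δ) := by ring
          linarith
        have hk2 : (k.choose 2 : ℝ) ≤ k^2 := by nlinarith
        calc ((m+1) * k.choose 2 : ℕ) * (-x) + 2 * (k.choose 2 : ℝ)
            = (k.choose 2 : ℝ) * (2 - ((m:ℝ)+1) * x) := by push_cast; ring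
          _ ≤ (k.choose 2 : ℝ) * (28 * k / ((m:ℝ)+1)) := by gcongr
          _ ≤ (k:ℝ)^2 * (28 * k / ((m:ℝ)+1)) := by gcongr
          _ = _ := by ring

lemma ncard_ham (hm : 2 ≤ m) :
    Set.ncard {E : Finset (Sym2 (Fin (m+1))) | IsHamCycle (m+1) E} = (Ham m).card := by
  rw [← Set.ncard_coe_finset]
  congr 1
  ext E
  simp [isHamCycle_iff m hm, Ham, eq_comm]

lemma ncard_tup (hm : 2 ≤ m) (k : ℕ) :
    Set.ncard {f : Fin k → Finset (Sym2 (Fin (m+1))) |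
          (∀ j, IsHamCycle (m+1) (f j)) ∧
          ∀ a b : Fin k, a ≠ b → Disjoint (f a) (f b)} = (Tup m k).card := by
  rw [← Set.ncard_coe_finset]
  congr 1
  ext E
  simp [isHamCycle_iff m hm, Ham, Tup, eq_comm]

lemma Ham_pos (m : ℕ) : 0 < (Ham m).card :=
  card_pos.2 ⟨_, mem_image_of_mem _ (mem_univ (Equiv.refl _))⟩

lemma main_bound {n k : ℕ} (hk : 0 < k) (h : 8 * k + 9 ≤ n) :
    Real.exp (-(28 * ((k:ℝ)^3 / n))) ≤
      ((Set.ncard {f : Fin k → Finset (Sym2 (Fin n)) |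
          (∀ j, IsHamCycle n (f j)) ∧
          ∀ a b : Fin k, a ≠ b → Disjoint (f a) (f b)} : ℝ) /
        (Set.ncard {E : Finset (Sym2 (Fin n)) | IsHamCycle n E} : ℝ) ^ k) *
        Real.exp (2 * (k.choose 2 : ℝ)) ∧
      ((Set.ncard {f : Fin k → Finset (Sym2 (Fin n)) |
          (∀ j, IsHamCycle n (f j)) ∧
          ∀ a b : Fin k, a ≠ b → Disjoint (f a) (f b)} : ℝ) /
        (Set.ncard {E : Finset (Sym2 (Fin n)) | IsHamCycle n E} : ℝ) ^ k) *
        Real.exp (2 * (k.choose 2 : ℝ)) ≤ Real.exp (28 * ((k:ℝ)^3 / n)) := by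
  obtain ⟨m, rfl⟩ : ∃ m, n = m + 1 := ⟨n - 1, by omega⟩
  rw [ncard_ham (by omega), ncard_tup (by omega), ← mul_div_assoc, Nat.cast_add, Nat.cast_one]
  obtain ⟨t1, t2⟩ := Tup_bounds (m := m) k (by omega) k le_rfl
  have hp : (0:ℝ) < ((Ham m).card : ℝ) ^ k := by
    have : (0:ℝ) < (Ham m).card := by exact_mod_cast Ham_pos m
    positivity
  rw [← le_div_iff₀ hp] at t1
  rw [← div_le_iff₀ hp] at t2
  exact ⟨(lo_exp hk (by omega)).trans (by gcongr), le_trans (by gcongr) (hi_exp hk (by omega))⟩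

end HamAux

/-- If `k = k(n)` is a sequence of positive integers with `k(n) = o(n^{1/100})`, and
`H_1, …, H_{k(n)}` are i.i.d. uniformly random Hamilton cycles of `K_n`, then the probability
`p(n)` that they are pairwise edge-disjoint satisfies `p(n) · e^{2·C(k(n),2)} → 1`.
The probability is expressed as (number of `k(n)`-tuples of Hamilton cycles that are pairwise
edge-disjoint) divided by (number of Hamilton cycles)^{k(n)}. -/
theorem random_hamilton_cycles_pairwise_edge_disjoint
    (k : ℕ → ℕ) (hkpos : ∀ n, 0 < k n)
    (hk : Filter.Tendsto (fun n : ℕ => (k n : ℝ) / (n : ℝ) ^ ((1 : ℝ) / 100))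
      Filter.atTop (nhds 0)) :
    Filter.Tendsto (fun n : ℕ =>
      ((Set.ncard {f : Fin (k n) → Finset (Sym2 (Fin n)) |
          (∀ j, IsHamCycle n (f j)) ∧
          ∀ a b : Fin (k n), a ≠ b → Disjoint (f a) (f b)} : ℝ) /
        (Set.ncard {E : Finset (Sym2 (Fin n)) | IsHamCycle n E} : ℝ) ^ (k n)) *
        Real.exp (2 * ((k n).choose 2 : ℝ)))
      Filter.atTop (nhds 1) := by
  have h1 : Filter.Tendsto (fun n : ℕ => (k n : ℝ) ^ 3 / n) Filter.atTop (nhds 0) := by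
    have h2 : Filter.Tendsto (fun n : ℕ => (n : ℝ) ^ (-(97 : ℝ) / 100)) Filter.atTop (nhds 0) := by
      have := (tendsto_rpow_neg_atTop (show (0:ℝ) < 97 / 100 by norm_num)).comp
        tendsto_natCast_atTop_atTop
      refine this.congr fun n => ?_
      simp only [Function.comp_apply]
      congr 1
      norm_num
    have h3 := (hk.pow 3).mul h2
    simp only [ne_eq, OfNat.ofNat_ne_zero, not_false_eq_true, zero_pow, mul_zero] at h3
    refine h3.congr' ?_
    filter_upwards [Filter.eventually_gt_atTop 0] with n hn
    have hn' : (0:ℝ) < n := by exact_mod_cast hn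
    have e1 : ((n:ℝ) ^ ((1:ℝ)/100)) ^ 3 = (n:ℝ) ^ ((3:ℝ)/100) := by
      rw [← Real.rpow_natCast, ← Real.rpow_mul hn'.le]; norm_num
    have e2 : (n:ℝ) ^ (-(97 : ℝ) / 100) = (n:ℝ) ^ ((3:ℝ)/100) / n := by
      nth_rewrite 3 [← Real.rpow_one (n:ℝ)]
      rw [← Real.rpow_sub hn']; norm_num
    have e3 : (0:ℝ) < (n:ℝ) ^ ((3:ℝ)/100) := Real.rpow_pos_of_pos hn' _
    rw [div_pow, e1, e2]
    field_simp
  have hev : ∀ᶠ n : ℕ in Filter.atTop, 8 * k n + 9 ≤ n := by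
    filter_upwards [h1.eventually (gt_mem_nhds (show (0:ℝ) < 1 / 17 by norm_num)),
      Filter.eventually_gt_atTop 0] with n hn hn0
    have hn' : (0:ℝ) < n := by exact_mod_cast hn0
    rw [div_lt_iff₀ hn'] at hn
    have hk1 : (1:ℝ) ≤ k n := by exact_mod_cast hkpos n
    have : (k n : ℝ) ≤ (k n : ℝ) ^ 3 := le_self_pow₀ hk1 (by norm_num)
    have : (8 * k n + 9 : ℝ) ≤ n := by linarith
    exact_mod_cast this
  have l1 : Filter.Tendsto (fun n : ℕ => Real.exp (-(28 * ((k n : ℝ) ^ 3 / n))))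
      Filter.atTop (nhds 1) := by
    have := (Real.continuous_exp.tendsto _).comp ((h1.const_mul 28).neg)
    simpa [Function.comp_def] using this
  have l2 : Filter.Tendsto (fun n : ℕ => Real.exp (28 * ((k n : ℝ) ^ 3 / n)))
      Filter.atTop (nhds 1) := by
    have := (Real.continuous_exp.tendsto _).comp (h1.const_mul 28)
    simpa [Function.comp_def] using this
  refine tendsto_of_tendsto_of_tendsto_of_le_of_le' l1 l2 ?_ ?_
  · filter_upwards [hev] with n hn
    exact (HamAux.main_bound (hkpos n) hn).1
  · filter_upwards [hev] with n hn
    exact (HamAux.main_bound (hkpos n) hn).2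
end

section
/- There exist an absolute constant C > 0 and N ∈ ℕ such that the following holds for all n ≥ N. Let k be a positive integer with k ≤ n^{1/100}, and let H_1, …, H_k be independent uniformly random Hamilton cycles in K_n. For 1 ≤ j ≤ k let E_j denote the event that the edge set of H_j is disjoint from the union of the edge sets of H_1, …, H_{j-1}. Then for every 0 ≤ i ≤ k−1, the conditional probability Pr[E_{i+1} | E_1 ∩ ⋯ ∩ E_i] lies in the interval [exp(−C/(k²·(log n)⁴))·e^{−2i}, exp(C/(k²·(log n)⁴))·e^{−2i}]. -/
namespace HamProof
open Finset Equiv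

lemma val_succ {n : ℕ} [NeZero n] (hn : 2 ≤ n) (j : Fin n) :
    (j + 1).val = if j.val + 1 = n then 0 else j.val + 1 := by
  have h1 : (1 : Fin n).val = 1 := by
    rw [Fin.val_one']; exact Nat.mod_eq_of_lt (by omega)
  have := j.isLt
  rw [Fin.val_add_eq_ite, h1]
  split_ifs <;> omega

lemma val_one {n : ℕ} [NeZero n] (hn : 2 ≤ n) : (1 : Fin n).val = 1 := by
  rw [Fin.val_one']; exact Nat.mod_eq_of_lt (by omega)

lemma val_pred {n : ℕ} [NeZero n] (hn : 2 ≤ n) (j : Fin n) :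
    (j - 1).val = if j.val = 0 then n - 1 else j.val - 1 := by
  have h := val_succ hn (j - 1)
  rw [sub_add_cancel] at h
  have := (j - 1).isLt
  split_ifs at h ⊢ <;> omega

/-- Reversal of the positions `1, …, c`. -/
def revf {n : ℕ} (c j : Fin n) : Fin n :=
  if h : 1 ≤ j.val ∧ j.val ≤ c.val then ⟨c.val + 1 - j.val, by have := c.isLt; omega⟩ else j

lemma revf_val {n : ℕ} (c j : Fin n) : (revf c j).val =
    if 1 ≤ j.val ∧ j.val ≤ c.val then c.val + 1 - j.val else j.val := by
  unfold revf; split_ifs <;> rfl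

lemma revf_invol {n : ℕ} (c : Fin n) : Function.Involutive (revf c) := by
  intro j
  apply Fin.ext
  simp only [revf_val]
  split_ifs <;> omega

/-- The reversal as a permutation. -/
def rev {n : ℕ} (c : Fin n) : Perm (Fin n) := (revf_invol c).toPerm

@[simp] lemma rev_apply {n : ℕ} (c j : Fin n) : rev c j = revf c j := rfl
@[simp] lemma rev_symm {n : ℕ} (c : Fin n) : (rev c).symm = rev c := rfl
lemma rev_mul_self {n : ℕ} (c : Fin n) : rev c * rev c = 1 := by
  ext j; simp [revf_invol c j]

/-- The cyclic sequence `σ` avoids the edges of `F`. -/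
def Av {n : ℕ} [NeZero n] (F : Finset (Sym2 (Fin n))) (σ : Perm (Fin n)) : Prop :=
  ∀ j, s(σ j, σ (j + 1)) ∉ F

lemma av_rev {n : ℕ} [NeZero n] (hn : 2 ≤ n) {F : Finset (Sym2 (Fin n))} {σ : Perm (Fin n)}
    (c : Fin n) (hc : 1 ≤ c.val) (hc' : c.val + 1 < n) (h : Av F σ)
    (h0 : s(σ 0, σ c) ∉ F) (h1 : s(σ 1, σ (c + 1)) ∉ F) : Av F (σ * rev c) := by
  intro j
  have e1 := val_one hn
  have ej := val_succ hn j
  have ec := val_succ hn c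
  have e0 : (0 : Fin n).val = 0 := Fin.val_zero n
  have hj := j.isLt
  simp only [Perm.mul_apply, rev_apply]
  rcases lt_trichotomy j.val c.val with hjc | hjc | hjc
  · by_cases j0 : j.val = 0
    · have a : revf c j = 0 := Fin.ext (by rw [revf_val]; split_ifs <;> omega)
      have b : revf c (j + 1) = c := Fin.ext (by rw [revf_val]; split_ifs at * <;> omega)
      rw [a, b]; exact h0
    · have b : revf c j = revf c (j + 1) + 1 := by
        apply Fin.ext
        rw [val_succ hn, revf_val, revf_val]; split_ifs at * <;> omega
      rw [b, Sym2.eq_swap]; exact h _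
  · have a : revf c j = 1 := Fin.ext (by rw [revf_val]; split_ifs <;> omega)
    have b : revf c (j + 1) = c + 1 := Fin.ext (by rw [revf_val]; split_ifs at * <;> omega)
    rw [a, b]; exact h1
  · have a : revf c j = j := Fin.ext (by rw [revf_val]; split_ifs <;> omega)
    have b : revf c (j + 1) = j + 1 := Fin.ext (by rw [revf_val]; split_ifs at * <;> omega)
    rw [a, b]; exact h _

open Classical in
lemma switch_count {n : ℕ} (s t : Finset (Perm (Fin n))) (good : Perm (Fin n) → Finset (Fin n))
    (m q : ℕ) (hm : ∀ σ ∈ s, m ≤ #(good σ)) (hst : ∀ σ ∈ s, ∀ b ∈ good σ, σ * rev b ∈ t)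
    (hq : ∀ τ ∈ t, #{b : Fin n | τ * rev b ∈ s ∧ b ∈ good (τ * rev b)} ≤ q) :
    #s * m ≤ #t * q := by
  have key : #(s.sigma good) ≤
      #(t.sigma fun τ => ({b : Fin n | τ * rev b ∈ s ∧ b ∈ good (τ * rev b)} : Finset (Fin n))) := by
    apply Finset.card_le_card_of_injOn (fun p => ⟨p.1 * rev p.2, p.2⟩)
    · rintro ⟨σ, b⟩ h
      simp only [coe_sigma, Set.mem_sigma_iff, mem_coe] at h
      simp only [coe_sigma, Set.mem_sigma_iff, mem_coe, mem_filter, mem_univ, true_and, mul_assoc,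
        rev_mul_self, mul_one]
      exact ⟨hst _ h.1 _ h.2, h⟩
    · rintro ⟨σ, b⟩ _ ⟨σ', b'⟩ _ h
      simp only [Sigma.mk.injEq, heq_eq_eq] at h
      obtain ⟨h1, rfl⟩ := h
      have := mul_right_cancel h1
      subst this; rfl
  rw [card_sigma, card_sigma] at key
  calc #s * m = ∑ _σ ∈ s, m := by simp
    _ ≤ _ := sum_le_sum hm
    _ ≤ _ := key
    _ ≤ ∑ _τ ∈ t, q := sum_le_sum hq
    _ = _ := by simp

section count
open Classical
variable {n : ℕ} [NeZero n]
set_option linter.unusedSectionVars false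

/-- Avoiding sequences starting with `u, v`. -/
noncomputable def setA (F : Finset (Sym2 (Fin n))) (u v : Fin n) : Finset (Perm (Fin n)) :=
  {σ | Av F σ ∧ σ 0 = u ∧ σ 1 = v}

/-- Avoiding sequences starting with `u`, `v` not cyclically adjacent to `u`. -/
noncomputable def setB (F : Finset (Sym2 (Fin n))) (u v : Fin n) : Finset (Perm (Fin n)) :=
  {σ | Av F σ ∧ σ 0 = u ∧ 2 ≤ (σ.symm v).val ∧ (σ.symm v).val + 2 ≤ n}

/-- Members of `setB` whose switching is blocked. -/
noncomputable def setBad (F : Finset (Sym2 (Fin n))) (u v : Fin n) : Finset (Perm (Fin n)) :=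
  {σ ∈ setB F u v | s(σ 1, σ (σ.symm v + 1)) ∈ F}

/-- Degree bound. -/
def DegLe (F : Finset (Sym2 (Fin n))) (d : ℕ) : Prop :=
  ∀ x, #{y | s(x, y) ∈ F} ≤ d

lemma deg_inj {F : Finset (Sym2 (Fin n))} {d : ℕ} (hF : DegLe F d) (x : Fin n)
    (g : Fin n → Fin n) (hg : g.Injective) : #{b | s(x, g b) ∈ F} ≤ d := by
  refine le_trans ?_ (hF x)
  apply Finset.card_le_card_of_injOn g
  · intro b hb; simpa using hb
  · exact hg.injOn

lemma card_mid : #({b | 2 ≤ b.val ∧ b.val + 2 ≤ n} : Finset (Fin n)) = n - 3 := by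
  have : ({b | 2 ≤ b.val ∧ b.val + 2 ≤ n} : Finset (Fin n)).map Fin.valEmbedding = Icc 2 (n-2) := by
    ext x
    simp only [mem_map, mem_filter, mem_univ, true_and, Fin.valEmbedding_apply, mem_Icc]
    constructor
    · rintro ⟨a, h, rfl⟩; omega
    · intro h; exact ⟨⟨x, by omega⟩, by simp only; omega, rfl⟩
  rw [← card_map, this, Nat.card_Icc]; omega

lemma countA {F : Finset (Sym2 (Fin n))} {d : ℕ} (hF : DegLe F d) (hn : 4 ≤ n) (u v : Fin n) :
    #(setA F u v) * (n - 3 - 2 * d) ≤ #(setB F u v) := by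
  have := switch_count (setA F u v) (setB F u v)
    (fun σ => ((({b | 2 ≤ b.val ∧ b.val + 2 ≤ n} : Finset (Fin n)) \
      ({b | s(σ 0, σ b) ∈ F} : Finset (Fin n))) \ ({b | s(σ 1, σ (b + 1)) ∈ F} : Finset (Fin n)))) (n - 3 - 2 * d) 1 ?_ ?_ ?_
  · simpa using this
  · intro σ _
    have h1 := le_card_sdiff ({b | s(σ 1, σ (b + 1)) ∈ F} : Finset (Fin n))
      (({b | 2 ≤ b.val ∧ b.val + 2 ≤ n} : Finset (Fin n)) \ ({b | s(σ 0, σ b) ∈ F} : Finset (Fin n)))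
    have h2 := le_card_sdiff ({b | s(σ 0, σ b) ∈ F} : Finset (Fin n))
      ({b | 2 ≤ b.val ∧ b.val + 2 ≤ n} : Finset (Fin n))
    have h3 := deg_inj hF (σ 0) σ σ.injective
    have h4 := deg_inj hF (σ 1) (fun b => σ (b + 1)) (σ.injective.comp (add_left_injective 1))
    rw [card_mid] at h2
    omega
  · intro σ hσ b hb
    simp only [mem_sdiff, mem_filter, mem_univ, true_and, setA, setB] at hσ hb ⊢
    obtain ⟨hav, h0, h1⟩ := hσ
    obtain ⟨⟨⟨hb1, hb2⟩, hb3⟩, hb4⟩ := hb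
    have e1 := val_one (n := n) (by omega)
    have r0 : revf b 0 = 0 := Fin.ext (by rw [revf_val]; simp)
    have r1 : revf b 1 = b := Fin.ext (by rw [revf_val]; split_ifs <;> omega)
    have hs : (σ * rev b).symm v = b := by
      rw [Equiv.symm_apply_eq]; 
      have : revf b b = 1 := by simpa [r1] using revf_invol b 1
      simp [this, h1]
    refine ⟨av_rev (by omega) b (by omega) (by omega) hav hb3 hb4, by simp [r0, h0], ?_, ?_⟩ <;>
    rw [hs] <;> omega
  · intro τ _
    rw [card_le_one]
    have e1 := val_one (n := n) (by omega)
    have key : ∀ b : Fin n, τ * rev b ∈ setA F u v → 2 ≤ b.val → b = τ.symm v := by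
      intro b hb hb1
      have r1 : revf b 1 = b := Fin.ext (by rw [revf_val]; split_ifs <;> omega)
      simp only [setA, mem_filter, mem_univ, true_and, Perm.mul_apply, rev_apply, r1] at hb
      rw [Equiv.eq_symm_apply, hb.2.2]
    intro a ha b hb
    simp only [mem_sdiff, mem_filter, mem_univ, true_and] at ha hb
    rw [key a ha.1 ha.2.1.1.1, key b hb.1 hb.2.1.1.1]

lemma countB {F : Finset (Sym2 (Fin n))} (hn : 4 ≤ n) (u v : Fin n)
    (he : s(u, v) ∉ F) :
    #(setB F u v) ≤ #(setBad F u v) + #(setA F u v) * (n - 3) := by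
  have := switch_count (setB F u v \ setBad F u v) (setA F u v)
    (fun σ => {σ.symm v}) 1 (n - 3) ?_ ?_ ?_
  · have h := le_card_sdiff (setBad F u v) (setB F u v)
    omega
  · simp
  · intro σ hσ b hb
    simp only [mem_sdiff, mem_filter, mem_univ, true_and, setA, setB, setBad, mem_singleton,
      not_and] at hσ hb ⊢
    obtain ⟨⟨hav, h0, h1, h2⟩, h3⟩ := hσ
    have h3 := h3 ⟨hav, h0, h1, h2⟩
    subst hb
    have e1 := val_one (n := n) (by omega)
    have r0 : revf (σ.symm v) 0 = 0 := Fin.ext (by rw [revf_val]; simp)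
    have r1 : revf (σ.symm v) 1 = (σ.symm v) := Fin.ext (by rw [revf_val]; split_ifs <;> omega)
    refine ⟨av_rev (by omega) _ (by omega) (by omega) hav ?_ h3, by simp [r0, h0], by simp [r1]⟩
    rw [h0, Equiv.apply_symm_apply]; exact he
  · intro τ hτ
    rw [← card_mid]
    apply card_le_card
    intro b hb
    simp only [mem_sdiff, mem_filter, mem_univ, true_and, setA, setB, mem_singleton] at hb hτ ⊢
    obtain ⟨⟨⟨_, _, h1, h2⟩, _⟩, h3⟩ := hb
    rw [← h3] at h1 h2
    exact ⟨h1, h2⟩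

lemma countBad {F : Finset (Sym2 (Fin n))} {d : ℕ} (hF : DegLe F d) (hn : 4 ≤ n) (u v : Fin n) :
    #(setBad F u v) * (n - 4 - 2 * d) ≤ #(setB F u v) * (2 * d) := by
  apply switch_count (setBad F u v) (setB F u v)
    (fun σ => ((({b | 2 ≤ b.val ∧ b.val + 2 ≤ n} : Finset (Fin n)) \
      ({b | s(σ 0, σ b) ∈ F} : Finset (Fin n))) \ ({b | s(σ 1, σ (b + 1)) ∈ F} : Finset (Fin n))) \ {σ.symm v}) (n - 4 - 2 * d) (2 * d)
  · intro σ _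
    have h1 := le_card_sdiff ({b | s(σ 1, σ (b + 1)) ∈ F} : Finset (Fin n))
      (({b | 2 ≤ b.val ∧ b.val + 2 ≤ n} : Finset (Fin n)) \ ({b | s(σ 0, σ b) ∈ F} : Finset (Fin n)))
    have h2 := le_card_sdiff ({b | s(σ 0, σ b) ∈ F} : Finset (Fin n))
      ({b | 2 ≤ b.val ∧ b.val + 2 ≤ n} : Finset (Fin n))
    have h3 := deg_inj hF (σ 0) σ σ.injective
    have h4 := deg_inj hF (σ 1) (fun b => σ (b + 1)) (σ.injective.comp (add_left_injective 1))
    have h5 := le_card_sdiff {σ.symm v} ((({b | 2 ≤ b.val ∧ b.val + 2 ≤ n} : Finset (Fin n)) \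
      ({b | s(σ 0, σ b) ∈ F} : Finset (Fin n))) \ ({b | s(σ 1, σ (b + 1)) ∈ F} : Finset (Fin n)))
    rw [card_mid] at h2
    rw [card_singleton] at h5
    omega
  · intro σ hσ b hb
    simp only [mem_sdiff, mem_filter, mem_univ, true_and, setBad, setB, mem_singleton] at hσ hb ⊢
    obtain ⟨⟨hav, h0, h1, h1'⟩, -⟩ := hσ
    obtain ⟨⟨⟨⟨hb1, hb2⟩, hb3⟩, hb4⟩, hb5⟩ := hb
    have r0 : revf b 0 = 0 := Fin.ext (by rw [revf_val]; simp)
    have hs : (σ * rev b).symm v = revf b (σ.symm v) := by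
      rw [Equiv.symm_apply_eq]; simp [revf_invol b (σ.symm v)]
    have hne : b.val ≠ (σ.symm v).val := fun h => hb5 (Fin.ext h)
    refine ⟨av_rev (by omega) b (by omega) (by omega) hav hb3 hb4, by simp [r0, h0], ?_, ?_⟩ <;>
    rw [hs, revf_val] <;> split_ifs <;> omega
  · intro τ hτ
    simp only [setB, mem_filter, mem_univ, true_and] at hτ
    obtain ⟨hav, h0, h1, h1'⟩ := hτ
    set p := τ.symm v with hp
    have h3 := deg_inj hF (τ (p + 1)) τ τ.injective
    have h4 := deg_inj hF (τ (p - 1)) τ τ.injective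
    refine le_trans (le_trans (card_le_card ?_) (card_union_le
      ({b | s(τ (p + 1), τ b) ∈ F} : Finset (Fin n)) {b | s(τ (p - 1), τ b) ∈ F})) (by omega)
    intro c hc
    have e1 := val_one (n := n) (by omega)
    simp only [mem_sdiff, mem_filter, mem_univ, true_and, setBad, setB, mem_singleton, mem_union] at hc ⊢
    obtain ⟨⟨⟨_, _, h5, h6⟩, h7⟩, ⟨⟨⟨⟨h8, h9⟩, _⟩, _⟩, h10⟩⟩ := hc
    have hs : (τ * rev c).symm v = revf c p := by
      rw [Equiv.symm_apply_eq, Perm.mul_apply, rev_apply, revf_invol c p, hp, Equiv.apply_symm_apply]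
    have r1 : revf c 1 = c := Fin.ext (by rw [revf_val]; split_ifs <;> omega)
    rw [hs] at h5 h6 h7 h10
    simp only [Perm.mul_apply, rev_apply, r1] at h7
    have hne : c.val ≠ (revf c p).val := fun h => h10 (Fin.ext h)
    have ep := val_succ (n := n) (by omega) p
    have ep' := val_pred (n := n) (by omega) p
    have er := val_succ (n := n) (by omega) (revf c p)
    rw [Sym2.eq_swap] at h7
    rcases lt_or_ge c.val p.val with hcp | hcp
    · left
      have : revf c (revf c p + 1) = p + 1 := by
        apply Fin.ext
        rw [revf_val, er, ep]
        rw [revf_val] at *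
        split_ifs at * <;> omega
      rwa [this] at h7
    · right
      have : revf c (revf c p + 1) = p - 1 := by
        apply Fin.ext
        rw [revf_val, er, ep']
        rw [revf_val] at *
        split_ifs at * <;> omega
      rwa [this] at h7

/-- Number of avoiding sequences. -/
noncomputable def T (F : Finset (Sym2 (Fin n))) : ℕ := #{σ : Perm (Fin n) | Av F σ}

lemma T_eq (F : Finset (Sym2 (Fin n))) (u : Fin n) :
    T F = n * #{σ : Perm (Fin n) | Av F σ ∧ σ 0 = u} := by
  unfold T
  rw [card_eq_sum_card_fiberwise (f := fun σ : Perm (Fin n) => σ.symm u) (t := univ) (by simp)]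
  rw [sum_congr rfl (g := fun _ => #{σ : Perm (Fin n) | Av F σ ∧ σ 0 = u})]
  · simp
  intro p _
  apply card_bij' (fun σ _ => σ * Equiv.addRight p) (fun σ _ => σ * (Equiv.addRight p).symm)
  · intro σ hσ
    simp only [mem_filter, mem_univ, true_and] at hσ ⊢
    refine ⟨fun j => ?_, ?_⟩
    · have := hσ.1 (j + p)
      simpa [add_right_comm] using this
    · simp [← hσ.2]
  · intro σ hσ
    simp only [mem_filter, mem_univ, true_and] at hσ ⊢
    refine ⟨fun j => ?_, ?_⟩
    · have := hσ.1 (j - p)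
      simpa [sub_eq_add_neg, add_right_comm] using this
    · rw [Equiv.symm_apply_eq]; simp [← hσ.2]
  · intro σ _; ext; simp
  · intro σ _; ext; simp

lemma card_start (hn : 4 ≤ n) (F : Finset (Sym2 (Fin n))) {u v : Fin n} (huv : u ≠ v) :
    #{σ : Perm (Fin n) | Av F σ ∧ σ 0 = u} = 2 * #(setA F u v) + #(setB F u v) := by
  have e1 := val_one (n := n) (by omega)
  have em : ((-1 : Fin n)).val = n - 1 := by
    have := val_pred (n := n) (by omega) 0
    simpa using this
  set A2 : Finset (Perm (Fin n)) := {σ | Av F σ ∧ σ 0 = u ∧ σ (-1) = v} with hA2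
  have hcard : #A2 = #(setA F u v) := by
    apply card_bij' (fun σ _ => σ * Equiv.neg (Fin n)) (fun σ _ => σ * Equiv.neg (Fin n))
    · intro σ hσ
      simp only [hA2, setA, mem_filter, mem_univ, true_and] at hσ ⊢
      refine ⟨fun j => ?_, by simp [hσ], by simp [hσ]⟩
      have := hσ.1 (-(j + 1))
      rw [Sym2.eq_swap]
      simpa using this
    · intro σ hσ
      simp only [hA2, setA, mem_filter, mem_univ, true_and] at hσ ⊢
      refine ⟨fun j => ?_, by simp [hσ], by simp [hσ]⟩
      have := hσ.1 (-(j + 1))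
      rw [Sym2.eq_swap]
      simpa using this
    · intro σ _; ext; simp
    · intro σ _; ext; simp
  have hun : ({σ : Perm (Fin n) | Av F σ ∧ σ 0 = u} : Finset _) = (setA F u v ∪ A2) ∪ setB F u v := by
    ext σ
    simp only [hA2, setA, setB, mem_filter, mem_univ, true_and, mem_union]
    constructor
    · rintro ⟨h, h0⟩
      have q0 : (σ.symm v).val ≠ 0 := by
        intro hh
        have : σ.symm v = 0 := Fin.ext hh
        rw [Equiv.symm_apply_eq] at this
        exact huv (by rw [this, h0])
      by_cases q1 : (σ.symm v).val = 1
      · have : σ.symm v = 1 := Fin.ext (by omega)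
        rw [Equiv.symm_apply_eq] at this
        exact Or.inl (Or.inl ⟨h, h0, this.symm⟩)
      by_cases q2 : (σ.symm v).val = n - 1
      · have : σ.symm v = -1 := Fin.ext (by omega)
        rw [Equiv.symm_apply_eq] at this
        exact Or.inl (Or.inr ⟨h, h0, this.symm⟩)
      have := (σ.symm v).isLt
      exact Or.inr ⟨h, h0, by omega, by omega⟩
    · tauto
  rw [hun, card_union_of_disjoint, card_union_of_disjoint, hcard]
  · ring
  · rw [disjoint_left]
    intro σ h1 h2
    simp only [hA2, setA, mem_filter, mem_univ, true_and] at h1 h2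
    have := σ.injective (h1.2.2.trans h2.2.2.symm)
    rw [this] at e1
    omega
  · rw [disjoint_left]
    intro σ h1 h2
    simp only [hA2, setA, setB, mem_filter, mem_univ, true_and, mem_union] at h1 h2
    rcases h1 with h1 | h1
    · have := h1.2.2
      rw [← Equiv.eq_symm_apply] at this
      rw [← this] at h2; omega
    · have := h1.2.2
      rw [← Equiv.eq_symm_apply] at this
      rw [← this] at h2; omega

lemma start_insert (hn : 4 ≤ n) (F : Finset (Sym2 (Fin n))) {u v : Fin n} (huv : u ≠ v) :
    ({σ : Perm (Fin n) | Av (insert s(u, v) F) σ ∧ σ 0 = u} : Finset _) = setB F u v := by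
  have e1 := val_one (n := n) (by omega)
  ext σ
  simp only [setB, mem_filter, mem_univ, true_and]
  have hA : Av (insert s(u, v) F) σ ↔ (∀ j, s(σ j, σ (j + 1)) ≠ s(u, v)) ∧ Av F σ := by
    simp only [Av, mem_insert, not_or, forall_and, ne_eq]
  rw [hA]
  constructor
  · rintro ⟨⟨h, h'⟩, h0⟩
    refine ⟨h', h0, ?_, ?_⟩
    · by_contra hlt
      by_cases q0 : (σ.symm v).val = 0
      · have : σ.symm v = 0 := Fin.ext q0
        rw [Equiv.symm_apply_eq] at this
        exact huv (by rw [this, h0])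
      · have : σ.symm v = 1 := Fin.ext (by omega)
        rw [Equiv.symm_apply_eq] at this
        apply h 0
        rw [zero_add, h0, ← this]
    · by_contra hlt
      have hv := val_succ (n := n) (by omega) (σ.symm v)
      have := (σ.symm v).isLt
      rw [if_pos (by omega)] at hv
      have h' : σ.symm v + 1 = 0 := Fin.ext hv
      apply h (σ.symm v)
      rw [h', h0, Equiv.apply_symm_apply, Sym2.eq_swap]
  · rintro ⟨h, h0, h1, h2⟩
    refine ⟨⟨?_, h⟩, h0⟩
    intro j heq
    rw [Sym2.eq_iff] at heq
    have hv := val_succ (n := n) (by omega) j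
    rcases heq with ⟨ha, hb⟩ | ⟨ha, hb⟩
    · have hj : j = 0 := σ.injective (ha.trans h0.symm)
      rw [← Equiv.eq_symm_apply] at hb
      rw [← hb, hj, zero_add] at h1
      omega
    · have hj : j + 1 = 0 := σ.injective (hb.trans h0.symm)
      rw [← Equiv.eq_symm_apply] at ha
      rw [← ha] at h1 h2
      rw [hj, if_neg (by omega)] at hv
      simp at hv

lemma real_upper {n d a b : ℝ} (hd : 0 ≤ d) (hn : 8 + 4 * d ≤ n) (ha : 0 ≤ a) (hb : 0 ≤ b)
    (h1 : a * (n - 3 - 2 * d) ≤ b) :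
    2 * a + b ≤ b * Real.exp (2 / n + (8 * d + 12) / n ^ 2) := by
  have hn0 : 0 < n := by linarith
  have h2 : a * n ≤ b * (1 + (4 * d + 6) / n) := by
    have hx : a ≤ 2 * b / n := by
      rw [le_div_iff₀ hn0]; nlinarith
    have e : b * (1 + (4 * d + 6) / n) = b + (2 * b / n) * (2 * d + 3) := by
      field_simp; ring
    rw [e]; nlinarith
  have h3 : 2 * a ≤ b * (2 / n + (8 * d + 12) / n ^ 2) := by
    have : b * (2 / n + (8 * d + 12) / n ^ 2) = 2 * (b * (1 + (4 * d + 6) / n)) / n := by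
      field_simp; ring
    rw [this, le_div_iff₀ hn0]; linarith
  have h4 := Real.add_one_le_exp (2 / n + (8 * d + 12) / n ^ 2)
  nlinarith

lemma real_lower {n d a b x : ℝ} (hd : 0 ≤ d) (hn : 8 + 4 * d ≤ n) (ha : 0 ≤ a) (hb : 0 ≤ b)
    (hx : 0 ≤ x) (h2 : b ≤ x + a * (n - 3)) (h3 : x * (n - 4 - 2 * d) ≤ b * (2 * d)) :
    b * Real.exp (2 / n - (8 * d + 12) / n ^ 2) ≤ 2 * a + b := by
  have hn0 : 0 < n := by linarith
  have hx' : x ≤ b * (4 * d / n) := by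
    have : b * (4 * d / n) = b * (4 * d) / n := by ring
    rw [this, le_div_iff₀ hn0]; nlinarith
  have h4 : b * (1 - 4 * d / n) ≤ a * n := by nlinarith
  have h5 : b * (2 / n - 8 * d / n ^ 2) ≤ 2 * a := by
    have : b * (2 / n - 8 * d / n ^ 2) = 2 * (b * (1 - 4 * d / n)) / n := by
      field_simp; ring
    rw [this, div_le_iff₀ hn0]; linarith
  set y := 2 / n - (8 * d + 12) / n ^ 2 with hy
  have hy2 : |y| ≤ 2 / n := by
    have e : (8 * d + 12) / n ^ 2 ≤ 4 / n := by
      rw [div_le_div_iff₀ (by positivity) hn0]; nlinarith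
    have e0 : 0 ≤ (8 * d + 12) / n ^ 2 := by positivity
    have e4 : 4 / n = 2 * (2 / n) := by ring
    rw [abs_le]; constructor <;> linarith
  have hlt : 2 / n ≤ 1 := by rw [div_le_one hn0]; linarith
  have h6 := (abs_le.mp (Real.abs_exp_sub_one_sub_id_le (hy2.trans hlt))).2
  have h7 : y ^ 2 ≤ (2 / n) ^ 2 := sq_le_sq' (by have := abs_le.mp hy2; linarith) (le_of_abs_le hy2)
  have h8 : y + (2 / n) ^ 2 ≤ 2 / n - 8 * d / n ^ 2 := by
    have : 2 / n - 8 * d / n ^ 2 - (y + (2 / n) ^ 2) = 8 / n ^ 2 := by rw [hy]; ring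
    have : 0 ≤ 8 / n ^ 2 := by positivity
    linarith
  have h9 : Real.exp y ≤ 1 + (2 / n - 8 * d / n ^ 2) := by linarith
  nlinarith

lemma T_step {F : Finset (Sym2 (Fin n))} {d : ℕ} (hF : DegLe F d) (hn : 8 + 4 * d ≤ n)
    {e : Sym2 (Fin n)} (hd : ¬ e.IsDiag) (he : e ∉ F) :
    Real.exp (-(2 / n) - (8 * d + 12) / n ^ 2) * T F ≤ T (insert e F) ∧
    (T (insert e F) : ℝ) ≤ Real.exp (-(2 / n) + (8 * d + 12) / n ^ 2) * T F := by
  induction e using Sym2.ind with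
  | _ u v =>
  have huv : u ≠ v := by simpa using hd
  have h1 := countA hF (by omega) u v
  have h2 := countB (by omega) u v he
  have h3 := countBad hF (by omega) u v
  rw [T_eq F u, T_eq (insert _ F) u, start_insert (by omega) F huv, card_start (by omega) F huv]
  generalize #(setA F u v) = a at *
  generalize #(setB F u v) = b at *
  generalize #(setBad F u v) = x at *
  have hnR : (8 : ℝ) + 4 * d ≤ n := by exact_mod_cast hn
  have h1' : (a : ℝ) * (n - 3 - 2 * d) ≤ b := by
    have : ((n - 3 - 2 * d : ℕ) : ℝ) = n - 3 - 2 * d := by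
      rw [Nat.cast_sub (by omega), Nat.cast_sub (by omega)]; push_cast; ring
    rw [← this]; exact_mod_cast h1
  have h2' : (b : ℝ) ≤ x + a * (n - 3) := by
    have : ((n - 3 : ℕ) : ℝ) = n - 3 := by
      rw [Nat.cast_sub (by omega)]; push_cast; ring
    rw [← this]; exact_mod_cast h2
  have h3' : (x : ℝ) * (n - 4 - 2 * d) ≤ b * (2 * d) := by
    have : ((n - 4 - 2 * d : ℕ) : ℝ) = n - 4 - 2 * d := by
      rw [Nat.cast_sub (by omega), Nat.cast_sub (by omega)]; push_cast; ring
    rw [← this]; exact_mod_cast h3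
  have k1 := real_upper (Nat.cast_nonneg d) hnR (Nat.cast_nonneg a) (Nat.cast_nonneg b) h1'
  have k2 := real_lower (Nat.cast_nonneg d) hnR (Nat.cast_nonneg a) (Nat.cast_nonneg b)
    (Nat.cast_nonneg x) h2' h3'
  have hn0 : (0 : ℝ) ≤ n := Nat.cast_nonneg n
  push_cast
  constructor
  · have e : (-(2 / (n : ℝ)) - (8 * d + 12) / n ^ 2) = -(2 / (n : ℝ) + (8 * d + 12) / n ^ 2) := by ring
    rw [e, Real.exp_neg, inv_mul_le_iff₀ (Real.exp_pos _)]
    calc (n : ℝ) * (2 * a + b) ≤ n * (b * Real.exp (2 / n + (8 * d + 12) / n ^ 2)) := by gcongr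
      _ = _ := by ring
  · have e : (-(2 / (n : ℝ)) + (8 * d + 12) / n ^ 2) = -(2 / (n : ℝ) - (8 * d + 12) / n ^ 2) := by ring
    rw [e, Real.exp_neg, le_inv_mul_iff₀ (Real.exp_pos _)]
    calc _ = (n : ℝ) * (b * Real.exp (2 / n - (8 * d + 12) / n ^ 2)) := by ring
      _ ≤ n * (2 * a + b) := by gcongr

lemma DegLe.mono {F G : Finset (Sym2 (Fin n))} {d : ℕ} (hG : DegLe G d) (h : F ⊆ G) : DegLe F d := by
  intro x
  refine le_trans (card_le_card ?_) (hG x)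
  intro y hy
  simp only [mem_filter, mem_univ, true_and] at hy ⊢
  exact h hy

lemma T_bounds {d : ℕ} (hn : 8 + 4 * d ≤ n) (F : Finset (Sym2 (Fin n))) :
    DegLe F d → (∀ e ∈ F, ¬ e.IsDiag) →
    Real.exp (#F * (-(2 / n) - (8 * d + 12) / n ^ 2)) * T (∅ : Finset (Sym2 (Fin n))) ≤ T F ∧
    (T F : ℝ) ≤ Real.exp (#F * (-(2 / n) + (8 * d + 12) / n ^ 2)) *
      T (∅ : Finset (Sym2 (Fin n))) := by
  induction F using Finset.induction_on with
  | empty => intro _ _; simp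
  | insert e F he ih =>
    intro hdeg hdiag
    have hF := hdeg.mono (subset_insert e F)
    obtain ⟨i1, i2⟩ := ih hF (fun e' he' => hdiag e' (mem_insert_of_mem he'))
    obtain ⟨s1, s2⟩ := T_step hF hn (hdiag e (mem_insert_self _ _)) he
    rw [card_insert_of_notMem he]
    push_cast
    rw [add_mul, add_mul, Real.exp_add, Real.exp_add, one_mul, one_mul]
    constructor
    · refine le_trans ?_ s1
      rw [mul_comm (Real.exp _) (Real.exp _), mul_assoc]
      gcongr
    · refine le_trans s2 ?_
      rw [mul_comm (Real.exp _) (Real.exp _), mul_assoc]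
      gcongr

/-- Edge set of the cyclic sequence. -/
noncomputable def ecyc (σ : Perm (Fin n)) : Finset (Sym2 (Fin n)) :=
  univ.image fun j => s(σ j, σ (j + 1))

lemma av_iff (F : Finset (Sym2 (Fin n))) (σ : Perm (Fin n)) : Av F σ ↔ Disjoint (ecyc σ) F := by
  rw [disjoint_left]
  simp [Av, ecyc]

lemma ecyc_mul (π σ : Perm (Fin n)) : ecyc (π * σ) = (ecyc σ).image (Sym2.map π) := by
  simp [ecyc, image_image, Function.comp_def]

lemma exists_of_ham (hn : 3 ≤ n) {E : Finset (Sym2 (Fin n))} (h : IsHamCycle n E) :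
    ∃ σ, ecyc σ = E := by
  obtain ⟨v, w, hw, rfl⟩ := h
  have hl : w.length = n := by simpa using hw.length_eq
  have hinj : Function.Injective (fun j : Fin n => w.getVert j.val) := by
    intro a b hab
    apply Fin.ext
    have := a.isLt
    have := b.isLt
    exact hw.isCycle.getVert_injOn' (by simp only [Set.mem_ofPred_eq]; omega) (by simp only [Set.mem_ofPred_eq]; omega) hab
  refine ⟨Equiv.ofBijective _ (Finite.injective_iff_bijective.mp hinj), ?_⟩
  have hwrap : ∀ j : Fin n, w.getVert (j + 1).val = w.getVert (j.val + 1) := by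
    intro j
    rw [val_succ (by omega)]
    split_ifs with hj
    · rw [hj, SimpleGraph.Walk.getVert_zero]
      have hg := w.getVert_length
      rw [hl] at hg
      exact hg.symm
    · rfl
  ext e
  simp only [ecyc, mem_image, mem_univ, true_and, List.mem_toFinset, Equiv.ofBijective_apply, hwrap]
  induction e using Sym2.ind with
  | _ x y =>
  rw [SimpleGraph.Walk.mk_mem_edges_iff_exists]
  constructor
  · rintro ⟨j, hj⟩
    exact ⟨j.val, by have := j.isLt; omega, hj⟩
  · rintro ⟨j, hj, h⟩
    exact ⟨⟨j, by omega⟩, h⟩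

lemma ham_ecyc (hn : 3 ≤ n) (σ : Perm (Fin n)) : IsHamCycle n (ecyc σ) := by
  have h0 : ∃ E, IsHamCycle n E := by
    obtain ⟨m, rfl⟩ : ∃ m, n = m + 3 := ⟨n - 3, by omega⟩
    refine ⟨_, 0, (SimpleGraph.cycleGraph.cycle m).map (.ofLE le_top), ?_, rfl⟩
    apply SimpleGraph.Walk.IsHamiltonianCycle.map Function.bijective_id
    rw [SimpleGraph.Walk.isHamiltonianCycle_iff_isCycle_and_length_eq]
    exact ⟨SimpleGraph.cycleGraph.isCycle_cycle, by simp⟩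
  obtain ⟨E, hE⟩ := h0
  obtain ⟨τ, rfl⟩ := exists_of_ham hn hE
  have : σ = (σ * τ⁻¹) * τ := by group
  rw [this, ecyc_mul]
  obtain ⟨v, w, hw, h⟩ := hE
  rw [h]
  let f : (⊤ : SimpleGraph (Fin n)) ≃g (⊤ : SimpleGraph (Fin n)) := SimpleGraph.Iso.completeGraph (σ * τ⁻¹)
  refine ⟨_, w.map f.toHom, hw.map f.bijective, ?_⟩
  ext e
  simp [SimpleGraph.Walk.edges_map, f]
  rfl

lemma ham_card {E : Finset (Sym2 (Fin n))} (h : IsHamCycle n E) : #E = n := by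
  obtain ⟨v, w, hw, rfl⟩ := h
  rw [List.toFinset_card_of_nodup hw.isCycle.isTrail.edges_nodup, SimpleGraph.Walk.length_edges]
  simpa using hw.length_eq

lemma ham_diag {E : Finset (Sym2 (Fin n))} (h : IsHamCycle n E) : ∀ e ∈ E, ¬ e.IsDiag := by
  obtain ⟨v, w, hw, rfl⟩ := h
  intro e he
  exact SimpleGraph.not_isDiag_of_mem_edgeSet _ (w.edges_subset_edgeSet (List.mem_toFinset.mp he))

lemma ham_deg (hn : 3 ≤ n) {E : Finset (Sym2 (Fin n))} (h : IsHamCycle n E) : DegLe E 2 := by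
  obtain ⟨σ, rfl⟩ := exists_of_ham hn h
  intro x
  refine le_trans (card_le_card (t := {σ (σ.symm x + 1), σ (σ.symm x - 1)}) ?_) card_le_two
  intro y hy
  simp only [ecyc, mem_filter, mem_univ, true_and, mem_image, Sym2.eq_iff] at hy
  obtain ⟨j, ⟨rfl, rfl⟩ | ⟨rfl, rfl⟩⟩ := hy <;> simp

/-- The Hamilton cycles. -/
noncomputable def Ham (n : ℕ) : Finset (Finset (Sym2 (Fin n))) := {E | IsHamCycle n E}

lemma fibre_card (hn : 3 ≤ n) {E : Finset (Sym2 (Fin n))} (h : IsHamCycle n E) :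
    #{σ : Perm (Fin n) | ecyc σ = E} = #{σ : Perm (Fin n) | ecyc σ = ecyc 1} := by
  obtain ⟨τ, rfl⟩ := exists_of_ham hn h
  apply card_bij' (fun σ _ => τ⁻¹ * σ) (fun σ _ => τ * σ)
  · intro σ hσ
    simp only [mem_filter, mem_univ, true_and] at hσ ⊢
    rw [ecyc_mul, hσ, ← ecyc_mul]; simp
  · intro σ hσ
    simp only [mem_filter, mem_univ, true_and] at hσ ⊢
    rw [ecyc_mul, hσ, ← ecyc_mul]; simp
  · intro σ _; simp
  · intro σ _; simp

lemma T_ham (hn : 3 ≤ n) (F : Finset (Sym2 (Fin n))) :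
    T F = #{E ∈ Ham n | Disjoint E F} * #{σ : Perm (Fin n) | ecyc σ = ecyc 1} := by
  unfold T
  rw [card_eq_sum_card_fiberwise (f := ecyc) (t := {E ∈ Ham n | Disjoint E F})]
  · rw [sum_congr rfl (g := fun _ => #{σ : Perm (Fin n) | ecyc σ = ecyc 1})]
    · simp
    intro E hE
    simp only [mem_filter, mem_univ, true_and, Ham] at hE
    rw [← fibre_card hn hE.1]
    congr 1
    ext σ
    simp only [mem_filter, mem_univ, true_and, av_iff]
    constructor
    · exact fun h => h.2
    · rintro rfl; exact ⟨hE.2, rfl⟩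
  · intro σ hσ
    simp only [coe_filter, Set.mem_ofPred_eq, mem_univ, true_and, av_iff, Ham, mem_filter] at hσ ⊢
    exact ⟨ham_ecyc hn σ, hσ⟩

lemma ham_bounds {d : ℕ} (hn : 8 + 4 * d ≤ n) {F : Finset (Sym2 (Fin n))}
    (hd : DegLe F d) (hdiag : ∀ e ∈ F, ¬ e.IsDiag) :
    Real.exp (#F * (-(2 / n) - (8 * d + 12) / n ^ 2)) * #(Ham n) ≤ #{E ∈ Ham n | Disjoint E F} ∧
    (#{E ∈ Ham n | Disjoint E F} : ℝ) ≤ Real.exp (#F * (-(2 / n) + (8 * d + 12) / n ^ 2)) *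
      #(Ham n) := by
  obtain ⟨h1, h2⟩ := T_bounds hn F hd hdiag
  rw [T_ham (by omega) F, T_ham (by omega) ∅] at h1 h2
  have hc : 0 < #{σ : Perm (Fin n) | ecyc σ = ecyc 1} := card_pos.mpr ⟨1, by simp⟩
  generalize #{σ : Perm (Fin n) | ecyc σ = ecyc 1} = c at *
  have hc' : (0 : ℝ) < c := by exact_mod_cast hc
  simp only [disjoint_empty_right, filter_true, Nat.cast_mul, ← mul_assoc] at h1 h2
  exact ⟨le_of_mul_le_mul_right h1 hc', le_of_mul_le_mul_right h2 hc'⟩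


/-- Tuples of Hamilton cycles, the first `i` pairwise disjoint. -/
noncomputable def tup (n k i : ℕ) : Finset (Fin k → Finset (Sym2 (Fin n))) :=
  {f | (∀ j, IsHamCycle n (f j)) ∧
    ∀ a b : Fin k, (a : ℕ) < (b : ℕ) → (b : ℕ) < i → Disjoint (f a) (f b)}

/-- Union of the first `i` cycles. -/
noncomputable def uni {n k : ℕ} (f : Fin k → Finset (Sym2 (Fin n))) (i : ℕ) : Finset (Sym2 (Fin n)) :=
  ({a : Fin k | a.val < i} : Finset (Fin k)).biUnion f

lemma card_lt (k i : ℕ) (h : i ≤ k) : #({a : Fin k | a.val < i} : Finset (Fin k)) = i := by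
  have : ({a : Fin k | a.val < i} : Finset (Fin k)).map Fin.valEmbedding = range i := by
    ext x
    simp only [mem_map, mem_filter, mem_univ, true_and, Fin.valEmbedding_apply, mem_range]
    constructor
    · rintro ⟨a, h, rfl⟩; omega
    · intro h; exact ⟨⟨x, by omega⟩, by simp only; omega, rfl⟩
  rw [← card_map, this, card_range]

lemma uni_card {k i : ℕ} (hi : i ≤ k) {f : Fin k → Finset (Sym2 (Fin n))} (hf : f ∈ tup n k i) :
    #(uni f i) = i * n := by
  simp only [tup, mem_filter, mem_univ, true_and] at hf
  unfold uni
  rw [card_biUnion, sum_congr rfl (g := fun _ => n), sum_const, card_lt k i hi, smul_eq_mul]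
  · intro a _; exact ham_card (hf.1 a)
  · intro a ha b hb hab
    have ha : a.val < i := by simpa using ha
    have hb : b.val < i := by simpa using hb
    have hne : a.val ≠ b.val := fun h => hab (Fin.ext h)
    rcases lt_or_gt_of_ne hne with h | h
    · exact hf.2 a b h hb
    · exact (hf.2 b a h ha).symm

lemma uni_deg (hn : 3 ≤ n) {k i : ℕ} (hi : i ≤ k) {f : Fin k → Finset (Sym2 (Fin n))}
    (hf : f ∈ tup n k i) : DegLe (uni f i) (2 * i) := by
  simp only [tup, mem_filter, mem_univ, true_and] at hf
  intro x
  have hsub : ({y | s(x, y) ∈ uni f i} : Finset (Fin n)) ⊆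
      ({a : Fin k | a.val < i} : Finset (Fin k)).biUnion fun a => {y | s(x, y) ∈ f a} := by
    intro y hy
    simpa [uni] using hy
  refine (card_le_card hsub).trans (card_biUnion_le.trans ?_)
  refine (sum_le_sum (g := fun _ => 2) fun a _ => ham_deg hn (hf.1 a) x).trans ?_
  rw [sum_const, card_lt k i hi, smul_eq_mul, mul_comm]

lemma uni_diag {k i : ℕ} {f : Fin k → Finset (Sym2 (Fin n))} (hf : f ∈ tup n k i) :
    ∀ e ∈ uni f i, ¬ e.IsDiag := by
  simp only [tup, mem_filter, mem_univ, true_and] at hf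
  intro e he
  simp only [uni, mem_biUnion] at he
  obtain ⟨a, _, ha⟩ := he
  exact ham_diag (hf.1 a) e ha

lemma tup_step {k i : ℕ} (hi : i < k) :
    #(tup n k (i + 1)) * #(Ham n) = ∑ f ∈ tup n k i, #{E ∈ Ham n | Disjoint E (uni f i)} := by
  rw [← card_sigma, ← card_product]
  set i' : Fin k := ⟨i, hi⟩ with hi'
  symm
  refine card_bij' (fun p _ => (Function.update p.1 i' p.2, p.1 i'))
    (fun p _ => ⟨Function.update p.1 i' p.2, p.1 i'⟩) ?_ ?_ ?_ ?_
  · rintro ⟨f, E⟩ h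
    simp only [mem_sigma, mem_filter, mem_univ, true_and, tup, Ham, uni, disjoint_biUnion_right,
      mem_product] at h ⊢
    obtain ⟨⟨h1, h2⟩, h3, h4⟩ := h
    refine ⟨⟨fun j => ?_, fun a b hab hb => ?_⟩, h1 _⟩
    · by_cases hj : j = i'
      · subst hj; simpa using h3
      · simpa [hj] using h1 j
    · have ha : a ≠ i' := fun h => by
        have : a.val = i := by rw [h]
        omega
      by_cases hb' : b = i'
      · subst hb'
        simpa [ha] using (h4 a (hab)).symm
      · have : b.val ≠ i := fun h => hb' (Fin.ext h)
        simpa [ha, hb'] using h2 a b hab (by omega)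
  · rintro ⟨g, E⟩ h
    simp only [mem_sigma, mem_filter, mem_univ, true_and, tup, Ham, uni, disjoint_biUnion_right,
      mem_product] at h ⊢
    obtain ⟨⟨h1, h2⟩, h3⟩ := h
    refine ⟨⟨fun j => ?_, fun a b hab hb => ?_⟩, h1 _, fun a ha => ?_⟩
    · by_cases hj : j = i'
      · subst hj; simpa using h3
      · simpa [hj] using h1 j
    · have ha : a ≠ i' := fun h => by
        have : a.val = i := by rw [h]
        omega
      have hb' : b ≠ i' := fun h => by
        have : b.val = i := by rw [h]
        omega
      simpa [ha, hb'] using h2 a b hab (by omega)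
    · have ha' : a ≠ i' := fun h => by
        have : a.val = i := by rw [h]
        omega
      simpa [ha'] using (h2 a i' ha (by simp [hi'])).symm
  · rintro ⟨f, E⟩ _; simp
  · rintro ⟨f, E⟩ _; simp

lemma tup_bounds {k i : ℕ} (hi : i < k) (hn : 8 + 8 * i ≤ n) :
    Real.exp (-(2 * i : ℝ) - i * (16 * i + 12) / n) * #(tup n k i) ≤ #(tup n k (i + 1)) ∧
    (#(tup n k (i + 1)) : ℝ) ≤ Real.exp (-(2 * i : ℝ) + i * (16 * i + 12) / n) * #(tup n k i) := by
  have hH : 0 < #(Ham n) := card_pos.mpr ⟨ecyc 1, by simp [Ham, ham_ecyc (n := n) (by omega) 1]⟩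
  have hH' : (0 : ℝ) < #(Ham n) := by exact_mod_cast hH
  have hn0 : (n : ℝ) ≠ 0 := by
    have : n ≠ 0 := by omega
    exact_mod_cast this
  have key : (#(tup n k (i + 1)) : ℝ) * #(Ham n) =
      ∑ f ∈ tup n k i, (#{E ∈ Ham n | Disjoint E (uni f i)} : ℝ) := by
    exact_mod_cast tup_step (n := n) hi
  have hb : ∀ f ∈ tup n k i,
      Real.exp (-(2 * i : ℝ) - i * (16 * i + 12) / n) * #(Ham n) ≤ #{E ∈ Ham n | Disjoint E (uni f i)} ∧
      (#{E ∈ Ham n | Disjoint E (uni f i)} : ℝ) ≤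
        Real.exp (-(2 * i : ℝ) + i * (16 * i + 12) / n) * #(Ham n) := by
    intro f hf
    have h := ham_bounds (d := 2 * i) (by omega) (uni_deg (by omega) hi.le hf) (uni_diag hf)
    rw [uni_card hi.le hf] at h
    have e1 : ((i * n : ℕ) : ℝ) * (-(2 / n) - (8 * (2 * i : ℕ) + 12) / n ^ 2) =
        -(2 * i : ℝ) - i * (16 * i + 12) / n := by
      push_cast; field_simp; ring
    have e2 : ((i * n : ℕ) : ℝ) * (-(2 / n) + (8 * (2 * i : ℕ) + 12) / n ^ 2) =
        -(2 * i : ℝ) + i * (16 * i + 12) / n := by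
      push_cast; field_simp; ring
    rw [e1, e2] at h
    exact h
  constructor
  · apply le_of_mul_le_mul_right _ hH'
    rw [key]
    calc _ = ∑ _f ∈ tup n k i, Real.exp (-(2 * i : ℝ) - i * (16 * i + 12) / n) * #(Ham n) := by
          rw [sum_const, nsmul_eq_mul]; ring
      _ ≤ _ := sum_le_sum fun f hf => (hb f hf).1
  · apply le_of_mul_le_mul_right _ hH'
    rw [key]
    calc _ ≤ ∑ _f ∈ tup n k i, Real.exp (-(2 * i : ℝ) + i * (16 * i + 12) / n) * #(Ham n) :=
          sum_le_sum fun f hf => (hb f hf).2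
      _ = _ := by rw [sum_const, nsmul_eq_mul]; ring

lemma tup_pos {k i : ℕ} (hi : i ≤ k) (hn : 8 + 8 * i ≤ n) : 0 < #(tup n k i) := by
  induction i with
  | zero =>
    exact card_pos.mpr ⟨fun _ => ecyc 1, by simp [tup, ham_ecyc (n := n) (by omega) 1]⟩
  | succ i ih =>
    have h0 : (0 : ℝ) < #(tup n k i) := by exact_mod_cast ih (by omega) (by omega)
    have h := (tup_bounds (n := n) (k := k) (i := i) (by omega) (by omega)).1
    have : (0 : ℝ) < #(tup n k (i + 1)) := lt_of_lt_of_le (by positivity) h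
    exact_mod_cast this

lemma error_bound {n k i : ℕ} (hn : 64 ≤ n) (hk : 1 ≤ k) (hkn : (k : ℝ) ≤ (n : ℝ) ^ ((1 : ℝ) / 100))
    (hi : i < k) :
    (i * (16 * i + 12) / n : ℝ) ≤ 17500 / ((k : ℝ) ^ 2 * Real.log (n : ℝ) ^ 4) := by
  have hn1 : (64 : ℝ) ≤ n := by exact_mod_cast hn
  have hn0 : (0 : ℝ) < n := by linarith
  have hk1 : (1 : ℝ) ≤ k := by exact_mod_cast hk
  have hik : (i : ℝ) ≤ k := by exact_mod_cast hi.le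
  have hi0 : (0 : ℝ) ≤ i := Nat.cast_nonneg i
  have hlog0 : 0 < Real.log n := Real.log_pos (by linarith)
  set r := (n : ℝ) ^ ((1 : ℝ) / 100) with hr
  have hr1 : 1 ≤ r := hk1.trans hkn
  have hrn : r ^ 100 = n := by
    rw [hr, ← Real.rpow_natCast, ← Real.rpow_mul hn0.le]; norm_num
  have hlog : Real.log n ≤ 5 * r ^ 20 := by
    have h := Real.log_le_rpow_div hn0.le (ε := 1 / 5) (by norm_num)
    have e : r ^ 20 = (n : ℝ) ^ ((1 : ℝ) / 5) := by
      rw [hr, ← Real.rpow_natCast, ← Real.rpow_mul hn0.le]; norm_num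
    rw [e]; linarith
  rw [div_le_div_iff₀ hn0 (by positivity)]
  have h1 : (i * (16 * i + 12) : ℝ) ≤ 28 * k ^ 2 := by nlinarith
  calc (i * (16 * i + 12) : ℝ) * (k ^ 2 * Real.log n ^ 4)
      ≤ (28 * k ^ 2) * (k ^ 2 * Real.log n ^ 4) := by gcongr
    _ = 28 * (k ^ 4 * Real.log n ^ 4) := by ring
    _ ≤ 28 * (r ^ 4 * (5 * r ^ 20) ^ 4) := by gcongr
    _ = 17500 * r ^ 84 := by ring
    _ ≤ 17500 * r ^ 100 := by gcongr <;> norm_num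
    _ = 17500 * n := by rw [hrn]

lemma size_bound {n k i : ℕ} (hn : 64 ≤ n) (hkn : (k : ℝ) ≤ (n : ℝ) ^ ((1 : ℝ) / 100))
    (hi : i < k) : 8 + 8 * i ≤ n := by
  have hn1 : (64 : ℝ) ≤ n := by exact_mod_cast hn
  have h1 : (k : ℝ) ≤ Real.sqrt n := by
    rw [Real.sqrt_eq_rpow]
    exact hkn.trans (Real.rpow_le_rpow_of_exponent_le (by linarith) (by norm_num))
  have h2 : (8 : ℝ) ≤ Real.sqrt n := Real.le_sqrt_of_sq_le (by linarith)
  have h3 := Real.mul_self_sqrt (Nat.cast_nonneg (α := ℝ) n)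
  have h4 : (i : ℝ) + 1 ≤ k := by exact_mod_cast hi
  have : (8 : ℝ) + 8 * i ≤ n := by nlinarith
  exact_mod_cast this

lemma ncard_tup (n k i : ℕ) : Set.ncard {f : Fin k → Finset (Sym2 (Fin n)) |
    (∀ j, IsHamCycle n (f j)) ∧
    ∀ a b : Fin k, (a : ℕ) < (b : ℕ) → (b : ℕ) < i → Disjoint (f a) (f b)} = #(tup n k i) := by
  rw [← Set.ncard_coe_finset]
  congr 1
  ext f
  simp [tup]

end count
end HamProof

/-- There are `C > 0` and `N` such that for `n ≥ N`, `1 ≤ k ≤ n^{1/100}` and `0 ≤ i ≤ k-1`: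
if `H_1, …, H_k` are i.i.d. uniformly random Hamilton cycles of `K_n` and `E_j` is the event
that `H_j` is edge-disjoint from `H_1, …, H_{j-1}`, then
`Pr[E_{i+1} ∣ E_1 ∩ ⋯ ∩ E_i] ∈ [exp(−C/(k²(log n)⁴))·e^{−2i}, exp(C/(k²(log n)⁴))·e^{−2i}]`.
Since the `H_j` are i.i.d. uniform, the conditional probability equals the ratio of the number
of `k`-tuples of Hamilton cycles whose first `i+1` entries are pairwise edge-disjoint to the
number of `k`-tuples whose first `i` entries are pairwise edge-disjoint. -/
theorem conditional_probability_next_hamilton_cycle_disjoint :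
    ∃ C : ℝ, 0 < C ∧ ∃ N : ℕ, ∀ n : ℕ, N ≤ n → ∀ k : ℕ, 1 ≤ k →
      (k : ℝ) ≤ (n : ℝ) ^ ((1 : ℝ) / 100) → ∀ i : ℕ, i ≤ k - 1 →
      (Set.ncard {f : Fin k → Finset (Sym2 (Fin n)) |
          (∀ j, IsHamCycle n (f j)) ∧
          ∀ a b : Fin k, (a : ℕ) < (b : ℕ) → (b : ℕ) < i + 1 → Disjoint (f a) (f b)} : ℝ) /
      (Set.ncard {f : Fin k → Finset (Sym2 (Fin n)) |
          (∀ j, IsHamCycle n (f j)) ∧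
          ∀ a b : Fin k, (a : ℕ) < (b : ℕ) → (b : ℕ) < i → Disjoint (f a) (f b)} : ℝ) ∈
      Set.Icc
        (Real.exp (-(C / ((k : ℝ) ^ 2 * Real.log (n : ℝ) ^ 4))) * Real.exp (-(2 * i : ℝ)))
        (Real.exp (C / ((k : ℝ) ^ 2 * Real.log (n : ℝ) ^ 4)) * Real.exp (-(2 * i : ℝ))) := by
  refine ⟨17500, by norm_num, 64, ?_⟩
  intro n hn k hk hkn i hi
  have hik : i < k := by omega
  have : NeZero n := ⟨by omega⟩
  have hsz := HamProof.size_bound hn hkn hik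
  have herr := HamProof.error_bound hn hk hkn hik
  rw [HamProof.ncard_tup n k (i + 1), HamProof.ncard_tup n k i]
  obtain ⟨h1, h2⟩ := HamProof.tup_bounds (n := n) hik hsz
  have hpos : (0 : ℝ) < (HamProof.tup n k i).card := by
    exact_mod_cast HamProof.tup_pos (n := n) hik.le hsz
  rw [Set.mem_Icc, le_div_iff₀ hpos, div_le_iff₀ hpos, ← Real.exp_add, ← Real.exp_add]
  constructor
  · refine le_trans ?_ h1
    exact mul_le_mul_of_nonneg_right (Real.exp_le_exp.mpr (by linarith)) hpos.le
  · refine le_trans h2 ?_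
    exact mul_le_mul_of_nonneg_right (Real.exp_le_exp.mpr (by linarith)) hpos.le
end

section
/- There exist an absolute constant C > 0 and N ∈ ℕ such that the following holds for all n ≥ N. Let k be a positive integer with k ≤ n^{1/100}, let 0 ≤ i ≤ k−1, and let H_1, …, H_i be pairwise edge-disjoint Hamilton cycles in K_n. Let h be the number of Hamilton cycles of K_n whose edge set is disjoint from the union of the edge sets of H_1, …, H_i (equivalently, the number of Hamilton cycles in the graph obtained from K_n by deleting the edges of H_1, …, H_i). Then exp(−C/(k²·(log n)⁴))·e^{−2i}·(n−1)!/2 ≤ h ≤ exp(C/(k²·(log n)⁴))·e^{−2i}·(n−1)!/2. -/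
section hamAux

open scoped Fin.CommRing

/-- cyclic edge set of a permutation -/
def cycE {m : ℕ} (f : Equiv.Perm (Fin (m+3))) : Finset (Sym2 (Fin (m+3))) :=
  Finset.univ.image (fun j => s(f j, f (j+1)))

theorem mem_cycE {m : ℕ} (f : Equiv.Perm (Fin (m+3))) (e : Sym2 (Fin (m+3))) :
    e ∈ cycE f ↔ ∃ j, s(f j, f (j+1)) = e := by
  simp [cycE]

theorem fin_val_add_one {m : ℕ} (x : Fin (m+3)) :
    (x + 1).val = if x.val = m + 2 then 0 else x.val + 1 := by
  rw [Fin.val_add_one]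
  simp [Fin.ext_iff]

theorem fin_one_add_one_ne {m : ℕ} : (1 : Fin (m+3)) + 1 ≠ 0 := by
  intro h
  have := congrArg Fin.val h
  rw [fin_val_add_one] at this
  simp at this

theorem fin_one_ne {m : ℕ} : (1 : Fin (m+3)) ≠ 0 := by
  intro h
  have := congrArg Fin.val h
  simp at this

theorem fin_add_one_ne {m : ℕ} (x : Fin (m+3)) : x + 1 ≠ x := by
  intro h
  exact fin_one_ne (m := m) (add_eq_left.mp h)

theorem fin_add_two_ne {m : ℕ} (x : Fin (m+3)) : x + 1 + 1 ≠ x := by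
  intro h
  exact fin_one_add_one_ne (m := m) (by rw [add_assoc] at h; simpa using h)

theorem isHam_of_cycE {m : ℕ} (f : Equiv.Perm (Fin (m+3))) : IsHamCycle (m+3) (cycE f) := by
  have hadj : ∀ {a b : Fin (m+3)}, (SimpleGraph.cycleGraph (m+3)).Adj a b →
      (⊤ : SimpleGraph (Fin (m+3))).Adj (f a) (f b) := by
    intro a b h
    simp only [SimpleGraph.top_adj, ne_eq, EmbeddingLike.apply_eq_iff_eq]
    exact h.ne
  let φ : SimpleGraph.cycleGraph (m+3) →g (⊤ : SimpleGraph (Fin (m+3))) := ⟨f, hadj⟩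
  have hg : ∀ i : ℕ, i ≤ m + 3 → (SimpleGraph.cycleGraph.cycle m).getVert i = -((i : ℕ) : Fin (m+3)) := by
    intro i hi
    rw [SimpleGraph.cycleGraph.getVert_cycle hi]
    apply Fin.ext
    simp only [Fin.neg_def, Fin.val_natCast]
    rcases Nat.lt_or_ge i (m+3) with h | h
    · rw [Nat.mod_eq_of_lt h]
    · have : i = m + 3 := by omega
      subst this
      simp
  refine ⟨φ 0, (SimpleGraph.cycleGraph.cycle m).map φ, ?_, ?_⟩
  · apply SimpleGraph.Walk.IsHamiltonianCycle.map f.bijective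
    rw [SimpleGraph.Walk.isHamiltonianCycle_iff_isCycle_and_length_eq]
    exact ⟨SimpleGraph.cycleGraph.isCycle_cycle, by simp⟩
  · ext e
    rw [mem_cycE, List.mem_toFinset]
    induction e with | _ a b
    rw [SimpleGraph.Walk.mk_mem_edges_iff_exists]
    simp only [SimpleGraph.Walk.length_map, SimpleGraph.cycleGraph.length_cycle,
      SimpleGraph.Walk.getVert_map]
    constructor
    · rintro ⟨j, hj⟩
      refine ⟨(-(j+1)).val, (-(j+1)).isLt, ?_⟩
      rw [hg _ (by omega), hg _ (by omega), ← hj, Sym2.eq_swap]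
      have e0 : (((-(j+1)).val : ℕ) : Fin (m+3)) = -(j+1) := Fin.cast_val_eq_self _
      have e1 : -((((-(j+1)).val + 1 : ℕ)) : Fin (m+3)) = j := by
        rw [Nat.cast_add, e0]; ring
      have e2 : -(((-(j+1)).val : ℕ) : Fin (m+3)) = j + 1 := by
        rw [e0]; ring
      rw [e1, e2]
      rfl
    · rintro ⟨i, hi, h⟩
      refine ⟨-((i : Fin (m+3)) + 1), ?_⟩
      rw [hg _ (by omega), hg _ (by omega)] at h
      rw [← h, Sym2.eq_swap]
      have e1 : -((i : Fin (m+3)) + 1) + 1 = -(i : Fin (m+3)) := by ring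
      have e2 : -((i + 1 : ℕ) : Fin (m+3)) = -((i : Fin (m+3)) + 1) := by push_cast; ring
      rw [e1, e2]
      rfl

theorem isHam_iff {m : ℕ} (E : Finset (Sym2 (Fin (m+3)))) :
    IsHamCycle (m+3) E ↔ ∃ f, E = cycE f := by
  constructor
  · rintro ⟨v, w, hw, rfl⟩
    have hlen : w.length = m + 3 := by simpa using hw.length_eq
    have hinj : Function.Injective (fun j : Fin (m+3) => w.getVert j.val) := by
      intro a b hab
      apply Fin.ext
      apply hw.isCycle.getVert_injOn' _ _ hab
      · show a.val ≤ w.length - 1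
        omega
      · show b.val ≤ w.length - 1
        omega
    let f : Equiv.Perm (Fin (m+3)) := Equiv.ofBijective _ (Finite.injective_iff_bijective.mp hinj)
    have hf : ∀ j, f j = w.getVert j.val := fun j => rfl
    have hf1 : ∀ j, f (j+1) = w.getVert (j.val+1) := by
      intro j
      rw [hf, fin_val_add_one]
      split_ifs with h
      · rw [h]
        have h2 := w.getVert_length
        rw [hlen] at h2
        rw [h2]; simp
      · rfl
    refine ⟨f, ?_⟩
    ext e
    rw [mem_cycE, List.mem_toFinset]
    induction e with | _ a b
    rw [SimpleGraph.Walk.mk_mem_edges_iff_exists]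
    constructor
    · rintro ⟨i, hi, h⟩
      refine ⟨⟨i, by omega⟩, ?_⟩
      rw [hf1, hf]; exact h
    · rintro ⟨j, h⟩
      refine ⟨j.val, by omega, ?_⟩
      rw [hf1, hf] at h; exact h
  · rintro ⟨f, rfl⟩
    exact isHam_of_cycE f

theorem cycE_inj {m : ℕ} (f : Equiv.Perm (Fin (m+3))) :
    Function.Injective (fun j => s(f j, f (j+1))) := by
  intro a b h
  simp only [Sym2.eq_iff, EmbeddingLike.apply_eq_iff_eq] at h
  rcases h with h | ⟨h1, h2⟩
  · exact h.1
  · subst h1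
    exact absurd h2 (fin_add_two_ne b)

theorem card_cycE {m : ℕ} (f : Equiv.Perm (Fin (m+3))) : (cycE f).card = m + 3 := by
  rw [cycE, Finset.card_image_of_injective _ (cycE_inj f)]
  simp

theorem deg_cycE {m : ℕ} (f : Equiv.Perm (Fin (m+3))) (u : Fin (m+3)) :
    (Finset.univ.filter (fun w => s(u,w) ∈ cycE f)).card ≤ 2 := by
  refine le_trans (Finset.card_le_card (t := {f (f.symm u + 1), f (f.symm u - 1)}) ?_)
    Finset.card_le_two
  intro w hw
  simp only [Finset.mem_filter, Finset.mem_univ, true_and, mem_cycE, Sym2.eq_iff] at hw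
  simp only [Finset.mem_insert, Finset.mem_singleton]
  obtain ⟨j, ⟨h1, h2⟩ | ⟨h1, h2⟩⟩ := hw
  · left; rw [← h1, ← h2]; simp
  · right; rw [← h1, ← h2]; simp

theorem not_diag_cycE {m : ℕ} (f : Equiv.Perm (Fin (m+3))) (u : Fin (m+3)) : s(u,u) ∉ cycE f := by
  rw [mem_cycE]
  rintro ⟨j, h⟩
  simp only [Sym2.eq_iff, or_self] at h
  have := h.1.trans h.2.symm
  simp only [EmbeddingLike.apply_eq_iff_eq] at this
  exact fin_add_one_ne j this.symm

/-- the dihedral permutations -/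
def dih {m : ℕ} (p : Fin (m+3) × Bool) : Equiv.Perm (Fin (m+3)) :=
  if p.2 then Equiv.addLeft p.1 else Equiv.subLeft p.1

theorem dih_inj {m : ℕ} : Function.Injective (dih (m := m)) := by
  rintro ⟨a, b⟩ ⟨c, d⟩ h
  have h0 := DFunLike.congr_fun h 0
  have h1 := DFunLike.congr_fun h 1
  cases b <;> cases d <;> simp [dih] at h0 h1 ⊢
  · exact h0
  · subst h0
    exfalso
    apply fin_add_two_ne (m := m) (a - 1)
    rw [sub_add_cancel]
    exact h1.symm
  · subst h0
    exfalso
    apply fin_add_two_ne (m := m) (a - 1)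
    rw [sub_add_cancel]
    exact h1
  · exact h0

theorem cycE_dih {m : ℕ} (p : Fin (m+3) × Bool) (g : Equiv.Perm (Fin (m+3))) :
    cycE ((dih p).trans g) = cycE g := by
  obtain ⟨a, b⟩ := p
  ext e
  rw [mem_cycE, mem_cycE]
  cases b
  · simp only [dih, Equiv.trans_apply]
    constructor
    · rintro ⟨j, rfl⟩
      refine ⟨a - j - 1, ?_⟩
      rw [Sym2.eq_swap]
      have e1 : a - j - 1 + 1 = a - j := by ring
      have e2 : a - j - 1 = a - (j + 1) := by ring
      rw [e1, e2]
      rfl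
    · rintro ⟨j, rfl⟩
      refine ⟨a - j - 1, ?_⟩
      rw [Sym2.eq_swap]
      have e1 : a - (a - j - 1 + 1) = j := by ring
      have e2 : a - (a - j - 1) = j + 1 := by ring
      show s(g (a - (a - j - 1 + 1)), g (a - (a - j - 1))) = _
      rw [e1, e2]
  · simp only [dih, Equiv.trans_apply]
    constructor
    · rintro ⟨j, rfl⟩
      refine ⟨a + j, ?_⟩
      simp [add_assoc]
    · rintro ⟨j, rfl⟩
      refine ⟨j - a, ?_⟩
      have e1 : a + (j - a) = j := by ring
      have e2 : a + (j - a + 1) = j + 1 := by ring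
      show s(g (a + (j - a)), g (a + (j - a + 1))) = _
      rw [e1, e2]

theorem exists_dih {m : ℕ} (f g : Equiv.Perm (Fin (m+3))) (h : cycE f = cycE g) :
    ∃ p, (dih p).trans g = f := by
  let q : Equiv.Perm (Fin (m+3)) := f.trans g.symm
  have hq : ∀ j, q (j+1) = q j + 1 ∨ q j = q (j+1) + 1 := by
    intro j
    have h1 : s(f j, f (j+1)) ∈ cycE g := by
      rw [← h, mem_cycE]; exact ⟨j, rfl⟩
    rw [mem_cycE] at h1
    obtain ⟨i, hi⟩ := h1
    simp only [Sym2.eq_iff] at hi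
    simp only [q, Equiv.trans_apply]
    rcases hi with ⟨h1, h2⟩ | ⟨h1, h2⟩
    · left; rw [← h1, ← h2]; simp
    · right; rw [← h1, ← h2]; simp
  have hne : ∀ j, q (j+1+1) ≠ q j := by
    intro j hj
    exact fin_add_two_ne j (q.injective hj)
  have hcast : ∀ j : Fin (m+3), j = ((j.val : ℕ) : Fin (m+3)) := by
    intro j; simp
  rcases hq 0 with h0 | h0
  · refine ⟨(q 0, true), ?_⟩
    have key : ∀ j : ℕ, q ((j : Fin (m+3)) + 1) = q (j : Fin (m+3)) + 1 := by
      intro j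
      induction j with
      | zero => simpa using h0
      | succ j ih =>
        push_cast
        rcases hq ((j : Fin (m+3)) + 1) with h1 | h1
        · exact h1
        · exfalso
          rw [ih] at h1
          exact hne _ (add_right_cancel h1).symm
    have key2 : ∀ j : ℕ, q (j : Fin (m+3)) = q 0 + j := by
      intro j
      induction j with
      | zero => simp
      | succ j ih => push_cast; rw [key, ih, add_assoc]
    ext1 j
    have := key2 j.val
    simp only [Fin.cast_val_eq_self] at this
    simp only [Equiv.trans_apply, dih, if_true, Equiv.coe_addLeft, ← this]
    simp [q]
  · refine ⟨(q 0, false), ?_⟩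
    have key : ∀ j : ℕ, q (j : Fin (m+3)) = q ((j : Fin (m+3)) + 1) + 1 := by
      intro j
      induction j with
      | zero => simpa using h0
      | succ j ih =>
        push_cast
        rcases hq ((j : Fin (m+3)) + 1) with h1 | h1
        · exfalso
          rw [← ih] at h1
          exact hne _ h1
        · exact h1
    have key2 : ∀ j : ℕ, q (j : Fin (m+3)) = q 0 - j := by
      intro j
      induction j with
      | zero => simp
      | succ j ih => 
        push_cast
        have := key j
        rw [ih] at this
        rw [← sub_sub, this]; simp
    ext1 j
    have := key2 j.val
    simp only [Fin.cast_val_eq_self] at this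
    simp [Equiv.trans_apply, dih, ← this]
    simp [q]

/-- sequences avoiding `G` -/
def avoidS {m : ℕ} (G : Finset (Sym2 (Fin (m+3)))) : Finset (Equiv.Perm (Fin (m+3))) :=
  Finset.univ.filter (fun f => ∀ j, s(f j, f (j+1)) ∉ G)

theorem mem_avoidS {m : ℕ} (G : Finset (Sym2 (Fin (m+3)))) (f : Equiv.Perm (Fin (m+3))) :
    f ∈ avoidS G ↔ ∀ j, s(f j, f (j+1)) ∉ G := by simp [avoidS]

theorem card_fiber {m : ℕ} (g : Equiv.Perm (Fin (m+3))) :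
    (Finset.univ.filter (fun f => cycE f = cycE g)).card = 2 * (m+3) := by
  have : Finset.univ.filter (fun f => cycE f = cycE g) =
      Finset.univ.image (fun p => (dih p).trans g) := by
    ext f
    simp only [Finset.mem_filter, Finset.mem_univ, true_and, Finset.mem_image]
    constructor
    · exact exists_dih f g
    · rintro ⟨p, rfl⟩; exact cycE_dih p g
  rw [this, Finset.card_image_of_injective]
  · simp [mul_comm]
  · intro p q h
    apply dih_inj
    ext1 x
    have := DFunLike.congr_fun h x
    simpa using this

theorem mem_avoidS_iff {m : ℕ} (G : Finset (Sym2 (Fin (m+3)))) (f : Equiv.Perm (Fin (m+3))) :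
    f ∈ avoidS G ↔ Disjoint (cycE f) G := by
  rw [mem_avoidS, Finset.disjoint_left]
  constructor
  · intro h e he
    rw [mem_cycE] at he
    obtain ⟨j, rfl⟩ := he
    exact h j
  · intro h j
    apply h
    rw [mem_cycE]
    exact ⟨j, rfl⟩

theorem count_eq {m : ℕ} (G : Finset (Sym2 (Fin (m+3)))) :
    (avoidS G).card = 2 * (m+3) * Set.ncard {E | IsHamCycle (m+3) E ∧ Disjoint E G} := by
  have h1 : {E | IsHamCycle (m+3) E ∧ Disjoint E G} = ((avoidS G).image cycE : Finset _) := by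
    ext E
    simp only [Set.mem_ofPred_eq, Finset.coe_image, Set.mem_image, Finset.mem_coe, mem_avoidS_iff,
      isHam_iff]
    constructor
    · rintro ⟨⟨f, rfl⟩, h⟩; exact ⟨f, h, rfl⟩
    · rintro ⟨f, h, rfl⟩; exact ⟨⟨f, rfl⟩, h⟩
  rw [h1, Set.ncard_coe_finset, mul_comm]
  rw [Finset.card_eq_sum_card_image cycE (avoidS G)]
  apply Finset.sum_const_nat
  intro E hE
  obtain ⟨g, hg, rfl⟩ := Finset.mem_image.mp hE
  rw [← card_fiber g]
  congr 1
  ext f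
  simp only [Finset.mem_filter, Finset.mem_univ, true_and, and_iff_right_iff_imp]
  intro h
  rw [mem_avoidS_iff] at hg ⊢
  rw [h]; exact hg


/-- reversal of positions 1..p -/
def revFun {m : ℕ} (p x : Fin (m+3)) : Fin (m+3) :=
  if h : 1 ≤ x.val ∧ x.val ≤ p.val then ⟨p.val + 1 - x.val, by omega⟩ else x

theorem revFun_val {m : ℕ} (p x : Fin (m+3)) : (revFun p x).val =
    if 1 ≤ x.val ∧ x.val ≤ p.val then p.val + 1 - x.val else x.val := by
  unfold revFun; split_ifs <;> rfl

theorem revFun_invol {m : ℕ} (p : Fin (m+3)) : Function.Involutive (revFun p) := by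
  intro x
  apply Fin.ext
  rw [revFun_val, revFun_val]
  split_ifs <;> omega

/-- reversal as a permutation -/
def revP {m : ℕ} (p : Fin (m+3)) : Equiv.Perm (Fin (m+3)) := (revFun_invol p).toPerm

theorem revP_val {m : ℕ} (p x : Fin (m+3)) : (revP p x).val =
    if 1 ≤ x.val ∧ x.val ≤ p.val then p.val + 1 - x.val else x.val := revFun_val p x

theorem revP_revP {m : ℕ} (p x : Fin (m+3)) : revP p (revP p x) = x := revFun_invol p x

theorem revP_zero {m : ℕ} (p : Fin (m+3)) : revP p 0 = 0 := by
  apply Fin.ext; rw [revP_val]; simp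

theorem ne_zero_val {m : ℕ} {p : Fin (m+3)} (hp : p ≠ 0) : 1 ≤ p.val := by
  rcases Nat.eq_zero_or_pos p.val with h | h
  · exact absurd (Fin.ext (by simpa using h)) hp
  · exact h

theorem revP_one {m : ℕ} (p : Fin (m+3)) (hp : p ≠ 0) : revP p 1 = p := by
  have := ne_zero_val hp
  apply Fin.ext; rw [revP_val]; simp [this]

theorem revP_self {m : ℕ} (p : Fin (m+3)) (hp : p ≠ 0) : revP p p = 1 := by
  have h := revP_revP p 1
  rwa [revP_one p hp] at h

theorem revP_edge {m : ℕ} (p : Fin (m+3)) (hp : p ≠ 0) (x : Fin (m+3)) :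
    (x = 0 ∧ revP p x = 0 ∧ revP p (x+1) = p) ∨ (x = p ∧ revP p x = 1 ∧ revP p (x+1) = p + 1) ∨
    ∃ y, y ≠ 0 ∧ y ≠ p ∧ ((revP p x = y ∧ revP p (x+1) = y+1) ∨
      (revP p x = y+1 ∧ revP p (x+1) = y)) := by
  have hp1 := ne_zero_val hp
  by_cases h0 : x = 0
  · left; subst h0; simp [revP_zero, revP_one p hp]
  by_cases h1 : x = p
  · right; left; subst h1
    refine ⟨rfl, revP_self _ hp, ?_⟩
    apply Fin.ext; rw [revP_val, fin_val_add_one]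
    split_ifs <;> omega
  right; right
  have hx1 := ne_zero_val h0
  have hxp : x.val ≠ p.val := fun h => h1 (Fin.ext h)
  by_cases hlt : x.val < p.val
  · refine ⟨revP p (x+1), ?_, ?_, Or.inr ⟨?_, rfl⟩⟩
    · intro h
      have := congrArg Fin.val h
      rw [revP_val, fin_val_add_one] at this
      simp only [Fin.val_zero] at this
      split_ifs at this <;> omega
    · intro h
      have := congrArg Fin.val h
      rw [revP_val, fin_val_add_one] at this
      split_ifs at this <;> omega
    · apply Fin.ext
      rw [fin_val_add_one, revP_val, revP_val, fin_val_add_one]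
      split_ifs <;> omega
  · refine ⟨x, h0, h1, Or.inl ⟨?_, ?_⟩⟩
    · apply Fin.ext; rw [revP_val]; split_ifs <;> omega
    · apply Fin.ext; rw [revP_val, fin_val_add_one]; split_ifs <;> omega

/-- reversal applied to a sequence -/
def flp {m : ℕ} (f : Equiv.Perm (Fin (m+3))) (p : Fin (m+3)) : Equiv.Perm (Fin (m+3)) :=
  (revP p).trans f

theorem flp_apply {m : ℕ} (f : Equiv.Perm (Fin (m+3))) (p x : Fin (m+3)) :
    flp f p x = f (revP p x) := rfl

theorem flp_flp {m : ℕ} (f : Equiv.Perm (Fin (m+3))) (p : Fin (m+3)) : flp (flp f p) p = f := by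
  ext1 x; simp [flp_apply, revP_revP]

theorem flp_edge {m : ℕ} (f : Equiv.Perm (Fin (m+3))) (p : Fin (m+3)) (hp : p ≠ 0)
    (x : Fin (m+3)) :
    (s(flp f p x, flp f p (x+1)) = s(f 0, f p)) ∨ (s(flp f p x, flp f p (x+1)) = s(f 1, f (p+1))) ∨
    ∃ y, y ≠ 0 ∧ y ≠ p ∧ s(flp f p x, flp f p (x+1)) = s(f y, f (y+1)) := by
  simp only [flp_apply]
  rcases revP_edge p hp x with ⟨_, h1, h2⟩ | ⟨_, h1, h2⟩ | ⟨y, hy, hy', ⟨h1, h2⟩ | ⟨h1, h2⟩⟩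
  · left; rw [h1, h2]
  · right; left; rw [h1, h2]
  · right; right; exact ⟨y, hy, hy', by rw [h1, h2]⟩
  · right; right; exact ⟨y, hy, hy', by rw [h1, h2, Sym2.eq_swap]⟩

theorem flp_mem {m : ℕ} {G : Finset (Sym2 (Fin (m+3)))} {f : Equiv.Perm (Fin (m+3))}
    (hf : f ∈ avoidS G) {p : Fin (m+3)} (hp : p ≠ 0) (h1 : s(f 0, f p) ∉ G)
    (h2 : s(f 1, f (p+1)) ∉ G) : flp f p ∈ avoidS G := by
  rw [mem_avoidS] at hf ⊢
  intro x
  rcases flp_edge f p hp x with h | h | ⟨y, _, _, h⟩ <;> rw [h]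
  · exact h1
  · exact h2
  · exact hf y

theorem flp_edge_pres {m : ℕ} (f : Equiv.Perm (Fin (m+3))) (p : Fin (m+3)) (hp : p ≠ 0)
    (j : Fin (m+3)) (hj0 : j ≠ 0) (hjp : j ≠ p) :
    ∃ q, s(flp f p q, flp f p (q+1)) = s(f j, f (j+1)) := by
  have h := revP_edge p hp j
  rcases h with ⟨h, _⟩ | ⟨h, _⟩ | ⟨y, _, _, ⟨h1, h2⟩ | ⟨h1, h2⟩⟩
  · exact absurd h hj0
  · exact absurd h hjp
  · refine ⟨y, ?_⟩
    rw [flp_apply, flp_apply, ← h2, ← h1, revP_revP, revP_revP]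
  · refine ⟨y, ?_⟩
    rw [flp_apply, flp_apply, ← h1, ← h2, revP_revP, revP_revP, Sym2.eq_swap]

/-- degree bound -/
def DegLe {m : ℕ} (G : Finset (Sym2 (Fin (m+3)))) (D : ℕ) : Prop :=
  ∀ u, (Finset.univ.filter (fun w => s(u,w) ∈ G)).card ≤ D

/-- sequences starting at `u` -/
def TT {m : ℕ} (G : Finset (Sym2 (Fin (m+3)))) (u : Fin (m+3)) : Finset (Equiv.Perm (Fin (m+3))) :=
  (avoidS G).filter (fun f => f 0 = u)

/-- sequences starting at `u, v` -/
def AA {m : ℕ} (G : Finset (Sym2 (Fin (m+3)))) (u v : Fin (m+3)) :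
    Finset (Equiv.Perm (Fin (m+3))) :=
  (avoidS G).filter (fun f => f 0 = u ∧ f 1 = v)

/-- admissible flip positions -/
def okP {m : ℕ} (G : Finset (Sym2 (Fin (m+3)))) (f : Equiv.Perm (Fin (m+3))) :
    Finset (Fin (m+3)) :=
  Finset.univ.filter (fun p => p ≠ 0 ∧ s(f 0, f p) ∉ G ∧ s(f 1, f (p+1)) ∉ G)

theorem card_pull {m : ℕ} {G : Finset (Sym2 (Fin (m+3)))} {D : ℕ} (hD : DegLe G D)
    (u : Fin (m+3)) (f : Equiv.Perm (Fin (m+3))) :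
    (Finset.univ.filter (fun p => s(u, f p) ∈ G)).card ≤ D := by
  refine le_trans ?_ (hD u)
  apply Finset.card_le_card_of_injOn f
  · intro p hp; simpa using hp
  · exact f.injective.injOn

theorem card_okP {m : ℕ} {G : Finset (Sym2 (Fin (m+3)))} {D : ℕ} (hD : DegLe G D)
    (f : Equiv.Perm (Fin (m+3))) : m + 3 ≤ (okP G f).card + (2 * D + 1) := by
  have h1 := card_pull hD (f 0) f
  have h2 := card_pull hD (f 1) ((Equiv.addRight 1).trans f)
  have hsub : (Finset.univ : Finset (Fin (m+3))) ⊆ okP G f ∪ ({0} ∪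
      (Finset.univ.filter (fun p => s(f 0, f p) ∈ G) ∪
       Finset.univ.filter (fun p => s(f 1, ((Equiv.addRight 1).trans f) p) ∈ G))) := by
    intro p _
    simp only [okP, Finset.mem_union, Finset.mem_filter, Finset.mem_univ, true_and,
      Finset.mem_singleton, Equiv.trans_apply, Equiv.coe_addRight]
    by_cases e1 : p = 0
    · right; left; exact e1
    by_cases e2 : s(f 0, f p) ∈ G
    · right; right; left; exact e2
    by_cases e3 : s(f 1, f (p+1)) ∈ G
    · right; right; right; exact Finset.mem_filter.2 ⟨Finset.mem_univ _, e3⟩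
    · left; exact ⟨e1, e2, e3⟩
  have h3 := Finset.card_le_card hsub
  rw [Finset.card_univ, Fintype.card_fin] at h3
  have h4 := Finset.card_union_le (okP G f) ({0} ∪
      (Finset.univ.filter (fun p => s(f 0, f p) ∈ G) ∪
       Finset.univ.filter (fun p => s(f 1, ((Equiv.addRight 1).trans f) p) ∈ G)))
  have h5 := Finset.card_union_le ({0} : Finset (Fin (m+3)))
      (Finset.univ.filter (fun p => s(f 0, f p) ∈ G) ∪
       Finset.univ.filter (fun p => s(f 1, ((Equiv.addRight 1).trans f) p) ∈ G))
  have h6 := Finset.card_union_le 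
      (Finset.univ.filter (fun p => s(f 0, f p) ∈ G))
       (Finset.univ.filter (fun p => s(f 1, ((Equiv.addRight 1).trans f) p) ∈ G))
  simp only [Finset.card_singleton] at h5
  omega

theorem upper_A {m : ℕ} {G : Finset (Sym2 (Fin (m+3)))} {D : ℕ} (hD : DegLe G D)
    (u v : Fin (m+3)) :
    (AA G u v).card * (m + 3) ≤ (TT G u).card + (AA G u v).card * (2 * D + 1) := by
  have h1 : ((AA G u v).sigma (fun f => okP G f)).card ≤ (TT G u).card := by
    apply Finset.card_le_card_of_injOn (fun q => flp q.1 q.2)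
    · rintro ⟨f, p⟩ h
      simp only [Finset.coe_sigma, Set.mem_sigma_iff, Finset.mem_coe, AA, okP, Finset.mem_filter,
        Finset.mem_univ, true_and] at h
      simp only [TT, Finset.coe_filter, Set.mem_ofPred_eq]
      refine ⟨flp_mem h.1.1 h.2.1 h.2.2.1 h.2.2.2, ?_⟩
      rw [flp_apply, revP_zero]; exact h.1.2.1
    · rintro ⟨f, p⟩ h ⟨g, q⟩ h' hfg
      simp only [Finset.coe_sigma, Set.mem_sigma_iff, Finset.mem_coe, AA, okP, Finset.mem_filter,
        Finset.mem_univ, true_and] at h h' hfg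
      have e1 : flp f p p = v := by rw [flp_apply, revP_self _ h.2.1]; exact h.1.2.2
      have e2 : flp g q q = v := by rw [flp_apply, revP_self _ h'.2.1]; exact h'.1.2.2
      have : p = q := by
        apply (flp f p).injective
        rw [e1, hfg, e2]
      subst this
      have : f = g := by rw [← flp_flp f p, hfg, flp_flp]
      subst this
      rfl
  rw [Finset.card_sigma] at h1
  have h2 : (AA G u v).card * (m+3) ≤ ∑ f ∈ AA G u v, ((okP G f).card + (2 * D + 1)) := by
    rw [← smul_eq_mul]
    exact Finset.card_nsmul_le_sum _ _ _ (fun f _ => card_okP hD f)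
  rw [Finset.sum_add_distrib, Finset.sum_const, smul_eq_mul] at h2
  omega

/-- bad sequences -/
def BB {m : ℕ} (G : Finset (Sym2 (Fin (m+3)))) (u v : Fin (m+3)) :
    Finset (Equiv.Perm (Fin (m+3))) :=
  (TT G u).filter (fun g => s(g 1, g (g.symm v + 1)) ∈ G)

theorem lower_A {m : ℕ} {G : Finset (Sym2 (Fin (m+3)))} 
    (u v : Fin (m+3)) (huv : u ≠ v) (hG : s(u,v) ∉ G) :
    (TT G u).card ≤ (AA G u v).card * (m + 2) + (BB G u v).card := by
  have h1 : ((TT G u).filter (fun g => ¬ s(g 1, g (g.symm v + 1)) ∈ G)).card ≤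
      ((AA G u v) ×ˢ (Finset.univ.erase (0 : Fin (m+3)))).card := by
    apply Finset.card_le_card_of_injOn (fun g => (flp g (g.symm v), g.symm v))
    · intro g h
      simp only [TT, Finset.coe_filter, Finset.mem_filter, Set.mem_ofPred_eq] at h
      have hne : g.symm v ≠ 0 := by
        intro h0
        apply huv
        rw [← h.1.2, ← h0]; simp
      simp only [Finset.coe_product, Set.mem_prod, Finset.mem_coe, AA, Finset.mem_filter,
        Finset.mem_erase, Finset.mem_univ, and_true]
      refine ⟨⟨flp_mem h.1.1 hne ?_ h.2, ?_, ?_⟩, hne⟩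
      · rw [h.1.2]; simpa using hG
      · rw [flp_apply, revP_zero]; exact h.1.2
      · rw [flp_apply, revP_one _ hne]; simp
    · intro f _ g _ h
      simp only [Prod.mk.injEq] at h
      rw [← flp_flp f (f.symm v), h.1, h.2, flp_flp]
  rw [Finset.card_product, Finset.card_erase_of_mem (Finset.mem_univ _), Finset.card_univ,
    Fintype.card_fin] at h1
  have h2 := Finset.card_filter_add_card_filter_not (s := TT G u)
    (fun g => s(g 1, g (g.symm v + 1)) ∈ G)
  simp only [BB]
  have : m + 3 - 1 = m + 2 := rfl
  rw [this] at h1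
  omega

theorem bad_B {m : ℕ} {G : Finset (Sym2 (Fin (m+3)))} {D : ℕ} (hD : DegLe G D)
    (u v : Fin (m+3)) (huv : u ≠ v) :
    (BB G u v).card * (m + 3) ≤ (TT G u).card * (2 * D) + (BB G u v).card * (2 * D + 2) := by
  let Q : Equiv.Perm (Fin (m+3)) → Finset (Fin (m+3)) := fun g =>
    Finset.univ.filter (fun x => s(g (g.symm v + 1), x) ∈ G) ∪
    Finset.univ.filter (fun x => s(g (g.symm v - 1), x) ∈ G)
  have hQ : ∀ g, (Q g).card ≤ 2 * D := by
    intro g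
    have h1 := hD (g (g.symm v + 1))
    have h2 := hD (g (g.symm v - 1))
    refine le_trans (Finset.card_union_le _ _) ?_
    omega
  have h1 : ((BB G u v).sigma (fun g => (okP G g).erase (g.symm v))).card ≤
      ((TT G u).sigma Q).card := by
    apply Finset.card_le_card_of_injOn (fun q => ⟨flp q.1 q.2, q.1 1⟩)
    · rintro ⟨g, p⟩ h
      simp only [Finset.coe_sigma, Set.mem_sigma_iff, Finset.mem_coe, BB, TT, okP,
        Finset.mem_filter, Finset.mem_erase, Finset.mem_univ, true_and] at h
      obtain ⟨⟨⟨hS, h0⟩, hbad⟩, hpv, hp0, ha, hb⟩ := h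
      simp only [Finset.coe_sigma, Set.mem_sigma_iff, Finset.mem_coe, TT, Finset.mem_filter]
      refine ⟨⟨flp_mem hS hp0 ha hb, ?_⟩, ?_⟩
      · rw [flp_apply, revP_zero]; exact h0
      · have hj : g.symm v ≠ 0 := by
          intro h'
          apply huv
          rw [← h0, ← h']; simp
        obtain ⟨q, hq⟩ := flp_edge_pres g p hp0 (g.symm v) hj (Ne.symm hpv)
        simp only [Q, Finset.mem_union, Finset.mem_filter, Finset.mem_univ, true_and]
        simp only [Equiv.apply_symm_apply, Sym2.eq_iff] at hq
        rw [Sym2.eq_swap] at hbad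
        rcases hq with ⟨e1, e2⟩ | ⟨e1, e2⟩
        · left
          have : (flp g p).symm v = q := by rw [← e1]; simp
          rw [this, e2]; exact hbad
        · right
          have : (flp g p).symm v = q + 1 := by rw [← e2]; simp
          rw [this, add_sub_cancel_right, e1]; exact hbad
    · rintro ⟨f, p⟩ h ⟨g, q⟩ h' hfg
      simp only [Finset.coe_sigma, Set.mem_sigma_iff, Finset.mem_coe, okP, Finset.mem_filter,
        Finset.mem_erase, Finset.mem_univ, true_and] at h h'
      simp only [Sigma.mk.injEq, heq_eq_eq] at hfg
      obtain ⟨hfg, hx⟩ := hfg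
      have e1 : flp f p p = f 1 := by rw [flp_apply, revP_self _ h.2.2.1]
      have e2 : flp g q q = g 1 := by rw [flp_apply, revP_self _ h'.2.2.1]
      have : p = q := by
        apply (flp f p).injective
        rw [e1, hfg, e2, hx]
      subst this
      have : f = g := by rw [← flp_flp f p, hfg, flp_flp]
      subst this
      rfl
  rw [Finset.card_sigma, Finset.card_sigma] at h1
  have h2 : (BB G u v).card * (m+3) ≤
      ∑ f ∈ BB G u v, (((okP G f).erase (f.symm v)).card + (2 * D + 2)) := by
    rw [← smul_eq_mul]
    apply Finset.card_nsmul_le_sum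
    intro f _
    have := card_okP hD f
    have := Finset.pred_card_le_card_erase (s := okP G f) (a := f.symm v)
    omega
  rw [Finset.sum_add_distrib, Finset.sum_const, smul_eq_mul] at h2
  have h3 : ∑ g ∈ TT G u, (Q g).card ≤ (TT G u).card * (2 * D) := by
    rw [← smul_eq_mul]
    exact Finset.sum_le_card_nsmul _ _ _ (fun g _ => hQ g)
  omega

theorem rot_mem {m : ℕ} (G : Finset (Sym2 (Fin (m+3)))) (f : Equiv.Perm (Fin (m+3)))
    (j : Fin (m+3)) : (Equiv.addRight j).trans f ∈ avoidS G ↔ f ∈ avoidS G := by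
  rw [mem_avoidS, mem_avoidS]
  simp only [Equiv.trans_apply, Equiv.coe_addRight]
  constructor
  · intro h x
    have := h (x - j)
    rwa [sub_add_cancel, show x - j + 1 + j = x + 1 by ring] at this
  · intro h x
    have := h (x + j)
    rwa [show x + j + 1 = x + 1 + j by ring] at this

theorem rot_card {m : ℕ} (G : Finset (Sym2 (Fin (m+3)))) (P : Fin (m+3) → Fin (m+3) → Prop)
    [∀ a b, Decidable (P a b)] (j : Fin (m+3)) :
    ((avoidS G).filter (fun f => P (f j) (f (j+1)))).card =
    ((avoidS G).filter (fun f => P (f 0) (f 1))).card := by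
  apply Finset.card_bij' (fun f _ => (Equiv.addRight j).trans f)
    (fun f _ => (Equiv.addRight (-j)).trans f)
  · intro f hf
    simp only [Finset.mem_filter] at hf ⊢
    refine ⟨(rot_mem G f j).2 hf.1, ?_⟩
    simpa [add_comm] using hf.2
  · intro f hf
    simp only [Finset.mem_filter] at hf ⊢
    refine ⟨(rot_mem G f (-j)).2 hf.1, ?_⟩
    have : j + 1 + -j = 1 := by ring
    simpa [this] using hf.2
  · intro f hf; ext1 x; simp
  · intro f hf; ext1 x; simp

theorem card_TT {m : ℕ} (G : Finset (Sym2 (Fin (m+3)))) (u : Fin (m+3)) :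
    (avoidS G).card = (m+3) * (TT G u).card := by
  have h : (avoidS G).card = ∑ j, ((avoidS G).filter (fun f => f j = u)).card := by
    rw [Finset.card_eq_sum_card_fiberwise (f := fun f => f.symm u) (t := Finset.univ)
      (fun _ _ => Finset.mem_coe.2 (Finset.mem_univ _))]
    apply Finset.sum_congr rfl
    intro j _
    congr 1
    ext f
    simp only [Finset.mem_filter]
    rw [Equiv.symm_apply_eq, eq_comm]
  rw [h, Finset.sum_congr rfl (fun j _ => rot_card G (fun a _ => a = u) j)]
  simp [TT]

theorem card_AA {m : ℕ} (G : Finset (Sym2 (Fin (m+3)))) (u v : Fin (m+3)) (huv : u ≠ v) :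
    (avoidS G).card = (avoidS (insert s(u,v) G)).card +
      (m+3) * ((AA G u v).card + (AA G v u).card) := by
  have h := Finset.card_filter_add_card_filter_not (s := avoidS G)
    (fun f => ∃ j, s(f j, f (j+1)) = s(u,v))
  have h1 : (avoidS G).filter (fun f => ¬ ∃ j, s(f j, f (j+1)) = s(u,v)) =
      avoidS (insert s(u,v) G) := by
    ext f
    simp only [Finset.mem_filter, mem_avoidS, Finset.mem_insert]
    constructor
    · rintro ⟨h1, h2⟩ j (h3 | h3)
      · exact h2 ⟨j, h3⟩
      · exact h1 j h3
    · intro h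
      exact ⟨fun j hj => h j (Or.inr hj), fun ⟨j, hj⟩ => h j (Or.inl hj)⟩
  have h2 : (avoidS G).filter (fun f => ∃ j, s(f j, f (j+1)) = s(u,v)) =
      Finset.univ.biUnion (fun j => (avoidS G).filter (fun f => s(f j, f (j+1)) = s(u,v))) := by
    ext f; simp
  have h3 : ((avoidS G).filter (fun f => ∃ j, s(f j, f (j+1)) = s(u,v))).card =
      (m+3) * ((AA G u v).card + (AA G v u).card) := by
    rw [h2, Finset.card_biUnion]
    · rw [Finset.sum_congr rfl (fun j _ => rot_card G (fun a b => s(a,b) = s(u,v)) j)]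
      simp only [Finset.sum_const, Finset.card_univ, Fintype.card_fin, smul_eq_mul]
      congr 1
      rw [← Finset.card_union_of_disjoint]
      · congr 1
        ext f
        simp only [AA, Finset.mem_filter, Finset.mem_union, Sym2.eq_iff]
        tauto
      · rw [Finset.disjoint_left]
        intro f hf hf'
        simp only [AA, Finset.mem_filter] at hf hf'
        exact huv (hf.2.1.symm.trans hf'.2.1)
    · intro a _ b _ hab
      rw [Function.onFun, Finset.disjoint_left]
      intro f hf hf'
      simp only [Finset.mem_filter] at hf hf'
      exact hab (cycE_inj f (hf.2.trans hf'.2.symm))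
  rw [h1, h3] at h
  omega


end hamAux

theorem real_A_upper (n D a t : ℝ) (hD : 1 ≤ D) (hn : 100 * D ≤ n) (ha : 0 ≤ a) 
    (h : a * n ≤ t + a * (2 * D + 1)) : n * a ≤ t * (1 + 6 * D / n) := by
  have hn0 : 0 < n := by linarith
  have h1 : a * (n - 3 * D) ≤ t := by nlinarith
  have h2 : n * a ≤ a * (n - 3 * D) * (1 + 6 * D / n) := by
    have : a * (n - 3 * D) * (1 + 6 * D / n) - n * a = a * (D * (3 * n - 18 * D) / n) := by
      field_simp; ring
    have h3 : 0 ≤ a * (D * (3 * n - 18 * D) / n) := by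
      apply mul_nonneg ha
      apply div_nonneg _ hn0.le
      apply mul_nonneg <;> linarith
    linarith
  refine h2.trans ?_
  apply mul_le_mul_of_nonneg_right h1
  positivity

theorem real_A_lower (n D a b t : ℝ) (hD : 1 ≤ D) (hn : 100 * D ≤ n) (ha : 0 ≤ a) (hb : 0 ≤ b)
    (ht : 0 ≤ t)
    (h : t ≤ a * (n - 1) + b) (h' : b * n ≤ t * (2 * D) + b * (2 * D + 2)) :
    t * (1 - 6 * D / n) ≤ n * a := by
  have hn0 : 0 < n := by linarith
  have h1 : b * (n - 4 * D) ≤ 2 * D * t := by nlinarith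
  have h2 : b * (n / 2) ≤ 2 * D * t := by
    refine le_trans ?_ h1
    apply mul_le_mul_of_nonneg_left _ hb
    linarith
  have h3 : b ≤ t * (6 * D / n) := by
    rw [← mul_div_assoc, le_div_iff₀ hn0]
    nlinarith [mul_nonneg ht (by linarith : 0 ≤ D)]
  nlinarith

theorem one_sub_ge_exp (y : ℝ) (h1 : y ≤ 1 / 2) :
    Real.exp (-(y + 2 * y ^ 2)) ≤ 1 - y := by
  rw [Real.exp_neg]
  have h2 := Real.add_one_le_exp (y + 2 * y ^ 2)
  have h3 : 0 < Real.exp (y + 2 * y ^ 2) := Real.exp_pos _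
  rw [inv_le_iff_one_le_mul₀ h3]
  have h4 : (1 - y) * (y + 2 * y ^ 2 + 1) ≤ (1 - y) * Real.exp (y + 2 * y ^ 2) :=
    mul_le_mul_of_nonneg_left h2 (by linarith)
  nlinarith [mul_nonneg (sq_nonneg y) (by linarith : 0 ≤ 1 - 2 * y)]

theorem step_bounds {m : ℕ} {G : Finset (Sym2 (Fin (m+3)))} {D : ℕ} (hD : DegLe G D)
    (hD1 : 1 ≤ D) (hn : 100 * D ≤ m + 3) (u v : Fin (m+3)) (huv : u ≠ v) (hG : s(u,v) ∉ G) :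
    ((avoidS (insert s(u,v) G)).card : ℝ) ≤
      Real.exp (-(2 / ((m+3 : ℕ) : ℝ)) + 30 * D / ((m+3 : ℕ) : ℝ)^2) * (avoidS G).card ∧
    Real.exp (-(2 / ((m+3 : ℕ) : ℝ)) - 30 * D / ((m+3 : ℕ) : ℝ)^2) * (avoidS G).card ≤
      ((avoidS (insert s(u,v) G)).card : ℝ) := by
  have hS := card_AA G u v huv
  have hTu := card_TT G u
  have hTv := card_TT G v
  have hGvu : s(v,u) ∉ G := by rwa [Sym2.eq_swap]
  have hT : (TT G v).card = (TT G u).card := by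
    apply Nat.eq_of_mul_eq_mul_left (by omega : 0 < m + 3)
    rw [← hTu, ← hTv]
  have u1 := upper_A hD u v
  have u2 := upper_A hD v u
  have l1 := lower_A u v huv hG
  have l2 := lower_A v u huv.symm hGvu
  have b1 := bad_B hD u v huv
  have b2 := bad_B hD v u huv.symm
  rw [hT] at u2 l2 b2
  generalize (AA G u v).card = a1 at *
  generalize (AA G v u).card = a2 at *
  generalize (BB G u v).card = c1 at *
  generalize (BB G v u).card = c2 at *
  generalize (avoidS (insert s(u,v) G)).card = s' at *
  rw [hTu] at hS ⊢
  generalize (TT G u).card = t at *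
  have hm : ((m+3 : ℕ) : ℝ) - 1 = ((m + 2 : ℕ) : ℝ) := by push_cast; ring
  clear hD hG hGvu hTv hTu hT huv
  clear u v G
  generalize hN : m + 3 = N at *
  have hS' : (N : ℝ) * t = s' + N * (a1 + a2) := by exact_mod_cast hS
  have hD1' : (1 : ℝ) ≤ D := by exact_mod_cast hD1
  have hn' : 100 * (D : ℝ) ≤ N := by exact_mod_cast hn
  have hN0 : (0 : ℝ) < N := by linarith
  have U1 := real_A_upper N D a1 t hD1' hn' (by positivity) (by exact_mod_cast u1)
  have U2 := real_A_upper N D a2 t hD1' hn' (by positivity) (by exact_mod_cast u2)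
  have L1 := real_A_lower N D a1 c1 t hD1' hn' (by positivity) (by positivity) (by positivity)
    (by rw [hm]; exact_mod_cast l1) (by exact_mod_cast b1)
  have L2 := real_A_lower N D a2 c2 t hD1' hn' (by positivity) (by positivity) (by positivity)
    (by rw [hm]; exact_mod_cast l2) (by exact_mod_cast b2)
  have ht : (0 : ℝ) ≤ t := by positivity
  have hNt : (0 : ℝ) ≤ N * t := by positivity
  have id1 : (1 - 2 / (N : ℝ) + 12 * D / (N : ℝ)^2) * (N * t) = N * t - 2 * (t * (1 - 6 * D / N)) := by
    field_simp; ring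
  have id2 : (1 - (2 / (N : ℝ) + 12 * D / (N : ℝ)^2)) * (N * t) =
      N * t - 2 * (t * (1 + 6 * D / N)) := by
    field_simp; ring
  push_cast
  constructor
  · have e1 : (s' : ℝ) ≤ (1 - 2 / (N : ℝ) + 12 * D / (N : ℝ)^2) * (N * t) := by
      rw [id1]; linarith
    refine e1.trans (mul_le_mul_of_nonneg_right ?_ hNt)
    have := Real.add_one_le_exp (-(2 / (N : ℝ)) + 30 * D / (N : ℝ)^2)
    have h30 : 12 * D / (N : ℝ)^2 ≤ 30 * D / (N : ℝ)^2 := by gcongr; norm_num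
    linarith
  · have e1 : (1 - (2 / (N : ℝ) + 12 * D / (N : ℝ)^2)) * (N * t) ≤ s' := by
      rw [id2]; linarith
    refine le_trans (mul_le_mul_of_nonneg_right ?_ hNt) e1
    have hy : 2 / (N : ℝ) + 12 * D / (N : ℝ)^2 ≤ 3 / N := by
      rw [div_add_div _ _ hN0.ne' (by positivity), div_le_div_iff₀ (by positivity) hN0]
      nlinarith [pow_pos hN0 2, pow_pos hN0 3]
    have hN100 : (100 : ℝ) ≤ N := by linarith
    have hy2 : 3 / (N : ℝ) ≤ 1 / 2 := by
      rw [div_le_div_iff₀ hN0 (by norm_num)]; linarith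
    have hy0 : 0 ≤ 2 / (N : ℝ) + 12 * D / (N : ℝ)^2 := by positivity
    have key := one_sub_ge_exp _ (hy.trans hy2)
    refine le_trans (Real.exp_le_exp.2 ?_) key
    have hsq : (2 / (N : ℝ) + 12 * D / (N : ℝ)^2)^2 ≤ (3 / N)^2 := pow_le_pow_left₀ hy0 hy 2
    have h9 : 2 * (3 / (N : ℝ))^2 ≤ 18 * D / (N : ℝ)^2 := by
      rw [div_pow, ← mul_div_assoc]
      apply div_le_div_of_nonneg_right _ (by positivity)
      linarith
    have : 30 * D / (N : ℝ)^2 = 12 * D / (N : ℝ)^2 + 18 * D / (N : ℝ)^2 := by ring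
    rw [this]
    linarith

theorem DegLe.mono {m : ℕ} {G G' : Finset (Sym2 (Fin (m+3)))} {D : ℕ} (h : DegLe G' D)
    (hs : G ⊆ G') : DegLe G D := by
  intro u
  refine le_trans (Finset.card_le_card ?_) (h u)
  intro w hw
  simp only [Finset.mem_filter, Finset.mem_univ, true_and] at hw ⊢
  exact hs hw

theorem all_bounds {m : ℕ} {D : ℕ} (hD1 : 1 ≤ D) (hn : 100 * D ≤ m + 3)
    (G : Finset (Sym2 (Fin (m+3)))) (hD : DegLe G D) (hd : ∀ u, s(u,u) ∉ G) :
    ((avoidS G).card : ℝ) ≤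
      Real.exp (G.card * (-(2 / ((m+3 : ℕ) : ℝ)) + 30 * D / ((m+3 : ℕ) : ℝ)^2)) * (m+3).factorial ∧
    Real.exp (G.card * (-(2 / ((m+3 : ℕ) : ℝ)) - 30 * D / ((m+3 : ℕ) : ℝ)^2)) * (m+3).factorial ≤
      ((avoidS G).card : ℝ) := by
  induction G using Finset.induction_on with
  | empty =>
    have : (avoidS (∅ : Finset (Sym2 (Fin (m+3))))).card = (m+3).factorial := by
      simp [avoidS, Finset.card_univ, Fintype.card_perm]
    rw [this]; simp
  | insert e G he ih =>
    obtain ⟨ih1, ih2⟩ := ih (hD.mono (Finset.subset_insert _ _))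
      (fun u hu => hd u (Finset.mem_insert_of_mem hu))
    induction e with | _ u v
    have huv : u ≠ v := by
      rintro rfl
      exact hd u (Finset.mem_insert_self _ _)
    obtain ⟨s1, s2⟩ := step_bounds (hD.mono (Finset.subset_insert _ _)) hD1 hn u v huv he
    rw [Finset.card_insert_of_notMem he]
    clear ih
    generalize (-(2 / ((m+3 : ℕ) : ℝ)) + 30 * D / ((m+3 : ℕ) : ℝ)^2) = X at *
    generalize (-(2 / ((m+3 : ℕ) : ℝ)) - 30 * D / ((m+3 : ℕ) : ℝ)^2) = Y at *
    rw [Nat.cast_add, Nat.cast_one, add_mul, one_mul, add_mul, one_mul, Real.exp_add, Real.exp_add]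
    constructor
    · refine s1.trans ?_
      calc _ ≤ Real.exp X * (Real.exp (G.card * X) * (m+3).factorial) := mul_le_mul_of_nonneg_left ih1 (Real.exp_pos _).le
        _ = _ := by ring
    · refine le_trans ?_ s2
      calc _ = Real.exp Y * (Real.exp (G.card * Y) * (m+3).factorial) := by ring
        _ ≤ _ := mul_le_mul_of_nonneg_left ih2 (Real.exp_pos _).le

theorem error_bound (n k : ℝ) (hn : 1000000 ≤ n) (hk : 1 ≤ k) (hkn : k ≤ n ^ ((1:ℝ)/100)) :
    200 * k ≤ n ∧ 60 * k ^ 2 / n ≤ (6000000000 : ℝ) / (k ^ 2 * Real.log n ^ 4) := by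
  have hn0 : 0 < n := by linarith
  have hn1 : 1 ≤ n := by linarith
  have hlog : 0 < Real.log n := Real.log_pos (by linarith)
  have hl : Real.log n ≤ 100 * n ^ ((1:ℝ)/100) := by
    have := Real.log_le_rpow_div hn0.le (by norm_num : (0:ℝ) < 1/100)
    linarith
  set r := n ^ ((1:ℝ)/100) with hr
  have hr0 : 0 < r := by positivity
  have hr1 : 1 ≤ r := hk.trans hkn
  have hrn : r ^ 100 = n := by
    rw [hr, ← Real.rpow_natCast, ← Real.rpow_mul hn0.le]; norm_num
  constructor
  · have h2 : r ^ 2 ≤ n := by rw [← hrn]; exact pow_le_pow_right₀ hr1 (by norm_num)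
    have h50 : 1000 ≤ r ^ 50 := by
      by_contra h
      push Not at h
      have : r ^ 100 = r ^ 50 * r ^ 50 := by ring
      nlinarith [pow_pos hr0 50]
    have h1 : r ≤ r ^ 50 := le_self_pow₀ hr1 (by norm_num)
    have : r ^ 100 = r ^ 50 * r ^ 50 := by ring
    nlinarith
  · rw [div_le_div_iff₀ hn0 (by positivity)]
    have h1 : k ^ 4 ≤ r ^ 4 := pow_le_pow_left₀ (by linarith) hkn 4
    have h2 : Real.log n ^ 4 ≤ (100 * r) ^ 4 := pow_le_pow_left₀ hlog.le hl 4
    have h3 : k ^ 4 * Real.log n ^ 4 ≤ r ^ 4 * (100 * r) ^ 4 :=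
      mul_le_mul h1 h2 (by positivity) (by positivity)
    have h4 : r ^ 8 ≤ n := by rw [← hrn]; exact pow_le_pow_right₀ hr1 (by norm_num)
    have h5 : r ^ 4 * (100 * r) ^ 4 = 100000000 * r ^ 8 := by ring
    have h6 : 60 * k ^ 2 * (k ^ 2 * Real.log n ^ 4) = 60 * (k ^ 4 * Real.log n ^ 4) := by ring
    rw [h6]
    linarith

/-- There are `C > 0` and `N` such that for all `n ≥ N`, all `1 ≤ k ≤ n^{1/100}`, all
`0 ≤ i ≤ k−1` and all pairwise edge-disjoint Hamilton cycles `H_1, …, H_i` of `K_n`, the number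
`h` of Hamilton cycles of `K_n` edge-disjoint from all of `H_1, …, H_i` satisfies
`exp(−C/(k²(log n)⁴))·e^{−2i}·(n−1)!/2 ≤ h ≤ exp(C/(k²(log n)⁴))·e^{−2i}·(n−1)!/2`. -/
theorem count_hamilton_cycles_avoiding_edge_disjoint_hamilton_cycles :
    ∃ C : ℝ, 0 < C ∧ ∃ N : ℕ, ∀ n : ℕ, N ≤ n → ∀ k : ℕ, 1 ≤ k →
      (k : ℝ) ≤ (n : ℝ) ^ ((1 : ℝ) / 100) → ∀ i : ℕ, i ≤ k - 1 →
      ∀ H : Fin i → Finset (Sym2 (Fin n)),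
        (∀ j, IsHamCycle n (H j)) →
        (∀ a b : Fin i, a ≠ b → Disjoint (H a) (H b)) →
        (Set.ncard {E : Finset (Sym2 (Fin n)) |
            IsHamCycle n E ∧ ∀ j, Disjoint E (H j)} : ℝ) ∈
        Set.Icc
          (Real.exp (-(C / ((k : ℝ) ^ 2 * Real.log (n : ℝ) ^ 4))) * Real.exp (-(2 * i : ℝ)) *
            ((n - 1).factorial : ℝ) / 2)
          (Real.exp (C / ((k : ℝ) ^ 2 * Real.log (n : ℝ) ^ 4)) * Real.exp (-(2 * i : ℝ)) *
            ((n - 1).factorial : ℝ) / 2) := by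
  refine ⟨6000000000, by norm_num, 1000000, ?_⟩
  intro n hn k hk hkn i hik H hH hdis
  obtain ⟨m, rfl⟩ : ∃ m, n = m + 3 := ⟨n - 3, by omega⟩
  have hnR : (1000000 : ℝ) ≤ ((m + 3 : ℕ) : ℝ) := by exact_mod_cast hn
  have hkR : (1 : ℝ) ≤ (k : ℝ) := by exact_mod_cast hk
  obtain ⟨e1, e2⟩ := error_bound _ _ hnR hkR hkn
  have hkn' : 200 * k ≤ m + 3 := by exact_mod_cast e1
  set G : Finset (Sym2 (Fin (m+3))) := Finset.univ.biUnion H with hGdef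
  have hset : {E : Finset (Sym2 (Fin (m+3))) | IsHamCycle (m+3) E ∧ ∀ j, Disjoint E (H j)} =
      {E | IsHamCycle (m+3) E ∧ Disjoint E G} := by
    ext E
    simp [hGdef, Finset.disjoint_biUnion_right]
  rw [hset]
  have hcount := count_eq G
  choose F hF using fun j => (isHam_iff (H j)).1 (hH j)
  have hcardG : G.card = i * (m + 3) := by
    rw [hGdef, Finset.card_biUnion (fun a _ b _ hab => hdis a b hab)]
    rw [Finset.sum_congr rfl (fun j _ => by rw [hF j, card_cycE])]
    simp
  have hdegG : DegLe G (2 * k) := by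
    intro u
    have : Finset.univ.filter (fun w => s(u,w) ∈ G) =
        Finset.univ.biUnion (fun j => Finset.univ.filter (fun w => s(u,w) ∈ H j)) := by
      ext w; simp [hGdef]
    rw [this]
    refine le_trans Finset.card_biUnion_le ?_
    refine le_trans (Finset.sum_le_card_nsmul _ _ 2 (fun j _ => ?_)) ?_
    · rw [hF j]; exact deg_cycE _ _
    · simp; omega
  have hdiag : ∀ u, s(u,u) ∉ G := by
    intro u hu
    simp only [hGdef, Finset.mem_biUnion, Finset.mem_univ, true_and] at hu
    obtain ⟨j, hj⟩ := hu
    rw [hF j] at hj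
    exact not_diag_cycE _ _ hj
  obtain ⟨b1, b2⟩ := all_bounds (by omega : 1 ≤ 2 * k) (by omega) G hdegG hdiag
  rw [hcount, hcardG, Nat.factorial_succ] at b1 b2
  generalize Set.ncard {E | IsHamCycle (m+3) E ∧ Disjoint E G} = h at *
  have hfac : m + 3 - 1 = m + 2 := rfl
  rw [hfac]
  have hm2 : m + 2 + 1 = m + 3 := rfl
  rw [hm2] at b1 b2
  have hN0 : (0 : ℝ) < ((m + 3 : ℕ) : ℝ) := by linarith
  simp only [Nat.cast_mul] at b1 b2
  generalize ((m + 3 : ℕ) : ℝ) = N at *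
  clear hn
  have hiR : (i : ℝ) ≤ k := by exact_mod_cast (by omega : i ≤ k)
  have hi0 : (0 : ℝ) ≤ i := by positivity
  have herr : (i * N) * (30 * (2 * k) / N ^ 2) ≤ 60 * (k : ℝ) ^ 2 / N := by
    have : (i * N) * (30 * (2 * (k : ℝ)) / N ^ 2) = 60 * (i * k) / N := by field_simp; ring
    rw [this]
    apply div_le_div_of_nonneg_right _ hN0.le
    rw [sq]
    apply mul_le_mul_of_nonneg_left _ (by norm_num)
    exact mul_le_mul_of_nonneg_right hiR (by positivity)
  have hmain : (i * N) * (2 / N) = 2 * (i : ℝ) := by field_simp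
  set X := (6000000000 : ℝ) / ((k : ℝ) ^ 2 * Real.log N ^ 4) with hX
  have hfpos : (0 : ℝ) ≤ ((m + 2).factorial : ℝ) := by positivity
  rw [← Real.exp_add, ← Real.exp_add]
  simp only [Nat.cast_ofNat] at b1 b2
  constructor
  · have hexp : Real.exp (-X + -(2 * (i:ℝ))) ≤
        Real.exp (i * N * (-(2 / N) - 30 * (2 * (k:ℝ)) / N ^ 2)) := by
      apply Real.exp_le_exp.2
      rw [mul_sub, mul_neg, hmain]
      linarith
    have h1 := (mul_le_mul_of_nonneg_right hexp (by positivity : 0 ≤ N * ((m+2).factorial : ℝ))).trans b2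
    have h2 : N * (Real.exp (-X + -(2 * (i:ℝ))) * ((m+2).factorial : ℝ)) ≤ N * (2 * h) := by
      linarith
    have := le_of_mul_le_mul_left h2 hN0
    linarith
  · have hexp : Real.exp (i * N * (-(2 / N) + 30 * (2 * (k:ℝ)) / N ^ 2)) ≤
        Real.exp (X + -(2 * (i:ℝ))) := by
      apply Real.exp_le_exp.2
      rw [mul_add, mul_neg, hmain]
      linarith
    have h1 := b1.trans (mul_le_mul_of_nonneg_right hexp (by positivity : 0 ≤ N * ((m+2).factorial : ℝ)))
    have h2 : N * (2 * h) ≤ N * (Real.exp (X + -(2 * (i:ℝ))) * ((m+2).factorial : ℝ)) := by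
      linarith
    have := le_of_mul_le_mul_left h2 hN0
    linarith
end

section
/- There exists N ∈ ℕ such that the following holds for all n ≥ N. Let i be a positive integer with i ≤ n^{1/100}, let F be the union of the edge sets of i pairwise edge-disjoint Hamilton cycles in K_n (so F is a 2i-regular graph on {1,…,n}), and let ℓ be a positive integer with 2 ≤ ℓ ≤ √n. Set r = n mod ℓ, t_c = ⌈n/ℓ⌉, t_f = ⌊n/ℓ⌋. Then the number of ordered partitions (V_1, …, V_ℓ) of {1, …, n}, with |V_j| = t_c for 1 ≤ j ≤ r and |V_j| = t_f for r < j ≤ ℓ, such that for every 1 ≤ j ≤ ℓ (indices cyclic, V_{ℓ+1} := V_1) the number of edges of F with one endpoint in V_j and the other in V_{j+1} differs from 2·i·n/ℓ² by at most 2·n^{2/3}, is at least (1 − e^{−n^{3/100}}) · n!/((t_c!)^r · (t_f!)^{ℓ−r}). -/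
open Equiv Finset in
theorem perm_mgf (n : ℕ) : ∀ (f : Perm (Fin n) → ℝ) (c : ℝ), 0 ≤ c → 2 * c ≤ 1 →
    (∀ σ a b, |f (swap a b * σ) - f σ| ≤ c) →
    ∑ σ, Real.exp (f σ - (∑ τ, f τ) / n.factorial) ≤ n.factorial * Real.exp (n * (2 * c) ^ 2) := by
  induction n with
  | zero =>
    intro f c h0 h1 h
    simp
  | succ n ih =>
    intro f c h0 h1 h
    set g : Fin (n + 1) → Perm (Fin n) → ℝ := fun p e => f (Perm.decomposeFin.symm (p, e)) with hg
    have hsum : ∀ φ : Perm (Fin (n + 1)) → ℝ,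
        ∑ σ, φ σ = ∑ p, ∑ e, φ (Perm.decomposeFin.symm (p, e)) := by
      intro φ
      rw [← Fintype.sum_prod_type' (f := fun p e => φ (Perm.decomposeFin.symm (p, e)))]
      exact (Equiv.sum_comp Perm.decomposeFin.symm φ).symm
    have hdec : ∀ (p : Fin (n + 1)) (e : Perm (Fin n)),
        Perm.decomposeFin.symm (p, e) = swap 0 p * Perm.decomposeFin.symm (0, e) := by
      intro p e
      ext x
      refine Fin.cases ?_ (fun y => ?_) x <;> simp
    have hdec2 : ∀ (a b : Fin n) (e : Perm (Fin n)),
        Perm.decomposeFin.symm (0, swap a b * e) =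
          swap a.succ b.succ * Perm.decomposeFin.symm (0, e) := by
      intro a b e
      ext x
      refine Fin.cases ?_ (fun y => ?_) x
      · simp [swap_apply_of_ne_of_ne, (Fin.succ_ne_zero _).symm]
      · simp only [Perm.decomposeFin_symm_apply_succ, Perm.mul_apply, swap_self, refl_apply]
        simp only [swap_apply_def, Fin.succ_inj]
        split_ifs <;> rfl
    have hn : (0 : ℝ) < n.factorial := by exact_mod_cast n.factorial_pos
    set m : Fin (n + 1) → ℝ := fun p => (∑ e, g p e) / n.factorial with hm
    set M : ℝ := (∑ τ, f τ) / (n + 1).factorial with hM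
    have hMm : ∑ p, m p = (n + 1) * M := by
      rw [hM, hsum f, hm, ← Finset.sum_div, Nat.factorial_succ]
      push_cast
      field_simp
      rfl
    have hmm : ∀ p q, |m p - m q| ≤ 2 * c := by
      intro p q
      rw [hm]
      simp only
      rw [← sub_div, ← Finset.sum_sub_distrib, abs_div, abs_of_pos hn, div_le_iff₀ hn]
      refine (Finset.abs_sum_le_sum_abs _ _).trans ?_
      refine (Finset.sum_le_card_nsmul _ _ (2 * c) ?_).trans ?_
      · intro e _
        simp only [hg]
        rw [hdec p, hdec q]
        have h2 := h (Perm.decomposeFin.symm (0, e)) 0 p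
        have h3 := h (Perm.decomposeFin.symm (0, e)) 0 q
        rw [abs_le] at *
        constructor <;> linarith [h2.1, h2.2, h3.1, h3.2]
      · simp [Fintype.card_perm, mul_comm]
    have hmM : ∀ p, |m p - M| ≤ 2 * c := by
      intro p
      have h1 : m p - M = (∑ q, (m p - m q)) / (n + 1) := by
        rw [Finset.sum_sub_distrib, hMm]
        simp
        field_simp
      rw [h1, abs_div, abs_of_pos (by positivity : (0 : ℝ) < n + 1), div_le_iff₀ (by positivity)]
      refine (Finset.abs_sum_le_sum_abs _ _).trans ?_
      refine (Finset.sum_le_card_nsmul _ _ (2 * c) (fun q _ => hmm p q)).trans ?_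
      simp [mul_comm]
    have hexp : ∀ p, Real.exp (m p - M) ≤ 1 + (m p - M) + (2 * c) ^ 2 := by
      intro p
      have h2 := Real.abs_exp_sub_one_sub_id_le ((hmM p).trans h1)
      have h3 : (m p - M) ^ 2 ≤ (2 * c) ^ 2 := sq_le_sq' (abs_le.1 (hmM p)).1 (abs_le.1 (hmM p)).2
      linarith [(abs_le.1 h2).2]
    have hin : ∀ p, ∑ e, Real.exp (g p e - M) ≤
        Real.exp (m p - M) * (n.factorial * Real.exp (n * (2 * c) ^ 2)) := by
      intro p
      have h2 := ih (g p) c h0 h1 (by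
        intro σ a b
        simp only [hg]
        rw [hdec p, hdec p σ, hdec2, ← mul_assoc, mul_swap_eq_swap_mul, mul_assoc]
        exact h _ _ _)
      refine le_trans (le_of_eq ?_) (mul_le_mul_of_nonneg_left h2 (Real.exp_pos _).le)
      rw [Finset.mul_sum]
      refine Finset.sum_congr rfl fun e _ => ?_
      rw [← Real.exp_add]
      congr 1
      simp only [hm]
      ring
    rw [hsum]
    calc ∑ p, ∑ e, Real.exp (g p e - M)
        ≤ ∑ p, (1 + (m p - M) + (2 * c) ^ 2) * (n.factorial * Real.exp (n * (2 * c) ^ 2)) := by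
          refine Finset.sum_le_sum fun p _ => (hin p).trans ?_
          exact mul_le_mul_of_nonneg_right (hexp p) (by positivity)
      _ = (n + 1) * (1 + (2 * c) ^ 2) * (n.factorial * Real.exp (n * (2 * c) ^ 2)) := by
          rw [← Finset.sum_mul]
          congr 1
          rw [Finset.sum_add_distrib, Finset.sum_add_distrib, Finset.sum_sub_distrib, hMm]
          simp
          ring
      _ ≤ (n + 1) * Real.exp ((2 * c) ^ 2) * (n.factorial * Real.exp (n * (2 * c) ^ 2)) := by
          gcongr
          linarith [Real.add_one_le_exp ((2 * c) ^ 2)]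
      _ = _ := by
          rw [Nat.factorial_succ]
          push_cast
          rw [show ((n : ℝ) + 1) * (2 * c) ^ 2 = n * (2 * c) ^ 2 + (2 * c) ^ 2 by ring, Real.exp_add]
          ring

open Equiv Finset in
theorem perm_tail (n : ℕ) (f : Perm (Fin n) → ℝ) (c s l : ℝ) (hc : 0 ≤ c) (hl : 0 ≤ l)
    (hcl : 2 * (l * c) ≤ 1) (h : ∀ σ a b, |f (swap a b * σ) - f σ| ≤ c) :
    ((univ.filter (fun σ => s ≤ f σ - (∑ τ, f τ) / n.factorial)).card : ℝ) ≤
      n.factorial * Real.exp (n * (2 * (l * c)) ^ 2 - l * s) := by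
  have h1 := perm_mgf n (fun σ => l * f σ) (l * c) (by positivity) hcl (by
    intro σ a b
    rw [← mul_sub, abs_mul, abs_of_nonneg hl]
    exact mul_le_mul_of_nonneg_left (h σ a b) hl)
  rw [sub_eq_add_neg, Real.exp_add, ← mul_assoc, Real.exp_neg, ← div_eq_mul_inv,
    le_div_iff₀ (Real.exp_pos _)]
  refine le_trans ?_ h1
  rw [← nsmul_eq_mul]
  refine (Finset.card_nsmul_le_sum _ _ _ ?_).trans
    (Finset.sum_le_univ_sum_of_nonneg (fun σ => (Real.exp_pos _).le))
  intro σ hσ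
  rw [Finset.mem_filter] at hσ
  rw [Real.exp_le_exp, ← Finset.mul_sum, mul_div_assoc, ← mul_sub]
  exact mul_le_mul_of_nonneg_left hσ.2 hl

open Equiv Finset in
theorem perm_tail2 (n : ℕ) (f : Perm (Fin n) → ℝ) (c s l : ℝ) (hc : 0 ≤ c) (hl : 0 ≤ l)
    (hcl : 2 * (l * c) ≤ 1) (h : ∀ σ a b, |f (swap a b * σ) - f σ| ≤ c) :
    ((univ.filter (fun σ => s < |f σ - (∑ τ, f τ) / n.factorial|)).card : ℝ) ≤
      2 * (n.factorial * Real.exp (n * (2 * (l * c)) ^ 2 - l * s)) := by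
  have h1 := perm_tail n f c s l hc hl hcl h
  have h2 := perm_tail n (fun σ => - f σ) c s l hc hl hcl (by
    intro σ a b
    rw [← abs_neg]
    convert h σ a b using 2
    ring)
  have h3 : (univ.filter (fun σ => s < |f σ - (∑ τ, f τ) / n.factorial|)) ⊆
      (univ.filter (fun σ => s ≤ f σ - (∑ τ, f τ) / n.factorial)) ∪
      (univ.filter (fun σ => s ≤ - f σ - (∑ τ, - f τ) / n.factorial)) := by
    intro σ
    simp only [mem_filter, mem_univ, true_and, mem_union, Finset.sum_neg_distrib]
    intro h4
    rcases lt_abs.1 h4 with h4 | h4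
    · left; linarith
    · right
      rw [neg_div]; linarith
  have h4 : ((univ.filter (fun σ => s < |f σ - (∑ τ, f τ) / n.factorial|)).card : ℝ) ≤
      ((univ.filter (fun σ => s ≤ f σ - (∑ τ, f τ) / n.factorial)).card : ℝ) +
      ((univ.filter (fun σ => s ≤ - f σ - (∑ τ, - f τ) / n.factorial)).card : ℝ) := by
    exact_mod_cast (card_le_card h3).trans (card_union_le _ _)
  linarith

theorem ham_card {n : ℕ} {E : Finset (Sym2 (Fin n))} (h : IsHamCycle n E) : E.card = n := by
  obtain ⟨v, w, hw, rfl⟩ := h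
  rw [List.toFinset_card_of_nodup hw.isCycle.edges_nodup, SimpleGraph.Walk.length_edges,
    hw.length_eq, Fintype.card_fin]

theorem ham_not_diag {n : ℕ} {E : Finset (Sym2 (Fin n))} (h : IsHamCycle n E) :
    ∀ e ∈ E, ¬ e.IsDiag := by
  obtain ⟨v, w, hw, rfl⟩ := h
  intro e he
  rw [List.mem_toFinset] at he
  exact SimpleGraph.not_isDiag_of_mem_edgeSet _ (w.edges_subset_edgeSet he)

theorem ham_deg {n : ℕ} {E : Finset (Sym2 (Fin n))} (h : IsHamCycle n E) (v : Fin n) :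
    (E.filter (fun e => v ∈ e)).card ≤ 2 := by
  obtain ⟨u, w, hw, rfl⟩ := h
  have h1 := hw.isCycle.ncard_neighborSet_toSubgraph_eq_two (hw.mem_support v)
  rw [← h1, ← Set.ncard_coe_finset]
  have h2 : (↑(w.edges.toFinset.filter (fun e => v ∈ e)) : Set (Sym2 (Fin n))) ⊆
      (fun x => s(v, x)) '' (w.toSubgraph.neighborSet v) := by
    intro e he
    simp only [Finset.coe_filter, List.mem_toFinset, Set.mem_ofPred_eq] at he
    obtain ⟨y, rfl⟩ := he.2
    refine ⟨y, ?_, rfl⟩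
    rw [SimpleGraph.Subgraph.mem_neighborSet]
    rw [← SimpleGraph.Subgraph.mem_edgeSet, SimpleGraph.Walk.mem_edges_toSubgraph]
    exact he.1
  refine (Set.ncard_le_ncard h2 (Set.toFinite _)).trans (Set.ncard_image_le (Set.toFinite _))

open Classical in
/-- Edges of `F` between colour classes `j` and `k` of `χ`. -/
noncomputable def betw {n ℓ : ℕ} (F : Finset (Sym2 (Fin n))) (χ : Fin n → Fin ℓ) (j k : Fin ℓ) :
    Finset (Sym2 (Fin n)) :=
  F.filter (fun e => ∃ x y, χ x = j ∧ χ y = k ∧ e = s(x, y))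

theorem betw_diff {n ℓ : ℕ} (F : Finset (Sym2 (Fin n))) (d : ℕ)
    (hF : ∀ v, (F.filter (fun e => v ∈ e)).card ≤ d) (χ χ' : Fin n → Fin ℓ) (j k : Fin ℓ)
    (a b : Fin n) (hab : ∀ v, v ≠ a → v ≠ b → χ v = χ' v) :
    (betw F χ j k).card ≤ (betw F χ' j k).card + 2 * d := by
  classical
  have h : betw F χ j k ⊆ betw F χ' j k ∪
      (F.filter (fun e => a ∈ e) ∪ F.filter (fun e => b ∈ e)) := by
    intro e he
    simp only [betw, Finset.mem_filter, Finset.mem_union] at he ⊢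
    obtain ⟨heF, x, y, hx, hy, rfl⟩ := he
    by_cases ha : a ∈ s(x, y)
    · exact Or.inr (Or.inl ⟨heF, ha⟩)
    by_cases hb : b ∈ s(x, y)
    · exact Or.inr (Or.inr ⟨heF, hb⟩)
    left
    simp only [Sym2.mem_iff, not_or] at ha hb
    refine ⟨heF, x, y, ?_, ?_, rfl⟩
    · rw [← hab x (Ne.symm ha.1) (Ne.symm hb.1)]; exact hx
    · rw [← hab y (Ne.symm ha.2) (Ne.symm hb.2)]; exact hy
  have h1 := Finset.card_le_card h
  have h2 := Finset.card_union_le (betw F χ' j k)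
      (F.filter (fun e => a ∈ e) ∪ F.filter (fun e => b ∈ e))
  have h3 := Finset.card_union_le (F.filter (fun e => a ∈ e)) (F.filter (fun e => b ∈ e))
  have := hF a
  have := hF b
  omega

open Equiv in
theorem betw_lip {n ℓ : ℕ} (F : Finset (Sym2 (Fin n))) (d : ℕ)
    (hF : ∀ v, (F.filter (fun e => v ∈ e)).card ≤ d) (χ : Fin n → Fin ℓ) (j k : Fin ℓ)
    (σ : Perm (Fin n)) (a b : Fin n) :
    |((betw F (χ ∘ (swap a b * σ : Perm (Fin n))) j k).card : ℝ) - ((betw F (χ ∘ σ) j k).card : ℝ)|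
      ≤ 2 * d := by
  have hab : ∀ v, v ≠ σ⁻¹ a → v ≠ σ⁻¹ b →
      (χ ∘ (swap a b * σ : Perm (Fin n))) v = (χ ∘ σ) v := by
    intro v ha hb
    simp only [Function.comp, Perm.mul_apply]
    rw [swap_apply_of_ne_of_ne]
    · intro h; exact ha (by rw [← h]; simp)
    · intro h; exact hb (by rw [← h]; simp)
  have h1 := betw_diff F d hF _ _ j k _ _ hab
  have h2 := betw_diff F d hF _ _ j k _ _ (fun v ha hb => (hab v ha hb).symm)
  have h1' : ((betw F (χ ∘ (swap a b * σ : Perm (Fin n))) j k).card : ℝ) ≤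
    (betw F (χ ∘ σ) j k).card + 2 * d := by exact_mod_cast h1
  have h2' : ((betw F (χ ∘ σ) j k).card : ℝ) ≤
    (betw F (χ ∘ (swap a b * σ : Perm (Fin n))) j k).card + 2 * d := by exact_mod_cast h2
  rw [abs_le]
  constructor <;> linarith

open Equiv Finset in
theorem pair_count_eq {n ℓ : ℕ} (χ : Fin n → Fin ℓ) (j k : Fin ℓ) {x y x' y' : Fin n}
    (h : x ≠ y) (h' : x' ≠ y') :
    (univ.filter (fun σ : Perm (Fin n) => χ (σ x) = j ∧ χ (σ y) = k)).card =
    (univ.filter (fun σ : Perm (Fin n) => χ (σ x') = j ∧ χ (σ y') = k)).card := by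
  obtain ⟨π, h1, h2⟩ : ∃ π : Perm (Fin n), π x' = x ∧ π y' = y := by
    refine ⟨swap (swap x' x y') y * swap x' x, ?_, ?_⟩
    · rw [Perm.mul_apply, swap_apply_left, swap_apply_of_ne_of_ne _ h]
      intro h3
      apply h'
      have := congrArg (swap x' x) h3
      simpa using this
    · simp
  refine Finset.card_bij (fun σ _ => σ * π) ?_ ?_ ?_
  · intro σ hσ
    simpa [h1, h2] using hσ
  · intro a _ b _ hab
    exact mul_right_cancel hab
  · intro σ hσ
    refine ⟨σ * π⁻¹, ?_, by simp⟩
    have h3 : π⁻¹ x = x' := by rw [← h1]; simp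
    have h4 : π⁻¹ y = y' := by rw [← h2]; simp
    simp only [mem_filter, mem_univ, true_and] at hσ ⊢
    rw [Perm.mul_apply, Perm.mul_apply, h3, h4]
    exact hσ

open Equiv Finset in
theorem pair_count {n ℓ : ℕ} (χ : Fin n → Fin ℓ) (j k : Fin ℓ) (hjk : j ≠ k) {x y : Fin n}
    (h : x ≠ y) :
    (n * (n - 1)) * (univ.filter (fun σ : Perm (Fin n) => χ (σ x) = j ∧ χ (σ y) = k)).card =
    n.factorial * ((univ.filter (fun v => χ v = j)).card * (univ.filter (fun v => χ v = k)).card)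
    := by
  have h1 : ∑ p ∈ (univ : Finset (Fin n)).offDiag,
      (univ.filter (fun σ : Perm (Fin n) => χ (σ p.1) = j ∧ χ (σ p.2) = k)).card =
      (n * (n - 1)) * (univ.filter (fun σ : Perm (Fin n) => χ (σ x) = j ∧ χ (σ y) = k)).card := by
    rw [Finset.sum_congr rfl (fun p hp => pair_count_eq χ j k (mem_offDiag.1 hp).2.2 h)]
    rw [Finset.sum_const, offDiag_card, smul_eq_mul, card_univ, Fintype.card_fin, Nat.mul_sub_one]
  rw [← h1]
  simp_rw [Finset.card_filter]
  rw [Finset.sum_comm]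
  have h2 : ∀ σ : Perm (Fin n), ∑ p ∈ (univ : Finset (Fin n)).offDiag,
      (if χ (σ p.1) = j ∧ χ (σ p.2) = k then 1 else 0) =
      ((univ.filter (fun v => χ v = j)).card * (univ.filter (fun v => χ v = k)).card) := by
    intro σ
    rw [← Finset.card_product, ← Finset.card_filter]
    refine Finset.card_bij (fun p _ => (σ p.1, σ p.2)) ?_ ?_ ?_
    · rintro ⟨p, q⟩ hp
      simp at hp ⊢
      exact hp.2
    · rintro ⟨p, q⟩ _ ⟨p', q'⟩ _ h
      simpa using h
    · rintro ⟨p, q⟩ hp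
      refine ⟨(σ⁻¹ p, σ⁻¹ q), ?_, by simp⟩
      simp at hp ⊢
      refine ⟨?_, hp⟩
      rintro rfl
      exact hjk (hp.1.symm.trans hp.2)
  rw [Finset.sum_congr rfl (fun σ _ => h2 σ), Finset.sum_const, card_univ, Fintype.card_perm,
    Fintype.card_fin, smul_eq_mul, Finset.card_filter, Finset.card_filter]

open Equiv Finset in
theorem betw_mean {n ℓ : ℕ} (F : Finset (Sym2 (Fin n))) (hF : ∀ e ∈ F, ¬ e.IsDiag)
    (χ : Fin n → Fin ℓ) (j k : Fin ℓ) (hjk : j ≠ k) :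
    (n * (n - 1)) * ∑ σ : Perm (Fin n), (betw F (χ ∘ σ) j k).card =
    n.factorial * (2 * F.card *
      ((univ.filter (fun v => χ v = j)).card * (univ.filter (fun v => χ v = k)).card)) := by
  classical
  have h1 : ∀ e ∈ F, (n * (n - 1)) * ∑ σ : Perm (Fin n),
      (if ∃ x y, (χ ∘ σ) x = j ∧ (χ ∘ σ) y = k ∧ e = s(x, y) then 1 else 0) =
      n.factorial * (2 * 
      ((univ.filter (fun v => χ v = j)).card * (univ.filter (fun v => χ v = k)).card)) := by
    intro e he
    have hd := hF e he
    induction e using Sym2.ind with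
    | _ x y =>
    have hxy : x ≠ y := by simpa using hd
    have h2 := pair_count χ j k hjk hxy
    have h3 := pair_count χ j k hjk hxy.symm
    rw [← Finset.card_filter]
    have h4 : (univ.filter (fun σ : Perm (Fin n) =>
        ∃ x' y', (χ ∘ σ) x' = j ∧ (χ ∘ σ) y' = k ∧ s(x, y) = s(x', y'))) =
        (univ.filter (fun σ : Perm (Fin n) => χ (σ x) = j ∧ χ (σ y) = k)) ∪
        (univ.filter (fun σ : Perm (Fin n) => χ (σ y) = j ∧ χ (σ x) = k)) := by
      ext σ
      simp only [mem_filter, mem_univ, true_and, mem_union, Function.comp]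
      constructor
      · rintro ⟨x', y', h5, h6, h7⟩
        rcases Sym2.eq_iff.1 h7 with ⟨rfl, rfl⟩ | ⟨rfl, rfl⟩
        · exact Or.inl ⟨h5, h6⟩
        · exact Or.inr ⟨h5, h6⟩
      · rintro (⟨h5, h6⟩ | ⟨h5, h6⟩)
        · exact ⟨x, y, h5, h6, rfl⟩
        · exact ⟨y, x, h5, h6, Sym2.eq_swap⟩
    rw [h4, Finset.card_union_of_disjoint, mul_add, h2, h3]
    · ring
    · rw [Finset.disjoint_filter]
      rintro σ _ ⟨h5, _⟩ ⟨_, h6⟩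
      exact hjk (h5.symm.trans h6)
  simp_rw [betw, Finset.card_filter _ F]
  rw [Finset.sum_comm, Finset.mul_sum, Finset.sum_congr rfl h1, Finset.sum_const, smul_eq_mul]
  simp_rw [Finset.card_filter]
  ring

/-- The base colouring. -/
def baseCol (n ℓ : ℕ) (hℓ : 0 < ℓ) (v : Fin n) : Fin ℓ := ⟨v % ℓ, Nat.mod_lt _ hℓ⟩

open Finset in
theorem baseCol_card (n ℓ : ℕ) (hℓ : 0 < ℓ) (j : Fin ℓ) :
    (univ.filter (fun v => baseCol n ℓ hℓ v = j)).card =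
      if (j : ℕ) < n % ℓ then (n + ℓ - 1) / ℓ else n / ℓ := by
  have h1 := Nat.count_modEq_card n hℓ j
  have h2 : (univ.filter (fun v => baseCol n ℓ hℓ v = j)).card =
      Nat.count (fun x => x ≡ j [MOD ℓ]) n := by
    rw [Nat.count_eq_card_filter_range, ← Finset.card_map Fin.valEmbedding]
    congr 1
    ext x
    simp only [mem_map, mem_filter, mem_univ, true_and, baseCol, Fin.valEmbedding_apply, mem_range,
      Nat.ModEq, Nat.mod_eq_of_lt j.2, Fin.ext_iff]
    constructor
    · rintro ⟨a, h, rfl⟩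
      exact ⟨a.2, h⟩
    · rintro ⟨h, h'⟩
      exact ⟨⟨x, h⟩, h', rfl⟩
  rw [h2, h1, Nat.mod_eq_of_lt j.2]
  split_ifs with h
  · have h3 : n + ℓ - 1 = (n % ℓ - 1) + ℓ * (n / ℓ + 1) := by
      have := Nat.mod_add_div n ℓ
      rw [mul_add]; omega
    have h4 : n % ℓ - 1 < ℓ := by
      have := Nat.mod_lt n hℓ
      omega
    rw [h3, Nat.add_mul_div_left _ _ hℓ, Nat.div_eq_of_lt h4, zero_add]
  · rfl

open Equiv Finset in
theorem fiber_card {n ℓ : ℕ} (χ χ' : Fin n → Fin ℓ) :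
    (univ.filter (fun σ : Perm (Fin n) => χ ∘ σ = χ')).card ≤
      ∏ j, ((univ.filter (fun v => χ v = j)).card).factorial := by
  classical
  have h1 := DomMulAct.stabilizer_card χ
  rcases Finset.eq_empty_or_nonempty (univ.filter (fun σ : Perm (Fin n) => χ ∘ σ = χ')) with h | h
  · rw [h]; simp
  · obtain ⟨σ₀, h0⟩ := h
    simp only [mem_filter, mem_univ, true_and] at h0
    simp_rw [Fintype.card_subtype] at h1
    rw [← h1]
    refine Finset.card_le_card_of_injOn (fun σ => σ * σ₀⁻¹) ?_ ?_
    · intro σ hσ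
      simp only [coe_filter, mem_univ, true_and, Set.mem_ofPred_eq] at hσ ⊢
      rw [Perm.coe_mul, ← Function.comp_assoc, hσ, ← h0]
      ext v
      simp
    · intro a _ b _ hab
      exact mul_right_cancel hab

theorem prod_fact (n ℓ : ℕ) (hℓ : 0 < ℓ) :
    ∏ j : Fin ℓ, (if (j : ℕ) < n % ℓ then (n + ℓ - 1) / ℓ else n / ℓ).factorial =
      (((n + ℓ - 1) / ℓ).factorial) ^ (n % ℓ) * ((n / ℓ).factorial) ^ (ℓ - n % ℓ) := by
  have hr := Nat.mod_lt n hℓ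
  rw [Fin.prod_univ_eq_prod_range (fun j : ℕ => (if j < n % ℓ then (n + ℓ - 1) / ℓ else n / ℓ).factorial),
    ← Finset.prod_range_mul_prod_Ico _ hr.le]
  congr 1
  · rw [Finset.prod_congr rfl (g := fun _ => ((n + ℓ - 1) / ℓ).factorial)]
    · simp
    · intro j hj
      rw [if_pos (Finset.mem_range.1 hj)]
  · rw [Finset.prod_congr rfl (g := fun _ => (n / ℓ).factorial)]
    · simp
    · intro j hj
      rw [if_neg (by have := (Finset.mem_Ico.1 hj).1; omega)]

open Filter in
theorem eventually_bounds : ∃ N : ℕ, ∀ n : ℕ, N ≤ n → 36 ≤ n ∧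
    8 * (n : ℝ) ^ ((1 : ℝ) / 100) ≤ (n : ℝ) ^ ((2 : ℝ) / 3) ∧
    (n : ℝ) ≤ Real.exp ((n : ℝ) ^ ((3 : ℝ) / 100)) ∧
    16 * (n : ℝ) ^ ((3 : ℝ) / 100) ≤ (n : ℝ) ^ ((47 : ℝ) / 300) := by
  have key : ∀ a b C : ℝ, a < b → ∀ᶠ n : ℕ in atTop, C * (n : ℝ) ^ a ≤ (n : ℝ) ^ b := by
    intro a b C hab
    have h1 := (tendsto_rpow_atTop (sub_pos.2 hab)).comp tendsto_natCast_atTop_atTop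
    filter_upwards [h1.eventually_ge_atTop C, eventually_gt_atTop 0] with n hn h0
    have h0' : (0 : ℝ) < n := by exact_mod_cast h0
    have : (n : ℝ) ^ b = (n : ℝ) ^ (b - a) * (n : ℝ) ^ a := by
      rw [← Real.rpow_add h0']; ring_nf
    rw [this]
    exact mul_le_mul_of_nonneg_right hn (by positivity)
  have h2 := (isLittleO_log_rpow_atTop (r := (3 : ℝ) / 100) (by norm_num)).bound one_pos
  have h3 := tendsto_natCast_atTop_atTop (R := ℝ) |>.eventually h2
  have h4 : ∀ᶠ n : ℕ in atTop, 36 ≤ n ∧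
    8 * (n : ℝ) ^ ((1 : ℝ) / 100) ≤ (n : ℝ) ^ ((2 : ℝ) / 3) ∧
    (n : ℝ) ≤ Real.exp ((n : ℝ) ^ ((3 : ℝ) / 100)) ∧
    16 * (n : ℝ) ^ ((3 : ℝ) / 100) ≤ (n : ℝ) ^ ((47 : ℝ) / 300) := by
    filter_upwards [h3, key (1/100) (2/3) 8 (by norm_num), key (3/100) (47/300) 16 (by norm_num),
      eventually_ge_atTop 36] with n h5 h6 h7 h8
    refine ⟨h8, h6, ?_, h7⟩
    have h0' : (0 : ℝ) < n := by exact_mod_cast (by omega : 0 < n)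
    rw [← Real.log_le_iff_le_exp h0']
    rw [one_mul, Real.norm_eq_abs, Real.norm_eq_abs, abs_of_nonneg (a := (n : ℝ) ^ _) (by positivity)] at h5
    exact (le_abs_self _).trans h5
  exact eventually_atTop.1 h4

theorem mean_arith (n ℓ i t t' : ℝ) (hn : 36 ≤ n) (hl : 2 ≤ ℓ) (hi : 0 ≤ i)
    (ht : |t - n / ℓ| ≤ 1) (ht' : |t' - n / ℓ| ≤ 1) :
    |2 * i * t * t' / (n - 1) - 2 * i * n / ℓ ^ 2| ≤ 8 * i := by
  obtain ⟨u, hu⟩ : ∃ u, u = n / ℓ := ⟨_, rfl⟩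
  obtain ⟨a, ha⟩ : ∃ a, a = t - n / ℓ := ⟨_, rfl⟩
  obtain ⟨b, hb⟩ : ∃ b, b = t' - n / ℓ := ⟨_, rfl⟩
  rw [← ha] at ht
  rw [← hb] at ht'
  have hu0 : 0 ≤ u := by rw [hu]; positivity
  have hu1 : 2 * u ≤ n := by
    have : ℓ * u = n := by rw [hu]; field_simp
    nlinarith
  have hlu : 2 * i * n / ℓ ^ 2 = 2 * i * u ^ 2 / n := by
    rw [hu]; field_simp
  have h1 : 2 * i * t * t' / (n - 1) - 2 * i * n / ℓ ^ 2 =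
      2 * i * ((u ^ 2 / n + (a + b) * u + a * b) / (n - 1)) := by
    rw [hlu, show t = u + a by rw [hu, ha]; ring, show t' = u + b by rw [hu, hb]; ring]
    have : n - 1 ≠ 0 := by linarith
    have : n ≠ 0 := by linarith
    field_simp
    ring
  rw [h1, abs_mul, abs_of_nonneg (by positivity : 0 ≤ 2 * i)]
  have h2 : |(u ^ 2 / n + (a + b) * u + a * b) / (n - 1)| ≤ 4 := by
    rw [abs_div, abs_of_pos (by linarith : 0 < n - 1), div_le_iff₀ (by linarith)]
    have h3 : u ^ 2 / n ≤ n := by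
      rw [div_le_iff₀ (by linarith)]; nlinarith
    have h30 : 0 ≤ u ^ 2 / n := by positivity
    have h4 : |(a + b) * u| ≤ 2 * u := by
      rw [abs_mul, abs_of_nonneg hu0]
      exact mul_le_mul_of_nonneg_right ((abs_add_le a b).trans (by linarith)) hu0
    have h5 : |a * b| ≤ 1 := by
      rw [abs_mul]
      exact mul_le_one₀ ht (abs_nonneg _) ht'
    have h6 := abs_add_le (u ^ 2 / n + (a + b) * u) (a * b)
    have h7 := abs_add_le (u ^ 2 / n) ((a + b) * u)
    rw [abs_of_nonneg h30] at h7
    linarith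
  nlinarith

theorem size_near (n ℓ : ℕ) (hℓ : 0 < ℓ) (j : Fin ℓ) :
    |(((if (j : ℕ) < n % ℓ then (n + ℓ - 1) / ℓ else n / ℓ : ℕ) : ℝ)) - (n : ℝ) / ℓ| ≤ 1 := by
  have hl : (0 : ℝ) < ℓ := by exact_mod_cast hℓ
  have h1 : ((n / ℓ : ℕ) : ℝ) ≤ (n : ℝ) / ℓ := Nat.cast_div_le
  have h2 : (n : ℝ) / ℓ ≤ ((n / ℓ : ℕ) : ℝ) + 1 := (Nat.lt_floor_add_one _).le.trans (by
    rw [Nat.floor_div_eq_div])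
  have h3 : (n + ℓ - 1) / ℓ ≤ n / ℓ + 1 := by
    rw [← Nat.add_div_right _ hℓ]
    exact Nat.div_le_div_right (by omega)
  have h4 : n / ℓ ≤ (n + ℓ - 1) / ℓ := Nat.div_le_div_right (by omega)
  have h5 : (((n + ℓ - 1) / ℓ : ℕ) : ℝ) ≤ ((n / ℓ : ℕ) : ℝ) + 1 := by exact_mod_cast h3
  have h6 : ((n / ℓ : ℕ) : ℝ) ≤ (((n + ℓ - 1) / ℓ : ℕ) : ℝ) := by exact_mod_cast h4
  have h7 : (((n + ℓ - 1) / ℓ : ℕ) : ℝ) ≤ (n : ℝ) / ℓ + 1 := by linarith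
  rw [abs_le]
  split_ifs
  · constructor <;> linarith
  · constructor <;> linarith

theorem tail_arith (n i : ℝ) (hn : 36 ≤ n) (hi : 1 ≤ i) (hin : i ≤ n ^ ((1 : ℝ) / 100)) (ℓ : ℝ)
    (hl : ℓ ≤ Real.sqrt n) (h1 : n ≤ Real.exp (n ^ ((3 : ℝ) / 100)))
    (h2 : 16 * n ^ ((3 : ℝ) / 100) ≤ n ^ ((47 : ℝ) / 300)) :
    ℓ * (2 * Real.exp (1 - 1 / (8 * i * Real.sqrt n) * n ^ ((2 : ℝ) / 3))) ≤
      Real.exp (-n ^ ((3 : ℝ) / 100)) := by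
  have hn0 : 0 < n := by linarith
  have h3 : 2 * n ^ ((3 : ℝ) / 100) ≤ 1 / (8 * i * Real.sqrt n) * n ^ ((2 : ℝ) / 3) := by
    rw [one_div, inv_mul_eq_div, le_div_iff₀ (by positivity)]
    have h4 : n ^ ((2 : ℝ) / 3) =
        n ^ ((47 : ℝ) / 300) * n ^ ((1 : ℝ) / 100) * Real.sqrt n := by
      rw [Real.sqrt_eq_rpow, ← Real.rpow_add hn0, ← Real.rpow_add hn0]
      norm_num
    rw [h4]
    calc 2 * n ^ ((3 : ℝ) / 100) * (8 * i * Real.sqrt n)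
        = 16 * n ^ ((3 : ℝ) / 100) * i * Real.sqrt n := by ring
      _ ≤ _ := by gcongr
  have h5 : ℓ * (2 * Real.exp 1) ≤ n := by
    have he := Real.exp_one_lt_d9
    have hs : 6 ≤ Real.sqrt n := Real.le_sqrt_of_sq_le (by linarith)
    have hss := Real.mul_self_sqrt hn0.le
    have : ℓ * (2 * Real.exp 1) ≤ Real.sqrt n * (2 * Real.exp 1) := by gcongr
    nlinarith
  calc ℓ * (2 * Real.exp (1 - 1 / (8 * i * Real.sqrt n) * n ^ ((2 : ℝ) / 3)))
      = ℓ * (2 * Real.exp 1) * Real.exp (- (1 / (8 * i * Real.sqrt n) * n ^ ((2 : ℝ) / 3))) := by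
        rw [sub_eq_add_neg, Real.exp_add]; ring
    _ ≤ Real.exp (n ^ ((3 : ℝ) / 100)) * Real.exp (- (2 * n ^ ((3 : ℝ) / 100))) := by
        refine mul_le_mul (h5.trans h1) ?_ (Real.exp_pos _).le (Real.exp_pos _).le
        rw [Real.exp_le_exp]; linarith
    _ = _ := by rw [← Real.exp_add]; ring_nf

theorem union_facts {n i : ℕ} (H : Fin i → Finset (Sym2 (Fin n)))
    (hH : ∀ j, IsHamCycle n (H j)) (hd : ∀ a b : Fin i, a ≠ b → Disjoint (H a) (H b)) :
    (Finset.univ.sup H).card = i * n ∧ (∀ e ∈ Finset.univ.sup H, ¬ e.IsDiag) ∧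
    (∀ v, ((Finset.univ.sup H).filter (fun e => v ∈ e)).card ≤ 2 * i) := by
  rw [Finset.sup_eq_biUnion]
  refine ⟨?_, ?_, ?_⟩
  · rw [Finset.card_biUnion (fun a _ b _ hab => hd a b hab),
      Finset.sum_congr rfl (fun j _ => ham_card (hH j))]
    simp
  · intro e he
    obtain ⟨j, _, hj⟩ := Finset.mem_biUnion.1 he
    exact ham_not_diag (hH j) e hj
  · intro v
    rw [Finset.filter_biUnion]
    refine Finset.card_biUnion_le.trans ?_
    refine (Finset.sum_le_card_nsmul _ _ 2 (fun j _ => ham_deg (hH j) v)).trans ?_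
    simp [mul_comm]

/-- There is `N` such that for all `n ≥ N` the following holds. Let `1 ≤ i ≤ n^{1/100}`, let `F`
be the union of the edge sets of `i` pairwise edge-disjoint Hamilton cycles of `K_n`, and let
`2 ≤ ℓ ≤ √n`; set `r = n % ℓ`, `t_c = ⌈n/ℓ⌉ = (n + ℓ - 1)/ℓ`, `t_f = ⌊n/ℓ⌋ = n/ℓ`. Then the
number of ordered partitions `(V_1, …, V_ℓ)` of `{1, …, n}` (indexed by `Fin ℓ`) whose first `r`
parts have size `t_c` and whose remaining parts have size `t_f`, such that for every `j`
(cyclically) the number of edges of `F` between `V_j` and `V_{j+1}` differs from `2·i·n/ℓ²` by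
at most `2·n^{2/3}`, is at least `(1 − e^{−n^{3/100}}) · n!/((t_c!)^r · (t_f!)^{ℓ−r})`. -/
theorem count_good_partitions :
    ∃ N : ℕ, ∀ n : ℕ, N ≤ n → ∀ i : ℕ, 1 ≤ i → (i : ℝ) ≤ (n : ℝ) ^ ((1 : ℝ) / 100) →
      ∀ H : Fin i → Finset (Sym2 (Fin n)),
        (∀ j, IsHamCycle n (H j)) →
        (∀ a b : Fin i, a ≠ b → Disjoint (H a) (H b)) →
        ∀ F : Finset (Sym2 (Fin n)), F = Finset.univ.sup H →
        ∀ ℓ : ℕ, ∀ hℓ : 2 ≤ ℓ, (ℓ : ℝ) ≤ Real.sqrt n →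
        (1 - Real.exp (-(n : ℝ) ^ ((3 : ℝ) / 100))) * (n.factorial : ℝ) /
            ((((n + ℓ - 1) / ℓ).factorial : ℝ) ^ (n % ℓ) *
              ((n / ℓ).factorial : ℝ) ^ (ℓ - n % ℓ)) ≤
          (Set.ncard {V : Fin ℓ → Finset (Fin n) |
            (∀ j : Fin ℓ, (V j).card = if (j : ℕ) < n % ℓ then (n + ℓ - 1) / ℓ else n / ℓ) ∧
            (∀ a b : Fin ℓ, a ≠ b → Disjoint (V a) (V b)) ∧
            (∀ v : Fin n, ∃ j, v ∈ V j) ∧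
            (∀ j : Fin ℓ,
              |(Set.ncard {e : Sym2 (Fin n) | e ∈ F ∧
                  ∃ x ∈ V j, ∃ y ∈ V (j + ⟨1, by omega⟩), e = s(x, y)} : ℝ) -
                2 * (i : ℝ) * (n : ℝ) / (ℓ : ℝ) ^ 2| ≤ 2 * (n : ℝ) ^ ((2 : ℝ) / 3))} : ℝ) := by
  classical
  obtain ⟨N, hN⟩ := eventually_bounds
  refine ⟨N, fun n hn i hi hin H hH hd F hF ℓ hℓ hℓn => ?_⟩
  obtain ⟨hn36, hb1, hb2, hb3⟩ := hN n hn
  have hℓ0 : 0 < ℓ := by omega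
  obtain ⟨hFc, hFd, hFdeg⟩ := union_facts H hH hd
  rw [← hF] at hFc hFd hFdeg
  have hnR : (36 : ℝ) ≤ n := by exact_mod_cast hn36
  have hiR : (1 : ℝ) ≤ i := by exact_mod_cast hi
  have hℓR : (2 : ℝ) ≤ ℓ := by exact_mod_cast hℓ
  have hnf : (0 : ℝ) < n.factorial := by exact_mod_cast n.factorial_pos
  have hs : 0 < Real.sqrt n := Real.sqrt_pos.2 (by linarith)
  set χ := baseCol n ℓ hℓ0 with hχ
  set one : Fin ℓ := ⟨1, by omega⟩ with hone
  have hne : ∀ j : Fin ℓ, j ≠ j + one := by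
    intro j h
    have h1 := congrArg Fin.val h
    rw [Fin.val_add, hone] at h1
    simp only at h1
    have hj := j.2
    rcases Nat.lt_or_ge (j + 1) ℓ with h2 | h2
    · rw [Nat.mod_eq_of_lt h2] at h1; omega
    · have h3 : (j : ℕ) + 1 = ℓ := by omega
      rw [h3, Nat.mod_self] at h1; omega
  let f : Fin ℓ → Equiv.Perm (Fin n) → ℝ := fun j σ => ((betw F (χ ∘ σ) j (j + one)).card : ℝ)
  let bad : Fin ℓ → Finset (Equiv.Perm (Fin n)) := fun j => Finset.univ.filter (fun σ =>
    (n : ℝ) ^ ((2 : ℝ) / 3) < |f j σ - (∑ τ, f j τ) / n.factorial|)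
  let good : Finset (Equiv.Perm (Fin n)) := Finset.univ \ Finset.univ.biUnion bad
  -- mean
  have hmean : ∀ j, |(∑ τ, f j τ) / n.factorial - 2 * (i : ℝ) * n / (ℓ : ℝ) ^ 2| ≤
      (n : ℝ) ^ ((2 : ℝ) / 3) := by
    intro j
    have h1 := betw_mean F hFd χ j (j + one) (hne j)
    rw [hχ, baseCol_card, baseCol_card, hFc, ← hχ] at h1
    obtain ⟨t, ht⟩ : ∃ t, t = if (j : ℕ) < n % ℓ then (n + ℓ - 1) / ℓ else n / ℓ := ⟨_, rfl⟩
    obtain ⟨t', ht'⟩ : ∃ t', t' = if ((j + one : Fin ℓ) : ℕ) < n % ℓ then (n + ℓ - 1) / ℓ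
      else n / ℓ := ⟨_, rfl⟩
    rw [← ht, ← ht'] at h1
    have h2 := size_near n ℓ hℓ0 j
    have h3 := size_near n ℓ hℓ0 (j + one)
    rw [← ht] at h2
    rw [← ht'] at h3
    have h4 : ((n : ℝ) * (n - 1)) * ∑ τ, f j τ = n.factorial * (2 * (i * n) * (t * t')) := by
      have := congrArg (Nat.cast : ℕ → ℝ) h1
      push_cast [Nat.cast_sub (by omega : 1 ≤ n)] at this
      exact this
    have h5 : (∑ τ, f j τ) / n.factorial = 2 * (i : ℝ) * t * t' / (n - 1) := by
      have : (n : ℝ) - 1 ≠ 0 := by linarith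
      have h0 : (n : ℝ) ≠ 0 := by linarith
      rw [div_eq_div_iff hnf.ne' this]
      apply mul_left_cancel₀ h0
      linear_combination h4
    rw [h5]
    refine (mean_arith n ℓ i t t' hnR hℓR (by linarith) h2 h3).trans (le_trans ?_ hb1)
    linarith
  -- tail
  have hbad : ∀ j, ((bad j).card : ℝ) ≤ n.factorial *
      (2 * Real.exp (1 - 1 / (8 * i * Real.sqrt n) * (n : ℝ) ^ ((2 : ℝ) / 3))) := by
    intro j
    have hlc : 2 * (1 / (8 * (i : ℝ) * Real.sqrt n) * (2 * ((2 * i : ℕ) : ℝ))) = 1 / Real.sqrt n := by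
      push_cast
      field_simp
      norm_num
    have h1 := perm_tail2 n (f j) (2 * ((2 * i : ℕ) : ℝ)) ((n : ℝ) ^ ((2 : ℝ) / 3))
      (1 / (8 * i * Real.sqrt n)) (by positivity) (by positivity)
      (by
        rw [hlc, div_le_one hs]
        exact Real.le_sqrt_of_sq_le (by linarith))
      (fun σ a b => betw_lip F (2 * i) hFdeg χ j (j + one) σ a b)
    rw [hlc] at h1
    have h2 : (n : ℝ) * (1 / Real.sqrt n) ^ 2 = 1 := by
      rw [div_pow, Real.sq_sqrt (by linarith)]
      have : (n : ℝ) ≠ 0 := by linarith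
      field_simp
    rw [h2] at h1
    refine h1.trans (le_of_eq ?_)
    ring
  have hgood : (1 - Real.exp (-(n : ℝ) ^ ((3 : ℝ) / 100))) * (n.factorial : ℝ) ≤ good.card := by
    have h1 : (n.factorial : ℝ) ≤ good.card + ((Finset.univ.biUnion bad).card : ℝ) := by
      have := Finset.card_sdiff_add_card_eq_card (Finset.subset_univ (Finset.univ.biUnion bad))
      rw [Finset.card_univ, Fintype.card_perm, Fintype.card_fin] at this
      exact_mod_cast this.ge
    have h2 : ((Finset.univ.biUnion bad).card : ℝ) ≤ ∑ j, ((bad j).card : ℝ) := by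
      exact_mod_cast Finset.card_biUnion_le
    have h3 := h2.trans (Finset.sum_le_card_nsmul _ _ _ (fun j _ => hbad j))
    rw [Finset.card_univ, Fintype.card_fin, nsmul_eq_mul] at h3
    have h4 := mul_le_mul_of_nonneg_left (tail_arith n i hnR hiR hin ℓ hℓn hb2 hb3) hnf.le
    linarith
  have hD : ((((n + ℓ - 1) / ℓ).factorial : ℝ) ^ (n % ℓ) *
      ((n / ℓ).factorial : ℝ) ^ (ℓ - n % ℓ)) =
      ((∏ j, ((Finset.univ.filter (fun v => χ v = j)).card).factorial : ℕ) : ℝ) := by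
    rw [hχ]
    simp_rw [baseCol_card]
    rw [prod_fact n ℓ hℓ0]
    push_cast
    rfl
  rw [hD, div_le_iff₀ (by
    exact_mod_cast Finset.prod_pos (fun j _ => Nat.factorial_pos _))]
  refine hgood.trans ?_
  let part : Equiv.Perm (Fin n) → (Fin ℓ → Finset (Fin n)) :=
    fun σ j => Finset.univ.filter (fun v => χ (σ v) = j)
  have h1 := Finset.card_le_mul_card_image (f := part) good
    (∏ j, ((Finset.univ.filter (fun v => χ v = j)).card).factorial) (by
      intro V hV
      obtain ⟨σ₀, _, rfl⟩ := Finset.mem_image.1 hV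
      refine le_trans (Finset.card_le_card ?_) (fiber_card χ (χ ∘ σ₀))
      intro σ hσ
      simp only [Finset.mem_filter, Finset.mem_univ, true_and] at hσ ⊢
      ext1 v
      have h2 : v ∈ part σ₀ (χ (σ₀ v)) := by simp [part]
      rw [← hσ.2] at h2
      simpa [part] using h2)
  have h2 : ∀ S : Set (Fin ℓ → Finset (Fin n)), (↑(Finset.image part good) : Set _) ⊆ S →
      (good.card : ℝ) ≤ (S.ncard : ℝ) *
        ((∏ j, ((Finset.univ.filter (fun v => χ v = j)).card).factorial : ℕ) : ℝ) := by
    intro S hS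
    have h3 := Set.ncard_le_ncard hS (Set.toFinite _)
    rw [Set.ncard_coe_finset] at h3
    rw [mul_comm]
    exact_mod_cast h1.trans (Nat.mul_le_mul_left _ h3)
  apply h2
  intro V hV
  simp only [Finset.coe_image, Set.mem_image, Finset.mem_coe] at hV
  obtain ⟨σ, hσ, rfl⟩ := hV
  refine ⟨?_, ?_, ?_, ?_⟩
  · intro j
    rw [← baseCol_card n ℓ hℓ0 j]
    refine Finset.card_bij (fun v _ => σ v) ?_ ?_ ?_
    · intro v hv
      simpa [part] using hv
    · intro a _ b _ hab
      exact σ.injective hab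
    · intro v hv
      refine ⟨σ.symm v, ?_, by simp⟩
      simpa [part] using hv
  · intro a b hab
    rw [Finset.disjoint_left]
    intro v hv hv'
    simp only [part, Finset.mem_filter, Finset.mem_univ, true_and] at hv hv'
    exact hab (hv.symm.trans hv')
  · intro v
    exact ⟨χ (σ v), by simp [part]⟩
  · intro j
    have h3 : {e : Sym2 (Fin n) | e ∈ F ∧
        ∃ x ∈ part σ j, ∃ y ∈ part σ (j + one), e = s(x, y)} =
        (↑(betw F (χ ∘ σ) j (j + one)) : Set (Sym2 (Fin n))) := by
      ext e
      simp only [part, betw, Finset.mem_filter, Finset.mem_univ, true_and, Set.mem_ofPred_eq,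
        Finset.coe_filter, Function.comp]
      constructor
      · rintro ⟨h4, x, hx, y, hy, h5⟩
        exact ⟨h4, x, y, hx, hy, h5⟩
      · rintro ⟨h4, x, y, hx, hy, h5⟩
        exact ⟨h4, x, hx, y, hy, h5⟩
    rw [h3, Set.ncard_coe_finset]
    have h4 : |f j σ - (∑ τ, f j τ) / n.factorial| ≤ (n : ℝ) ^ ((2 : ℝ) / 3) := by
      by_contra h5
      push Not at h5
      have h6 := (Finset.mem_sdiff.1 hσ).2
      apply h6
      rw [Finset.mem_biUnion]
      exact ⟨j, Finset.mem_univ _, by simpa [bad] using h5⟩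
    have h5 := abs_add_le (f j σ - (∑ τ, f j τ) / n.factorial)
      ((∑ τ, f j τ) / n.factorial - 2 * (i : ℝ) * n / (ℓ : ℝ) ^ 2)
    rw [sub_add_sub_cancel] at h5
    have h6 := hmean j
    change |f j σ - _| ≤ _
    linarith
end
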